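/- Suppose ω₁ ≤ γ₀ < γ₁ are both L-cardinals. Then SRP^L(γ₁) implies SRP^L(γ₀), and WRP^L(γ₁) implies WRP^L(γ₀). -/

import Mathlib

/-!
Common set-theoretic infrastructure for formalizing the paper
"The strong reflecting property and Harrington's Principle".

We work over Mathlib's `ZFSet.{0}` (a model of ZFC).  First-order satisfaction
for the language of set theory (with two auxiliary unary predicates) is
defined directly; Gödel's constructible hierarchy `L` (and its relativized
versions `L[A]`), hereditarily-small sets `H_κ`, transitive collapses,
clubs, elementary submodels, admissible ordinals, and the various
reflecting properties are all defined from first principles.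
-/

noncomputable section
attribute [local instance] Classical.propDecidable
namespace SRPPaper

open ZFSet

/-- Image of a `ZFSet.{0}` under an arbitrary (classically definable) function. -/
def img (f : ZFSet.{0} → ZFSet.{0}) : ZFSet.{0} → ZFSet.{0} :=
  @ZFSet.image f (Classical.allZFSetDefinable _)

/-! ### First-order formulas and satisfaction -/

/-- First-order formulas in the language `{∈, =, A, B}` where `A`, `B` are
unary predicate symbols; variables are de Bruijn-style indices in `Fin n`. -/
inductive Fml : ℕ → Type
  | mem {n} (i j : Fin n) : Fml n
  | eq {n} (i j : Fin n) : Fml n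
  | inA {n} (i : Fin n) : Fml n
  | inB {n} (i : Fin n) : Fml n
  | not {n} : Fml n → Fml n
  | and {n} : Fml n → Fml n → Fml n
  | ex {n} : Fml (n + 1) → Fml n

/-- Satisfaction over the structure `(S, ∈, A, B)`; quantifiers range over `S`,
the new variable of `ex` gets index `0`. -/
def SatAB (S A B : Set ZFSet.{0}) : ∀ {n}, Fml n → (Fin n → ZFSet.{0}) → Prop
  | _, .mem i j, v => v i ∈ v j
  | _, .eq i j, v => v i = v j
  | _, .inA i, v => v i ∈ A
  | _, .inB i, v => v i ∈ B
  | _, .not φ, v => ¬ SatAB S A B φ v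
  | _, .and φ ψ, v => SatAB S A B φ v ∧ SatAB S A B ψ v
  | _, .ex φ, v => ∃ x ∈ S, SatAB S A B φ (Fin.cons x v)

/-- Pure `∈`-satisfaction over the structure `(S, ∈)`. -/
def Sat (S : Set ZFSet.{0}) {n} (φ : Fml n) (v : Fin n → ZFSet.{0}) : Prop :=
  SatAB S ∅ ∅ φ v

/-- Δ₀ (bounded) formulas. -/
inductive IsDelta0 : ∀ {n}, Fml n → Prop
  | mem {n} (i j : Fin n) : IsDelta0 (.mem i j)
  | eq {n} (i j : Fin n) : IsDelta0 (.eq i j)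
  | inA {n} (i : Fin n) : IsDelta0 (.inA i)
  | inB {n} (i : Fin n) : IsDelta0 (.inB i)
  | not {n} {φ : Fml n} : IsDelta0 φ → IsDelta0 (.not φ)
  | and {n} {φ ψ : Fml n} : IsDelta0 φ → IsDelta0 ψ → IsDelta0 (.and φ ψ)
  | bex {n} (j : Fin (n + 1)) {φ : Fml (n + 1)} : j ≠ 0 → IsDelta0 φ →
      IsDelta0 (.ex (.and (.mem 0 j) φ))

/-- A Gödel code for formulas. -/
def codeF : ∀ {n}, Fml n → ℕ
  | _, .mem i j => Nat.pair 0 (Nat.pair i.val j.val)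
  | _, .eq i j => Nat.pair 1 (Nat.pair i.val j.val)
  | _, .inA i => Nat.pair 2 i.val
  | _, .inB i => Nat.pair 3 i.val
  | _, .not φ => Nat.pair 4 (codeF φ)
  | _, .and φ ψ => Nat.pair 5 (Nat.pair (codeF φ) (codeF ψ))
  | _, .ex φ => Nat.pair 6 (codeF φ)

/-! ### Ordinals, von Neumann naturals -/

/-- `x` is a (von Neumann) ordinal: a transitive set of transitive sets. -/
def IsOrd (x : ZFSet.{0}) : Prop :=
  x.IsTransitive ∧ ∀ y ∈ x, ZFSet.IsTransitive y

/-- `x` is a limit ordinal. -/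
def IsLimitOrd (x : ZFSet.{0}) : Prop :=
  IsOrd x ∧ x ≠ ∅ ∧ ∀ y ∈ x, ∃ z ∈ x, y ∈ z

/-- The `n`-th von Neumann natural number. -/
def natZ : ℕ → ZFSet.{0}
  | 0 => ∅
  | n + 1 => insert (natZ n) (natZ n)

/-- Decoding of von Neumann naturals. -/
def zfToNat (x : ZFSet.{0}) : ℕ :=
  if h : ∃ n : ℕ, natZ n = x then h.choose else 0

/-! ### Coded functions, products -/

/-- The cartesian product of two `ZFSet.{0}`s (as a set of Kuratowski pairs). -/
def prodZ (a b : ZFSet.{0}) : ZFSet.{0} :=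
  ZFSet.sep (fun z => ∃ x, x ∈ a ∧ ∃ y, y ∈ b ∧ z = ZFSet.pair x y)
    (ZFSet.powerset (ZFSet.powerset (a ∪ b)))

/-- `f` codes a surjection from `a` onto `b`. -/
def IsSurjF (a b f : ZFSet.{0}) : Prop :=
  ZFSet.IsFunc a b f ∧ ∀ y, y ∈ b → ∃ x, x ∈ a ∧ ZFSet.pair x y ∈ f

/-- `f` codes an injection from `a` into `b`. -/
def IsInjF (a b f : ZFSet.{0}) : Prop :=
  ZFSet.IsFunc a b f ∧
    ∀ x₁, x₁ ∈ a → ∀ x₂, x₂ ∈ a → ∀ y, ZFSet.pair x₁ y ∈ f → ZFSet.pair x₂ y ∈ f → x₁ = x₂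

/-- The set of values of a coded function `f`. -/
def imageOf (f : ZFSet.{0}) : ZFSet.{0} :=
  ZFSet.sep (fun y => ∃ x, ZFSet.pair x y ∈ f) (ZFSet.sUnion (ZFSet.sUnion f))

/-! ### Cardinals (in `V`) -/

/-- `x` and `y` are equinumerous. -/
def EqNum (x y : ZFSet.{0}) : Prop := Nonempty (x.toSet ≃ y.toSet)

/-- `|x| ≤ |y|`. -/
def CardLE (x y : ZFSet.{0}) : Prop := Nonempty (x.toSet ↪ y.toSet)

/-- `|x| < κ`, for `κ` a cardinal: `x` injects into some member of `κ`. -/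
def CardLT (x κ : ZFSet.{0}) : Prop := ∃ α, α ∈ κ ∧ CardLE x α

/-- `κ` is a cardinal (of `V`). -/
def IsCard (κ : ZFSet.{0}) : Prop := IsOrd κ ∧ ∀ α ∈ κ, ¬ EqNum α κ

/-- `x` is unbounded (cofinal) in the ordinal `κ`. -/
def UnbIn (x κ : ZFSet.{0}) : Prop := ∀ β ∈ κ, ∃ γ ∈ x, β ∈ γ ∨ β = γ

/-- `κ` is a regular cardinal: every cofinal subset of `κ` has size `κ`. -/
def IsRegular (κ : ZFSet.{0}) : Prop :=
  IsCard κ ∧ ∀ x : ZFSet.{0}, x ⊆ κ → UnbIn x κ → EqNum x κ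

/-- The least ordinal satisfying `p` (junk value `∅` if there is none). -/
def leastOrd (p : ZFSet.{0} → Prop) : ZFSet.{0} :=
  if h : ∃ α, (IsOrd α ∧ p α) ∧ ∀ β ∈ α, ¬ (IsOrd β ∧ p β) then h.choose else ∅

/-- The cardinal `ℵₙ` of `V` (`Aleph 0 = ω`). -/
def Aleph : ℕ → ZFSet.{0}
  | 0 => ZFSet.omega
  | n + 1 => leastOrd (fun κ => IsCard κ ∧ Aleph n ∈ κ)

/-- The cardinal successor (in `V`) of `κ`. -/
def SuccCard (κ : ZFSet.{0}) : ZFSet.{0} := leastOrd (fun α => IsCard α ∧ κ ∈ α)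

/-- `X` is countable. -/
def Ctbl (X : ZFSet.{0}) : Prop := X.toSet.Countable

/-- `|X| = ω`: `X` is countably infinite. -/
def CtblInf (X : ZFSet.{0}) : Prop := X.toSet.Countable ∧ X.toSet.Infinite

/-! ### `H_κ`, elementary submodels, transitive collapse -/

/-- The class `H_κ` of sets hereditarily of cardinality `< κ`. -/
def Hset (κ : ZFSet.{0}) : Set ZFSet.{0} :=
  {x | ∃ t : ZFSet.{0}, t.IsTransitive ∧ x ∈ t ∧ CardLT t κ}

/-- `X ≺ S`: `X` is an elementary submodel of the class `(S, ∈)`. -/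
def ElemSub (X : ZFSet.{0}) (S : Set ZFSet.{0}) : Prop :=
  X.toSet ⊆ S ∧ ∀ {n : ℕ} (φ : Fml n) (v : Fin n → ZFSet.{0}),
    (∀ i, v i ∈ X) → (Sat X.toSet φ v ↔ Sat S φ v)

/-- The transitive-collapse map of (the ∈-structure on) `X`:
`collapse X y = {collapse X z | z ∈ y ∩ X}`.  For `γ ∈ X`, `collapse X γ` is
the image `γ̄` of `γ` under the transitive collapse of `X`. -/
def collapse (X : ZFSet.{0}) : ZFSet.{0} → ZFSet.{0} :=
  ZFSet.mem_wf.fix (C := fun _ => ZFSet.{0}) fun y ih =>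
    img (fun z => if h : z ∈ y then ih z h else ∅) (ZFSet.sep (fun z => z ∈ X) y)

/-- The transitive collapse of `X` (as a set). -/
def collapseSet (X : ZFSet.{0}) : ZFSet.{0} := img (fun y => collapse X y) X

/-- The transitive closure of (the members of) `x`. -/
def tcl : ZFSet.{0} → ZFSet.{0} :=
  ZFSet.mem_wf.fix (C := fun _ => ZFSet.{0}) fun x ih =>
    x ∪ ZFSet.sUnion (img (fun y => if h : y ∈ x then ih y h else ∅) x)

/-- The (von Neumann) rank of a set, as an ordinal `ZFSet.{0}`. -/
def rankZ : ZFSet.{0} → ZFSet.{0} :=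
  ZFSet.mem_wf.fix (C := fun _ => ZFSet.{0}) fun x ih =>
    ZFSet.sUnion (img (fun y => if h : y ∈ x then insert (ih y h) (ih y h) else ∅) x)

/-- The order type of a set `X` of ordinals: the unique ordinal `α` such that
`(X, ∈) ≅ (α, ∈)` (junk value `∅` if there is none). -/
def otype (X : ZFSet.{0}) : ZFSet.{0} :=
  if h : ∃ α, IsOrd α ∧ ∃ e : X.toSet ≃ α.toSet,
      ∀ a b : X.toSet, (a : ZFSet.{0}) ∈ (b : ZFSet.{0}) ↔ ((e a : ZFSet.{0}) ∈ (e b : ZFSet.{0}))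
  then h.choose else ∅

/-! ### The constructible hierarchy (relative to a predicate) -/

/-- The set of subsets of `X` definable over `(X, ∈, A)` with parameters. -/
def DefSetA (A : Set ZFSet.{0}) (X : ZFSet.{0}) : ZFSet.{0} :=
  ZFSet.sep (fun B => ∃ (n : ℕ) (φ : Fml (n + 1)) (v : Fin n → ZFSet.{0}),
      (∀ i, v i ∈ X) ∧ B = ZFSet.sep (fun z => SatAB X.toSet A ∅ φ (Fin.cons z v)) X)
    (ZFSet.powerset X)

/-- The hierarchy `L_α[A]`: `LstageA A α = ⋃_{β ∈ α} Def_A (LstageA A β)`. -/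
def LstageA (A : Set ZFSet.{0}) : ZFSet.{0} → ZFSet.{0} :=
  ZFSet.mem_wf.fix (C := fun _ => ZFSet.{0}) fun α ih =>
    ZFSet.sUnion (img (fun β => if h : β ∈ α then DefSetA A (ih β h) else ∅) α)

/-- Gödel's hierarchy `L_α`. -/
def Lstage : ZFSet.{0} → ZFSet.{0} := LstageA ∅

/-- The constructible universe `L`, as a class. -/
def LClass : Set ZFSet.{0} := {x | ∃ α, IsOrd α ∧ x ∈ Lstage α}

/-- The class `L[A]`, for a set `A`. -/
def LrelClass (A : ZFSet.{0}) : Set ZFSet.{0} := {x | ∃ α, IsOrd α ∧ x ∈ LstageA A.toSet α}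

/-- The constructible universe as computed inside a transitive (set or class)
model `W`: the union of the `L_α` for `α` an ordinal of `W`. -/
def LClassIn (W : Set ZFSet.{0}) : Set ZFSet.{0} :=
  {x | ∃ α, IsOrd α ∧ α ∈ W ∧ x ∈ Lstage α}

/-- `κ` is a cardinal in the (transitive) class `W`:
no coded surjection lying in `W` maps some `α < κ` onto `κ`. -/
def CardIn (W : Set ZFSet.{0}) (κ : ZFSet.{0}) : Prop :=
  IsOrd κ ∧ ∀ α, α ∈ κ → ∀ f, f ∈ W → ¬ IsSurjF α κ f

/-- `κ` is an `L`-cardinal. -/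
def LCard (κ : ZFSet.{0}) : Prop := CardIn LClass κ

/-! ### Clubs and stationarity on `[S]^ω` and on `κ` -/

/-- The union of an `ℕ`-indexed family of `ZFSet.{0}`s. -/
def seqUnion (f : ℕ → ZFSet.{0}) : ZFSet.{0} :=
  ZFSet.sUnion (img (fun m => f (zfToNat m)) ZFSet.omega)

/-- `C` is a club of countable subsets of `S`: every member is a countable
subset of `S`, `C` is `⊆`-cofinal in the countable subsets of `S`, and `C` is
closed under unions of countable increasing chains. -/
def ClubSub (S : Set ZFSet.{0}) (C : Set ZFSet.{0}) : Prop :=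
  (∀ X ∈ C, (X : ZFSet.{0}).toSet ⊆ S ∧ CtblInf X) ∧
  (∀ X : ZFSet.{0}, X.toSet ⊆ S → CtblInf X → ∃ Y ∈ C, X ⊆ Y) ∧
  (∀ f : ℕ → ZFSet.{0}, (∀ n, f n ∈ C) → (∀ n, f n ⊆ f (n + 1)) → seqUnion f ∈ C)

/-- `C` is stationary in `[S]^ω`: it meets every club of countable subsets. -/
def StatSub (S : Set ZFSet.{0}) (C : Set ZFSet.{0}) : Prop :=
  ∀ D : Set ZFSet.{0}, ClubSub S D → ∃ X, X ∈ C ∧ X ∈ D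

/-- `D` is a club (closed unbounded set) in the ordinal `κ`. -/
def ClubIn (κ D : ZFSet.{0}) : Prop :=
  D ⊆ κ ∧ (∀ β ∈ κ, ∃ θ, θ ∈ D ∧ β ∈ θ) ∧
  ∀ α, α ∈ κ → α ≠ ∅ → (∀ β ∈ α, ∃ θ, θ ∈ D ∧ θ ∈ α ∧ (β ∈ θ ∨ β = θ)) → α ∈ D

/-- `D` is stationary in the ordinal `κ`. -/
def StatIn (κ D : ZFSet.{0}) : Prop :=
  D ⊆ κ ∧ ∀ C : ZFSet.{0}, ClubIn κ C → ∃ θ, θ ∈ D ∧ θ ∈ C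

/-! ### The strong and weak reflecting properties -/

/-- `SRP^M(γ)` for an inner model given as a class `W`:  for some regular
cardinal `κ > γ`, whenever `X ≺ H_κ` is countable with `γ ∈ X`, the image of
`γ` under the transitive collapse of `X` is a cardinal of `W`. -/
def SRPclass (W : Set ZFSet.{0}) (γ : ZFSet.{0}) : Prop :=
  ∃ κ, IsRegular κ ∧ γ ∈ κ ∧
    ∀ X : ZFSet.{0}, ElemSub X (Hset κ) → CtblInf X → γ ∈ X → CardIn W (collapse X γ)

/-- `SRP^L(γ)`: the strong reflecting property for `L`-cardinals. -/
def SRPL (γ : ZFSet.{0}) : Prop := SRPclass LClass γ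

/-- `WRP^L(γ)`: the weak reflecting property for `L`-cardinals. -/
def WRPL (γ : ZFSet.{0}) : Prop :=
  ∃ κ, IsRegular κ ∧ γ ∈ κ ∧
    ∃ X : ZFSet.{0}, ElemSub X (Hset κ) ∧ CtblInf X ∧ γ ∈ X ∧ LCard (collapse X γ)

/-- `SRP^M_{<λ}(λ)`: for some regular `θ > λ`, every `X ≺ H_θ` with `|X| < λ`
and `λ ∈ X` collapses `λ` to a `W`-cardinal. -/
def SRPlt (W : Set ZFSet.{0}) (lam : ZFSet.{0}) : Prop :=
  ∃ θ, IsRegular θ ∧ lam ∈ θ ∧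
    ∀ X : ZFSet.{0}, ElemSub X (Hset θ) → CardLT X lam → lam ∈ X → CardIn W (collapse X lam)

/-! ### Notions relativized to a transitive (set or class) model `W` -/

/-- `κ` is a regular cardinal in `W`: `κ` is a `W`-cardinal and every coded
function in `W` from some `α < κ` into `κ` is bounded. -/
def RegularIn (W : Set ZFSet.{0}) (κ : ZFSet.{0}) : Prop :=
  CardIn W κ ∧ ∀ α, α ∈ κ → ∀ f, f ∈ W → ZFSet.IsFunc α κ f →
    ∃ β, β ∈ κ ∧ ∀ ξ y, ξ ∈ α → ZFSet.pair ξ y ∈ f → y ∈ β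

/-- `H_κ` as computed in `W`. -/
def HsetIn (W : Set ZFSet.{0}) (κ : ZFSet.{0}) : Set ZFSet.{0} :=
  {x | x ∈ W ∧ ∃ t, t ∈ W ∧ t.IsTransitive ∧ x ∈ t ∧
    ∃ f, f ∈ W ∧ ∃ α, α ∈ κ ∧ IsInjF t α f}

/-- `X` is countable in `W`. -/
def CtblIn (W : Set ZFSet.{0}) (X : ZFSet.{0}) : Prop :=
  X = ∅ ∨ ∃ f, f ∈ W ∧ IsSurjF ZFSet.omega X f

/-- `|X| = ω` in `W`: countable and infinite in `W`. -/
def CtblInfIn (W : Set ZFSet.{0}) (X : ZFSet.{0}) : Prop :=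
  CtblIn W X ∧ ∀ n, n ∈ ZFSet.omega → ∀ f, f ∈ W → ¬ IsSurjF n X f

/-- The `ω₁` of `W`. -/
def omega1In (W : Set ZFSet.{0}) : ZFSet.{0} :=
  leastOrd (fun α => CardIn W α ∧ ZFSet.omega ∈ α)

/-- The `ω₂` of `W`. -/
def omega2In (W : Set ZFSet.{0}) : ZFSet.{0} :=
  leastOrd (fun α => CardIn W α ∧ omega1In W ∈ α)

/-- The cardinal successor of `κ` as computed in `W`. -/
def SuccCardIn (W : Set ZFSet.{0}) (κ : ZFSet.{0}) : ZFSet.{0} :=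
  leastOrd (fun α => CardIn W α ∧ κ ∈ α)

/-- `WRP^L(γ)` as computed inside the (transitive) model `W`:  for some
`κ ∈ W` regular in `W` with `γ < κ` there is an `X ∈ W`, countably infinite
in `W`, with `X ≺ H_κ^W`, `γ ∈ X`, whose collapse sends `γ` to a cardinal of
the `L` of `W`. -/
def WRPLIn (W : Set ZFSet.{0}) (γ : ZFSet.{0}) : Prop :=
  ∃ κ, κ ∈ W ∧ RegularIn W κ ∧ γ ∈ κ ∧
    ∃ X, X ∈ W ∧ ElemSub X (HsetIn W κ) ∧ CtblInfIn W X ∧ γ ∈ X ∧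
      CardIn (LClassIn W) (collapse X γ)

/-- `SRP^L(γ)` as computed inside the (transitive) model `W`. -/
def SRPLIn (W : Set ZFSet.{0}) (γ : ZFSet.{0}) : Prop :=
  ∃ κ, κ ∈ W ∧ RegularIn W κ ∧ γ ∈ κ ∧
    ∀ X, X ∈ W → ElemSub X (HsetIn W κ) → CtblInfIn W X → γ ∈ X →
      CardIn (LClassIn W) (collapse X γ)

/-! ### Models of (fragments of) ZFC, semantically -/

/-- `W` is a transitive model of `ZFC⁻` (ZFC with Power Set deleted and with
Collection), rendered semantically: nonempty, transitive, closed under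
pairing and union, contains `ω`, satisfies full Separation and Collection for
first-order formulas with parameters, and Choice. -/
def ModelsZFCminus (W : Set ZFSet.{0}) : Prop :=
  (∃ x, x ∈ W) ∧
  (∀ x, x ∈ W → x.toSet ⊆ W) ∧
  (∀ x y, x ∈ W → y ∈ W → insert x (insert y (∅ : ZFSet.{0})) ∈ W) ∧
  (∀ x, x ∈ W → ZFSet.sUnion x ∈ W) ∧
  (ZFSet.omega ∈ W) ∧
  (∀ (n : ℕ) (φ : Fml (n + 1)) (v : Fin n → ZFSet.{0}), (∀ i, v i ∈ W) → ∀ a, a ∈ W →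
    ZFSet.sep (fun z => SatAB W ∅ ∅ φ (Fin.cons z v)) a ∈ W) ∧
  (∀ (n : ℕ) (φ : Fml (n + 2)) (v : Fin n → ZFSet.{0}), (∀ i, v i ∈ W) → ∀ a, a ∈ W →
    (∀ x, x ∈ a → ∃ y, y ∈ W ∧ SatAB W ∅ ∅ φ (Fin.cons x (Fin.cons y v))) →
    ∃ b, b ∈ W ∧ ∀ x, x ∈ a → ∃ y, y ∈ b ∧ SatAB W ∅ ∅ φ (Fin.cons x (Fin.cons y v))) ∧
  (∀ x, x ∈ W → (∀ y, y ∈ x → y ≠ ∅) →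
    ∃ c, c ∈ W ∧ ∀ y, y ∈ x → ∃! z, z ∈ y ∧ ZFSet.pair y z ∈ c)

/-- `W` is a transitive model of `ZFC` (with Power Set). -/
def ModelsZFC (W : Set ZFSet.{0}) : Prop :=
  ModelsZFCminus W ∧ ∀ x, x ∈ W → ∃ p, p ∈ W ∧ ∀ z, z ∈ W → (z ∈ p ↔ z ⊆ x)

/-- `W` is a model of `Z₂ = ZFC⁻ +` "every set is countable". -/
def ModelsZ2 (W : Set ZFSet.{0}) : Prop :=
  ModelsZFCminus W ∧ ∀ x, x ∈ W → CtblIn W x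

/-- `p` is the power set of `x` as computed in `W`. -/
def IsPowIn (W : Set ZFSet.{0}) (x p : ZFSet.{0}) : Prop :=
  p ∈ W ∧ ∀ z, z ∈ W → (z ∈ p ↔ z ⊆ x)

/-- `W` is a model of `Z₃ = ZFC⁻ + 𝒫(ω)` exists `+` every set has size `≤ ℶ₁`. -/
def ModelsZ3 (W : Set ZFSet.{0}) : Prop :=
  ModelsZFCminus W ∧ (∃ p, IsPowIn W ZFSet.omega p) ∧
    ∀ x, x ∈ W → ∀ p, IsPowIn W ZFSet.omega p → ∃ f, f ∈ W ∧ IsInjF x p f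

/-- `W` is a model of `Z₄ = ZFC⁻ + 𝒫(𝒫(ω))` exists `+` every set has size `≤ ℶ₂`. -/
def ModelsZ4 (W : Set ZFSet.{0}) : Prop :=
  ModelsZFCminus W ∧
    (∃ p q, IsPowIn W ZFSet.omega p ∧ IsPowIn W p q) ∧
    ∀ x, x ∈ W → ∀ p q, IsPowIn W ZFSet.omega p → IsPowIn W p q →
      ∃ f, f ∈ W ∧ IsInjF x q f

/-! ### Forcing: the Lévy collapse, genericity, generic extensions -/

/-- The Lévy collapse `Col(ω, <κ)`: finite partial functions `p` with
`p(α, n) ∈ α` for `α < κ`, `n < ω`. -/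
def ColLt (κ : ZFSet.{0}) : ZFSet.{0} :=
  ZFSet.sep (fun p => p.toSet.Finite ∧
      (∀ z, z ∈ p → ∃ α n β, α ∈ κ ∧ n ∈ ZFSet.omega ∧ β ∈ α ∧
        z = ZFSet.pair (ZFSet.pair α n) β) ∧
      (∀ α n β β', ZFSet.pair (ZFSet.pair α n) β ∈ p →
        ZFSet.pair (ZFSet.pair α n) β' ∈ p → β = β'))
    (ZFSet.powerset (prodZ (prodZ κ ZFSet.omega) (ZFSet.sUnion κ)))

/-- `G` is a filter on the partial order `P` of partial functions ordered by
reverse inclusion (`p` is stronger than `q` iff `q ⊆ p`) which meets every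
dense subset of `P` lying in the (transitive) model `W`. -/
def GenericOver (W : Set ZFSet.{0}) (P G : ZFSet.{0}) : Prop :=
  G ⊆ P ∧
  (∀ p q, p ∈ G → q ∈ P → q ⊆ p → q ∈ G) ∧
  (∀ p q, p ∈ G → q ∈ G → ∃ r, r ∈ G ∧ p ⊆ r ∧ q ⊆ r) ∧
  (∀ D, D ∈ W → D ⊆ P → (∀ p, p ∈ P → ∃ q, q ∈ D ∧ p ⊆ q) → ∃ q, q ∈ G ∧ q ∈ D)

/-- Genericity for an abstract partial order `R` (a set of pairs) on `P`:
`pair p q ∈ R` means `p` is stronger than (extends) `q`. -/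
def GenericOnP (W : Set ZFSet.{0}) (P R G : ZFSet.{0}) : Prop :=
  G ⊆ P ∧
  (∀ p q, p ∈ G → q ∈ P → ZFSet.pair p q ∈ R → q ∈ G) ∧
  (∀ p q, p ∈ G → q ∈ G → ∃ r, r ∈ G ∧ ZFSet.pair r p ∈ R ∧ ZFSet.pair r q ∈ R) ∧
  (∀ D, D ∈ W → D ⊆ P → (∀ p, p ∈ P → ∃ q, q ∈ D ∧ ZFSet.pair q p ∈ R) →
    ∃ q, q ∈ G ∧ q ∈ D)

/-- Evaluation of a forcing name `τ` by a filter `G`: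
`nameVal G τ = {nameVal G σ | ∃ p ∈ G, (σ, p) ∈ τ}`. -/
def nameVal (G : ZFSet.{0}) : ZFSet.{0} → ZFSet.{0} :=
  (ZFSet.mem_wf.transGen).fix (C := fun _ => ZFSet.{0}) fun τ ih =>
    img (fun σ => if h : Relation.TransGen (· ∈ ·) σ τ then ih σ h else ∅)
      (ZFSet.sep (fun σ => ∃ p, p ∈ G ∧ ZFSet.pair σ p ∈ τ)
        (ZFSet.sUnion (ZFSet.sUnion τ)))

/-- The generic extension `M[G]` of a transitive set model `M`, via names. -/
def extSet (M G : ZFSet.{0}) : Set ZFSet.{0} := {x | ∃ τ, τ ∈ M ∧ x = nameVal G τ}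

/-! ### Remarkable cardinals (Schindler), relative to a ground model class -/

/-- Clubs of countable subsets of `S`, as computed in the (transitive) model
`E`: the club is coded by a set `D ∈ E`, its members are subsets of `S`
countably infinite in `E`, it is cofinal among such sets lying in `E`, and it
is closed under unions of increasing `ω`-chains coded in `E`. -/
def ClubSubIn (E : Set ZFSet.{0}) (S : Set ZFSet.{0}) (D : ZFSet.{0}) : Prop :=
  D ∈ E ∧
  (∀ X, X ∈ D → X.toSet ⊆ S ∧ CtblInfIn E X) ∧
  (∀ X : ZFSet.{0}, X ∈ E → X.toSet ⊆ S → CtblInfIn E X → ∃ Y, Y ∈ D ∧ X ⊆ Y) ∧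
  (∀ g, g ∈ E → ZFSet.IsFunc ZFSet.omega D g →
    (∀ n y y', n ∈ ZFSet.omega → ZFSet.pair n y ∈ g →
      ZFSet.pair (insert n n) y' ∈ g → y ⊆ y') →
    ZFSet.sUnion (imageOf g) ∈ D)

/-- Stationarity of a collection `C` of countable subsets of `S`, as computed
in the model `E`. -/
def StatSubIn (E : Set ZFSet.{0}) (S : Set ZFSet.{0}) (C : Set ZFSet.{0}) : Prop :=
  ∀ D : ZFSet.{0}, ClubSubIn E S D → ∃ X, X ∈ C ∧ X ∈ D

/-- `X` condenses remarkably (with ground model `W`, extension operation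
`Ext` sending a generic object to the corresponding extension of `W`,
collapse height `δ`, target `θ`, and generic `G`):  `X = ran(π)` for some
elementary `π : (H_β^{W[G∩H_α^W]}, ∈, H_β^W, G∩H_α^W) → (H_θ^{W[G]}, ∈, H_θ^W, G)`
with `α = crit(π) < β < δ` and `β` a cardinal of `W`. -/
def CondensesRemarkably (W : Set ZFSet.{0}) (Ext : ZFSet.{0} → Set ZFSet.{0})
    (δ θ G X : ZFSet.{0}) : Prop :=
  ∃ (f : ZFSet.{0} → ZFSet.{0}) (α β : ZFSet.{0}), IsOrd α ∧ α ∈ β ∧ β ∈ δ ∧ CardIn W β ∧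
    (∀ ξ, ξ ∈ α → f ξ = ξ) ∧ f α ≠ α ∧
    (let Gα : ZFSet.{0} := ZFSet.sep (fun p => p ∈ HsetIn W α) G
     let Dom : Set ZFSet.{0} := HsetIn (Ext Gα) β
     let Cod : Set ZFSet.{0} := HsetIn (Ext G) θ
     Set.MapsTo f Dom Cod ∧ X.toSet = f '' Dom ∧
     ∀ (n : ℕ) (φ : Fml n) (v : Fin n → ZFSet.{0}), (∀ i, v i ∈ Dom) →
       (SatAB Dom W Gα.toSet φ v ↔ SatAB Cod W G.toSet φ (f ∘ v)))

/-- `δ` is `θ`-remarkable, in the sense of the (transitive) ground model `W`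
with extensions given by `Ext`: for every `G` which is `Col(ω, <δ)`-generic
over `W`, in `W[G]` the set of countable `X ⊆ H_θ^{W[G]}` which condense
remarkably is stationary. -/
def ThetaRemarkableVia (W : Set ZFSet.{0}) (Ext : ZFSet.{0} → Set ZFSet.{0})
    (δ θ : ZFSet.{0}) : Prop :=
  ∀ G, GenericOver W (ColLt δ) G →
    StatSubIn (Ext G) (HsetIn (Ext G) θ)
      {X | CondensesRemarkably W Ext δ θ G X}

/-- `δ` is remarkable in the sense of `(W, Ext)`:  `θ`-remarkable for every
regular (in `W`) `θ > δ`. -/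
def RemarkableVia (W : Set ZFSet.{0}) (Ext : ZFSet.{0} → Set ZFSet.{0}) (δ : ZFSet.{0}) : Prop :=
  ∀ θ, RegularIn W θ → δ ∈ θ → ThetaRemarkableVia W Ext δ θ

/-! ### Indiscernibles and sharps -/

/-- `I` is a set (or class) of ordinal indiscernibles for the structure
`(S, ∈, A)`. -/
def IndiscFor (S A : Set ZFSet.{0}) (I : Set ZFSet.{0}) : Prop :=
  (∀ x ∈ I, IsOrd x ∧ x ∈ S) ∧
  ∀ (n : ℕ) (φ : Fml n) (v w : Fin n → ZFSet.{0}),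
    (∀ i, v i ∈ I) → (∀ i, w i ∈ I) →
    (∀ i j : Fin n, i < j → v i ∈ v j) → (∀ i j : Fin n, i < j → w i ∈ w j) →
    (SatAB S A ∅ φ v ↔ SatAB S A ∅ φ w)

/-- `0♯` exists: for some uncountable limit ordinal `λ`, `L_λ` has an
uncountable set of indiscernibles. -/
def ZeroSharpExists : Prop :=
  ∃ lam : ZFSet.{0}, IsLimitOrd lam ∧ ¬ lam.toSet.Countable ∧
    ∃ I : ZFSet.{0}, ¬ I.toSet.Countable ∧ IndiscFor (Lstage lam).toSet ∅ I.toSet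

/-- The sharp of `L[A]` exists: for some uncountable limit ordinal `λ`, the
structure `(L_λ[A], ∈, A)` has an uncountable set of indiscernibles. -/
def SharpOverExists (A : ZFSet.{0}) : Prop :=
  ∃ lam : ZFSet.{0}, IsLimitOrd lam ∧ ¬ lam.toSet.Countable ∧
    ∃ I : ZFSet.{0}, ¬ I.toSet.Countable ∧
      IndiscFor (LstageA A.toSet lam).toSet A.toSet I.toSet

/-- `I` is a closed unbounded proper class of ordinals. -/
def ProperClassClub (I : Set ZFSet.{0}) : Prop :=
  (∀ x ∈ I, IsOrd x) ∧
  (∀ α, IsOrd α → ∃ β, IsOrd β ∧ α ∈ β ∧ β ∈ I) ∧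
  (∀ α, IsOrd α → α ≠ ∅ → (∀ β ∈ α, ∃ θ, θ ∈ I ∧ θ ∈ α ∧ (β ∈ θ ∨ β = θ)) → α ∈ I)

/-- `s` is (a real coding) `0♯`: there is a closed unbounded proper class `I`
of Silver indiscernibles for `L` and `s` is the set of codes of formulas
satisfied in `L` by increasing tuples from `I`. -/
def IsZeroSharpReal (s : ZFSet.{0}) : Prop :=
  s ⊆ ZFSet.omega ∧
  ∃ I : Set ZFSet.{0}, ProperClassClub I ∧ IndiscFor LClass ∅ I ∧
    s = ZFSet.sep (fun m => ∃ (n : ℕ) (φ : Fml n) (v : Fin n → ZFSet.{0}),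
          (∀ i, v i ∈ I) ∧ (∀ i j : Fin n, i < j → v i ∈ v j) ∧
          Sat LClass φ v ∧ m = natZ (Nat.pair n (codeF φ))) ZFSet.omega

/-! ### Admissible ordinals and Harrington's Principle -/

/-- The (graph of the) function `f` is `Σ₁`-definable with parameters over the
structure `(S, ∈)`. -/
def Sigma1DefOver (S : Set ZFSet.{0}) (f : ZFSet.{0} → ZFSet.{0}) : Prop :=
  ∃ (n : ℕ) (ψ : Fml (n + 3)), IsDelta0 ψ ∧
    ∃ p : Fin n → ZFSet.{0}, (∀ i, p i ∈ S) ∧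
      ∀ a b, a ∈ S → b ∈ S →
        (f a = b ↔ Sat S (Fml.ex ψ) (Fin.cons a (Fin.cons b p)))

/-- `α` is `x`-admissible: `α > ω` is a limit ordinal and no
`Σ₁(L_α[x])`-definable function maps some `δ < α` cofinally into `α`. -/
def Admissible (x α : ZFSet.{0}) : Prop :=
  IsLimitOrd α ∧ ZFSet.omega ∈ α ∧
  ¬ ∃ δ, δ ∈ α ∧ ∃ f : ZFSet.{0} → ZFSet.{0},
      Sigma1DefOver (LstageA x.toSet α).toSet f ∧
      (∀ β, β ∈ δ → f β ∈ α) ∧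
      ∀ ξ, ξ ∈ α → ∃ β, β ∈ δ ∧ (ξ ∈ f β ∨ ξ = f β)

/-- The generalized Harrington Principle `HP(M)` for the inner model given by
the class `W`: there is a real `x` such that every `x`-admissible ordinal is a
cardinal of `W`. -/
def HPclass (W : Set ZFSet.{0}) : Prop :=
  ∃ x : ZFSet.{0}, x ⊆ ZFSet.omega ∧ ∀ α, Admissible x α → CardIn W α

/-- Harrington's Principle `HP(L)`. -/
def HPL : Prop := HPclass LClass

/-- `HP(L)` as computed inside the (transitive) model `W`. -/
def HPLIn (W : Set ZFSet.{0}) : Prop :=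
  ∃ x, x ∈ W ∧ x ⊆ ZFSet.omega ∧
    ∀ α, α ∈ W → Admissible x α → CardIn (LClassIn W) α

/-! ### Inner models, elementary embeddings, rigidity, covering -/

/-- `W` is an inner model: a transitive proper class containing all ordinals
and satisfying ZFC. -/
def InnerModelClass (W : Set ZFSet.{0}) : Prop :=
  (∀ x, x ∈ W → x.toSet ⊆ W) ∧ (∀ α : ZFSet.{0}, IsOrd α → α ∈ W) ∧ ModelsZFC W

/-- `j` is an elementary embedding of the class `(W, ∈)` into itself. -/
def ElemEmbOn (W : Set ZFSet.{0}) (j : ZFSet.{0} → ZFSet.{0}) : Prop :=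
  Set.MapsTo j W W ∧
  ∀ (n : ℕ) (φ : Fml n) (v : Fin n → ZFSet.{0}),
    (∀ i, v i ∈ W) → (Sat W φ v ↔ Sat W φ (j ∘ v))

/-- `W` has the rigidity property: there is no nontrivial elementary embedding
from `W` to `W`. -/
def RigidClass (W : Set ZFSet.{0}) : Prop :=
  ¬ ∃ j : ZFSet.{0} → ZFSet.{0}, ElemEmbOn W j ∧ ∃ x, x ∈ W ∧ j x ≠ x

/-- `W` has the full covering property: every set `X` of ordinals is covered
by some `Y ∈ W` with `|Y| = |X| + ω₁`. -/
def FullCovering (W : Set ZFSet.{0}) : Prop :=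
  ∀ X : ZFSet.{0}, (∀ z ∈ X, IsOrd z) →
    ∃ Y, Y ∈ W ∧ X ⊆ Y ∧ Nonempty (Y.toSet ≃ (X.toSet ⊕ (Aleph 1).toSet))

/-- The restriction `M|θ` of the inner model `W`: its elements of rank `< θ`. -/
def restrictTo (W : Set ZFSet.{0}) (θ : ZFSet.{0}) : Set ZFSet.{0} :=
  {x | x ∈ W ∧ rankZ x ∈ θ}

/-- The class `S` is definable (with parameters) in `H_θ`. -/
def DefinableInH (θ : ZFSet.{0}) (S : Set ZFSet.{0}) : Prop :=
  ∃ (n : ℕ) (φ : Fml (n + 1)) (v : Fin n → ZFSet.{0}),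
    (∀ i, v i ∈ Hset θ) ∧ ∀ x, x ∈ Hset θ → (x ∈ S ↔ Sat (Hset θ) φ (Fin.cons x v))

/-- `ν` is weakly inaccessible in `W`: a regular limit cardinal of `W`. -/
def WeaklyInaccIn (W : Set ZFSet.{0}) (ν : ZFSet.{0}) : Prop :=
  RegularIn W ν ∧ ZFSet.omega ∈ ν ∧
    ∀ β, β ∈ ν → ∃ δ, δ ∈ ν ∧ β ∈ δ ∧ CardIn W δ

/-! ### Measures, `κ`-models and `0†` -/

/-- `⟨L[U], ∈, U⟩ ⊨ "U is a normal ultrafilter over κ"`:  `L[U]` is a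
`κ`-model. -/
def IsKappaModel (κ U : ZFSet.{0}) : Prop :=
  IsOrd κ ∧ ZFSet.omega ∈ κ ∧ U ∈ LrelClass U ∧
  (∀ X, X ∈ U → X ⊆ κ ∧ X ∈ LrelClass U) ∧ κ ∈ U ∧ (∅ : ZFSet.{0}) ∉ U ∧
  (∀ X Y, X ∈ U → Y ∈ U → X ∩ Y ∈ U) ∧
  (∀ X Y, X ∈ U → Y ∈ LrelClass U → X ⊆ Y → Y ⊆ κ → Y ∈ U) ∧
  (∀ X, X ∈ LrelClass U → X ⊆ κ → (X ∈ U ∨ κ \ X ∈ U)) ∧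
  (∀ α, α ∈ κ → (insert α ∅ : ZFSet.{0}) ∉ U) ∧
  (∀ δ g, δ ∈ κ → g ∈ LrelClass U → ZFSet.IsFunc δ (ZFSet.powerset κ) g →
    (∀ ξ y, ZFSet.pair ξ y ∈ g → y ∈ U) →
    ZFSet.sep (fun β => ∀ ξ, ξ ∈ δ → ∀ y, ZFSet.pair ξ y ∈ g → β ∈ y) κ ∈ U) ∧
  (∀ f X, f ∈ LrelClass U → X ∈ U → ZFSet.IsFunc κ κ f →
    (∀ α, α ∈ X → α ≠ ∅ → ∀ y, ZFSet.pair α y ∈ f → y ∈ α) →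
    ∃ β Y, β ∈ κ ∧ Y ∈ U ∧ ∀ α, α ∈ Y → ZFSet.pair α β ∈ f)

/-- `0†` exists: there is a `κ`-model (for some `κ`) and a nontrivial
elementary embedding from that model to itself with critical point
greater than `κ`. -/
def ZeroDaggerExists : Prop :=
  ∃ κ U : ZFSet.{0}, IsKappaModel κ U ∧
    ∃ j : ZFSet.{0} → ZFSet.{0}, ElemEmbOn (LrelClass U) j ∧
      ∃ η, IsOrd η ∧ κ ∈ η ∧ (∀ β, β ∈ η → j β = β) ∧ j η ≠ η

/-- `U` witnesses that `κ` is a measurable cardinal (in `V`): `U` is a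
`κ`-complete nonprincipal normal ultrafilter on `κ`. -/
def IsMeasureOn (κ U : ZFSet.{0}) : Prop :=
  IsOrd κ ∧ ZFSet.omega ∈ κ ∧
  (∀ X, X ∈ U → X ⊆ κ) ∧ κ ∈ U ∧ (∅ : ZFSet.{0}) ∉ U ∧
  (∀ X Y, X ∈ U → Y ∈ U → X ∩ Y ∈ U) ∧
  (∀ X Y, X ∈ U → X ⊆ Y → Y ⊆ κ → Y ∈ U) ∧
  (∀ X : ZFSet.{0}, X ⊆ κ → (X ∈ U ∨ κ \ X ∈ U)) ∧
  (∀ α, α ∈ κ → (insert α ∅ : ZFSet.{0}) ∉ U) ∧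
  (∀ x : ZFSet.{0}, x.toSet ⊆ U.toSet → CardLT x κ → x ≠ ∅ →
    ZFSet.sep (fun β => ∀ y, y ∈ x → β ∈ y) κ ∈ U) ∧
  (∀ f X, X ∈ U → ZFSet.IsFunc κ κ f →
    (∀ α, α ∈ X → α ≠ ∅ → ∀ y, ZFSet.pair α y ∈ f → y ∈ α) →
    ∃ β Y, β ∈ κ ∧ Y ∈ U ∧ ∀ α, α ∈ Y → ZFSet.pair α β ∈ f)

/-- `κ` is a measurable cardinal. -/
def IsMeasurable (κ : ZFSet.{0}) : Prop := ∃ U, IsMeasureOn κ U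

/-- `U ∈ W` witnesses measurability of `κ` inside the inner model `W`. -/
def MeasurableIn (W : Set ZFSet.{0}) (κ U : ZFSet.{0}) : Prop :=
  U ∈ W ∧ IsOrd κ ∧ ZFSet.omega ∈ κ ∧
  (∀ X, X ∈ U → X ⊆ κ) ∧ κ ∈ U ∧ (∅ : ZFSet.{0}) ∉ U ∧
  (∀ X Y, X ∈ U → Y ∈ U → X ∩ Y ∈ U) ∧
  (∀ X Y, X ∈ U → Y ∈ W → X ⊆ Y → Y ⊆ κ → Y ∈ U) ∧
  (∀ X, X ∈ W → X ⊆ κ → (X ∈ U ∨ κ \ X ∈ U)) ∧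
  (∀ α, α ∈ κ → (insert α ∅ : ZFSet.{0}) ∉ U) ∧
  (∀ δ g, δ ∈ κ → g ∈ W → ZFSet.IsFunc δ (ZFSet.powerset κ) g →
    (∀ ξ y, ZFSet.pair ξ y ∈ g → y ∈ U) →
    ZFSet.sep (fun β => ∀ ξ, ξ ∈ δ → ∀ y, ZFSet.pair ξ y ∈ g → β ∈ y) κ ∈ U)

/-- There is an inner model with a measurable cardinal. -/
def ExistsInnerModelMeasurable : Prop :=
  ∃ W : Set ZFSet.{0}, InnerModelClass W ∧ ∃ κ U, MeasurableIn W κ U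

/-! ### Core-model-like inner models -/

/-- `W` satisfies the GCH. -/
def GCHIn (W : Set ZFSet.{0}) : Prop :=
  ∀ κ, CardIn W κ → (ZFSet.omega ∈ κ ∨ ZFSet.omega = κ) →
    ∃ f, f ∈ W ∧ IsInjF (ZFSet.sep (fun z => z ∈ W) (ZFSet.powerset κ))
      (SuccCardIn W κ) f

/-- `W` has the condensation property: the transitive collapse of any
elementary submodel of an initial segment of `W` is again an initial segment
of `W`. -/
def CondensationFor (W : Set ZFSet.{0}) : Prop :=
  ∀ θ : ZFSet.{0}, IsOrd θ → ∀ X : ZFSet.{0},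
    X.toSet ⊆ restrictTo W θ → ElemSub X (restrictTo W θ) →
    ∃ θ', IsOrd θ' ∧ (collapseSet X).toSet = restrictTo W θ'

/-- The properties of the Dodd–Jensen core model `K` (below a measurable
cardinal) which are relevant here: `K` is an inner model satisfying the GCH,
with condensation, and (by Dodd–Jensen, given that there is no inner model
with a measurable) the rigidity property. -/
def CoreModelProps (W : Set ZFSet.{0}) : Prop :=
  InnerModelClass W ∧ GCHIn W ∧ CondensationFor W ∧ RigidClass W

/-! ### `L(ℝ)`, determinacy, and `HOD` -/

/-- The base of the `L(ℝ)` hierarchy: the transitive closure of `{𝒫(ω)}`. -/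
def lrBase : ZFSet.{0} :=
  insert (ZFSet.powerset ZFSet.omega) (tcl (ZFSet.powerset ZFSet.omega))

/-- The hierarchy `L_α(ℝ)`. -/
def LRstage : ZFSet.{0} → ZFSet.{0} :=
  ZFSet.mem_wf.fix (C := fun _ => ZFSet.{0}) fun α ih =>
    lrBase ∪ ZFSet.sUnion
      (img (fun β => if h : β ∈ α then DefSetA ∅ (ih β h) else ∅) α)

/-- The class `L(ℝ)`. -/
def LRClass : Set ZFSet.{0} := {x | ∃ α, IsOrd α ∧ x ∈ LRstage α}

/-- The `ZFSet` coding the function `ω → ω` given by `g`. -/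
def seqCode (g : ℕ → ℕ) : ZFSet.{0} :=
  img (fun m => ZFSet.pair m (natZ (g (zfToNat m)))) ZFSet.omega

/-- The game on `ω` with payoff `A` (a set of coded functions `ω → ω`) is
determined: one of the two players has a winning strategy. -/
def DeterminedZ (A : ZFSet.{0}) : Prop :=
  (∃ σ : List ℕ → ℕ, ∀ g : ℕ → ℕ,
    (∀ n : ℕ, g (2 * n) = σ (List.ofFn (fun i : Fin (2 * n) => g i.val))) →
    seqCode g ∈ A) ∨
  (∃ τ : List ℕ → ℕ, ∀ g : ℕ → ℕ,
    (∀ n : ℕ, g (2 * n + 1) = τ (List.ofFn (fun i : Fin (2 * n + 1) => g i.val))) →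
    seqCode g ∉ A)

/-- `AD^{L(ℝ)}`: every set of reals in `L(ℝ)` is determined.  (Since every
real, and every strategy, belongs to `L(ℝ)`, this is equivalent to `L(ℝ) ⊨ AD`.) -/
def ADinLR : Prop :=
  ∀ A, A ∈ LRClass → (∀ f, f ∈ A → ZFSet.IsFunc ZFSet.omega ZFSet.omega f) →
    DeterminedZ A

/-- `x` is ordinal definable. -/
def IsOD (x : ZFSet.{0}) : Prop :=
  ∃ (n : ℕ) (φ : Fml (n + 1)) (v : Fin n → ZFSet.{0}),
    (∀ i, IsOrd (v i)) ∧ ∀ y, (Sat Set.univ φ (Fin.cons y v) ↔ y = x)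

/-- The class `HOD` of hereditarily ordinal definable sets. -/
def HODClass : Set ZFSet.{0} :=
  {x | IsOD x ∧ ∀ y, y ∈ tcl x → IsOD y}

/-- The class `L[A]` as computed inside the (transitive) model `W`. -/
def LrelClassIn (W : Set ZFSet.{0}) (A : ZFSet.{0}) : Set ZFSet.{0} :=
  {x | ∃ α, IsOrd α ∧ α ∈ W ∧ x ∈ LstageA A.toSet α}

/-! ## The statement -/

/-! ### Renaming of variables and definable relations -/

/-- Renaming of variables. -/
def Fml.rename : ∀ {n m : ℕ}, (Fin n → Fin m) → Fml n → Fml m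
  | _, _, ρ, .mem i j => .mem (ρ i) (ρ j)
  | _, _, ρ, .eq i j => .eq (ρ i) (ρ j)
  | _, _, ρ, .inA i => .inA (ρ i)
  | _, _, ρ, .inB i => .inB (ρ i)
  | _, _, ρ, .not φ => .not (φ.rename ρ)
  | _, _, ρ, .and φ ψ => .and (φ.rename ρ) (ψ.rename ρ)
  | _, _, ρ, .ex φ => .ex (φ.rename (Fin.cases 0 fun i => (ρ i).succ))

theorem sat_rename {W : Set ZFSet.{0}} : ∀ {n m : ℕ} (ρ : Fin n → Fin m) (φ : Fml n)
    (v : Fin m → ZFSet.{0}), Sat W (φ.rename ρ) v ↔ Sat W φ (v ∘ ρ)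
  | _, _, ρ, .mem i j, v => Iff.rfl
  | _, _, ρ, .eq i j, v => Iff.rfl
  | _, _, ρ, .inA i, v => Iff.rfl
  | _, _, ρ, .inB i, v => Iff.rfl
  | _, _, ρ, .not φ, v => not_congr (sat_rename ρ φ v)
  | _, _, ρ, .and φ ψ, v => and_congr (sat_rename ρ φ v) (sat_rename ρ ψ v)
  | _, _, ρ, .ex φ, v => by
    refine exists_congr fun x => and_congr_right fun _ => ?_
    refine (sat_rename _ φ _).trans (iff_of_eq (congrArg (Sat W φ) ?_))
    funext i
    refine Fin.cases ?_ (fun i => ?_) i <;> simp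

/-- `R` is uniformly definable, without parameters, over the classes in `C`. -/
class Df (C : Set ZFSet.{0} → Prop) {n : ℕ}
    (R : Set ZFSet.{0} → (Fin n → ZFSet.{0}) → Prop) : Prop where
  out : ∃ φ : Fml n, ∀ W, C W → ∀ v, (∀ i, v i ∈ W) → (Sat W φ v ↔ R W v)

/-- Transitive classes. -/
def TransCl (W : Set ZFSet.{0}) : Prop := ∀ x ∈ W, ∀ y ∈ x, y ∈ W

/-- `C` consists of transitive classes. -/
class ImpTrans (C : Set ZFSet.{0} → Prop) : Prop where
  out : ∀ W, C W → TransCl W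

instance : ImpTrans TransCl := ⟨fun _ h => h⟩

theorem cons_mem {W : Set ZFSet.{0}} {n : ℕ} {x : ZFSet.{0}} {v : Fin n → ZFSet.{0}}
    (hx : x ∈ W) (hv : ∀ i, v i ∈ W) (i : Fin (n + 1)) :
    (Fin.cons x v : Fin (n + 1) → ZFSet.{0}) i ∈ W :=
  Fin.cases hx hv i

section Df

variable {C : Set ZFSet.{0} → Prop} {n : ℕ}
variable {R R' : Set ZFSet.{0} → (Fin n → ZFSet.{0}) → Prop}

theorem Df.congr (h : Df C R) (e : ∀ W, C W → ∀ v, (∀ i, v i ∈ W) → (R W v ↔ R' W v)) :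
    Df C R' :=
  let ⟨φ, hφ⟩ := h.out
  ⟨φ, fun W hW v hv => (hφ W hW v hv).trans (e W hW v hv)⟩

instance Df.sat (φ : Fml n) : Df C (fun W v => Sat W φ v) := ⟨φ, fun _ _ _ _ => Iff.rfl⟩

theorem Df.comp {m : ℕ} (ρ : Fin n → Fin m) (h : Df C R) : Df C (fun W v => R W (v ∘ ρ)) :=
  let ⟨φ, hφ⟩ := h.out
  ⟨φ.rename ρ, fun W hW _ hv => (sat_rename ρ φ _).trans (hφ W hW _ fun i => hv (ρ i))⟩

theorem Df.tail (h : Df C R) : Df C (fun W (w : Fin (n + 1) → ZFSet.{0}) => R W (Fin.tail w)) :=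
  h.comp Fin.succ

theorem Df.mem_var (i j : Fin n) : Df C (fun _ v => v i ∈ v j) :=
  ⟨.mem i j, fun _ _ _ _ => Iff.rfl⟩

theorem Df.eq_var (i j : Fin n) : Df C (fun _ v => v i = v j) :=
  ⟨.eq i j, fun _ _ _ _ => Iff.rfl⟩

instance Df.not [h : Df C R] : Df C (fun W v => ¬ R W v) :=
  let ⟨φ, hφ⟩ := h.out
  ⟨.not φ, fun W hW v hv => not_congr (hφ W hW v hv)⟩

instance Df.and [h : Df C R] [h' : Df C R'] : Df C (fun W v => R W v ∧ R' W v) :=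
  let ⟨φ, hφ⟩ := h.out
  let ⟨ψ, hψ⟩ := h'.out
  ⟨.and φ ψ, fun W hW v hv => and_congr (hφ W hW v hv) (hψ W hW v hv)⟩

instance Df.or [Df C R] [Df C R'] : Df C (fun W v => R W v ∨ R' W v) :=
  (inferInstance : Df C fun W v => ¬ (¬ R W v ∧ ¬ R' W v)).congr fun _ _ _ _ => by tauto

instance Df.imp [Df C R] [Df C R'] : Df C (fun W v => R W v → R' W v) :=
  (inferInstance : Df C fun W v => ¬ (R W v ∧ ¬ R' W v)).congr fun _ _ _ _ => by tauto

instance Df.iff [Df C R] [Df C R'] : Df C (fun W v => R W v ↔ R' W v) :=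
  (inferInstance : Df C fun W v => (R W v → R' W v) ∧ (R' W v → R W v)).congr
    fun _ _ _ _ => by tauto

variable {Q : Set ZFSet.{0} → ZFSet.{0} → (Fin n → ZFSet.{0}) → Prop}

instance Df.ex [h : Df C (fun W (w : Fin (n + 1) → ZFSet.{0}) => Q W (w 0) (Fin.tail w))] :
    Df C (fun W v => ∃ x ∈ W, Q W x v) :=
  let ⟨φ, hφ⟩ := h.out
  ⟨.ex φ, fun W hW v hv => exists_congr fun x => and_congr_right fun hx =>
    hφ W hW (Fin.cons x v) (cons_mem hx hv)⟩

instance Df.all [Df C (fun W (w : Fin (n + 1) → ZFSet.{0}) => Q W (w 0) (Fin.tail w))] :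
    Df C (fun W v => ∀ x ∈ W, Q W x v) :=
  (inferInstance : Df C fun W v => ¬ ∃ x ∈ W, ¬ Q W x v).congr fun _ _ _ _ => by
    push Not; rfl

/-- `f` is an operation under which the classes in `C` are closed and whose graph is uniformly
definable over these classes. -/
class Tm (C : Set ZFSet.{0} → Prop) {n : ℕ} (f : (Fin n → ZFSet.{0}) → ZFSet.{0}) : Prop where
  mem : ∀ W, C W → ∀ v, (∀ i, v i ∈ W) → f v ∈ W
  graph : Df C fun _ (w : Fin (n + 1) → ZFSet.{0}) => w 0 = f (Fin.tail w)

instance Tm.var (i : Fin n) : Tm C (fun v => v i) := ⟨fun _ _ _ h => h i, Df.eq_var 0 i.succ⟩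

instance Tm.tail (i : Fin n) : Tm C (fun v : Fin (n + 1) → ZFSet.{0} => Fin.tail v i) :=
  Tm.var i.succ

instance Tm.tail2 (i : Fin n) :
    Tm C (fun v : Fin (n + 2) → ZFSet.{0} => Fin.tail (Fin.tail v) i) :=
  Tm.var i.succ.succ

instance Tm.tail3 (i : Fin n) :
    Tm C (fun v : Fin (n + 3) → ZFSet.{0} => Fin.tail (Fin.tail (Fin.tail v)) i) :=
  Tm.var i.succ.succ.succ

instance Tm.tail4 (i : Fin n) :
    Tm C (fun v : Fin (n + 4) → ZFSet.{0} => Fin.tail (Fin.tail (Fin.tail (Fin.tail v))) i) :=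
  Tm.var i.succ.succ.succ.succ

instance Tm.tail5 (i : Fin n) : Tm C (fun v : Fin (n + 5) → ZFSet.{0} =>
    Fin.tail (Fin.tail (Fin.tail (Fin.tail (Fin.tail v)))) i) :=
  Tm.var i.succ.succ.succ.succ.succ

/-- Substitution of a term for the first variable. -/
theorem Df.subst {f : (Fin n → ZFSet.{0}) → ZFSet.{0}} [hf : Tm C f]
    (h : Df C (fun W (w : Fin (n + 1) → ZFSet.{0}) => Q W (w 0) (Fin.tail w))) :
    Df C (fun W v => Q W (f v) v) :=
  have := hf.graph
  (inferInstance : Df C fun W v => ∃ x ∈ W, x = f v ∧ Q W x v).congr fun W hW v hv =>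
    ⟨fun ⟨_, _, e, h⟩ => e ▸ h, fun h => ⟨_, hf.mem W hW v hv, rfl, h⟩⟩

theorem Tm.weak {f : (Fin n → ZFSet.{0}) → ZFSet.{0}} (hf : Tm C f) :
    Tm C fun w : Fin (n + 1) → ZFSet.{0} => f (Fin.tail w) :=
  ⟨fun W hW v hv => hf.mem W hW _ fun i => hv i.succ, by
    have := hf.graph.comp (Fin.cases 0 fun i => i.succ.succ : Fin (n + 1) → Fin (n + 2))
    exact this⟩

theorem Df.comp1 {P : Set ZFSet.{0} → ZFSet.{0} → Prop}
    (h : Df C fun W (w : Fin 1 → ZFSet.{0}) => P W (w 0))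
    {f : (Fin n → ZFSet.{0}) → ZFSet.{0}} [Tm C f] : Df C fun W v => P W (f v) :=
  Df.subst (Q := fun W x _ => P W x) (h.comp fun _ => 0)

theorem Df.comp2 {P : Set ZFSet.{0} → ZFSet.{0} → ZFSet.{0} → Prop}
    (h : Df C fun W (w : Fin 2 → ZFSet.{0}) => P W (w 0) (w 1))
    {f g : (Fin n → ZFSet.{0}) → ZFSet.{0}} [Tm C f] [hg : Tm C g] :
    Df C fun W v => P W (f v) (g v) :=
  Df.subst (Q := fun W x v => P W x (g v)) <|
    have := hg.weak
    Df.subst (Q := fun W y v => P W (v 0) y) (h.comp ![1, 0])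

theorem Df.comp3 {P : Set ZFSet.{0} → ZFSet.{0} → ZFSet.{0} → ZFSet.{0} → Prop}
    (h : Df C fun W (w : Fin 3 → ZFSet.{0}) => P W (w 0) (w 1) (w 2))
    {f g k : (Fin n → ZFSet.{0}) → ZFSet.{0}} [Tm C f] [hg : Tm C g] [hk : Tm C k] :
    Df C fun W v => P W (f v) (g v) (k v) :=
  Df.subst (Q := fun W x v => P W x (g v) (k v)) <|
    have := hg.weak
    have := hk.weak
    Df.subst (Q := fun W y v => P W (v 0) y (k (Fin.tail v))) <|
      have := hk.weak.weak
      Df.subst (Q := fun W y v => P W (v 1) (v 0) y) (h.comp ![2, 1, 0])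

theorem Df.comp4 {P : Set ZFSet.{0} → ZFSet.{0} → ZFSet.{0} → ZFSet.{0} → ZFSet.{0} → Prop}
    (h : Df C fun W (w : Fin 4 → ZFSet.{0}) => P W (w 0) (w 1) (w 2) (w 3))
    {f g k l : (Fin n → ZFSet.{0}) → ZFSet.{0}} [Tm C f] [hg : Tm C g] [hk : Tm C k]
    [hl : Tm C l] : Df C fun W v => P W (f v) (g v) (k v) (l v) :=
  Df.subst (Q := fun W x v => P W x (g v) (k v) (l v)) <|
    have := hg.weak
    have := hk.weak
    have := hl.weak
    Df.subst (Q := fun W y v => P W (v 0) y (k (Fin.tail v)) (l (Fin.tail v))) <|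
      have := hk.weak.weak
      have := hl.weak.weak
      Df.subst (Q := fun W y v => P W (v 1) (v 0) y (l (Fin.tail (Fin.tail v)))) <|
        have := hl.weak.weak.weak
        Df.subst (Q := fun W y v => P W (v 2) (v 1) (v 0) y) (h.comp ![3, 2, 1, 0])

theorem Tm.comp1 {F : ZFSet.{0} → ZFSet.{0}} (h : Tm C fun w : Fin 1 → ZFSet.{0} => F (w 0))
    {f : (Fin n → ZFSet.{0}) → ZFSet.{0}} [hf : Tm C f] : Tm C fun v => F (f v) :=
  ⟨fun W hW v hv => h.mem W hW ![f v] (by simpa using hf.mem W hW v hv),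
    have := hf.weak
    Df.comp2 (P := fun _ y x => y = F x) h.graph⟩

theorem Tm.comp2 {F : ZFSet.{0} → ZFSet.{0} → ZFSet.{0}}
    (h : Tm C fun w : Fin 2 → ZFSet.{0} => F (w 0) (w 1))
    {f g : (Fin n → ZFSet.{0}) → ZFSet.{0}} [hf : Tm C f] [hg : Tm C g] :
    Tm C fun v => F (f v) (g v) :=
  ⟨fun W hW v hv => h.mem W hW ![f v, g v] (by
      simpa [Fin.forall_fin_two] using ⟨hf.mem W hW v hv, hg.mem W hW v hv⟩),
    have := hf.weak
    have := hg.weak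
    Df.comp3 (P := fun _ y x z => y = F x z) h.graph⟩

theorem Tm.comp3 {F : ZFSet.{0} → ZFSet.{0} → ZFSet.{0} → ZFSet.{0}}
    (h : Tm C fun w : Fin 3 → ZFSet.{0} => F (w 0) (w 1) (w 2))
    {f g k : (Fin n → ZFSet.{0}) → ZFSet.{0}} [hf : Tm C f] [hg : Tm C g] [hk : Tm C k] :
    Tm C fun v => F (f v) (g v) (k v) :=
  ⟨fun W hW v hv => h.mem W hW ![f v, g v, k v] (by
      intro i
      fin_cases i
      exacts [hf.mem W hW v hv, hg.mem W hW v hv, hk.mem W hW v hv]),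
    have := hf.weak
    have := hg.weak
    have := hk.weak
    Df.comp4 (P := fun _ y x z u => y = F x z u) h.graph⟩

instance Df.mem {f g : (Fin n → ZFSet.{0}) → ZFSet.{0}} [Tm C f] [Tm C g] :
    Df C fun _ v => f v ∈ g v :=
  Df.comp2 (P := fun _ x y => x ∈ y) (Df.mem_var 0 1)

instance Df.eq {f g : (Fin n → ZFSet.{0}) → ZFSet.{0}} [Tm C f] [Tm C g] :
    Df C fun _ v => f v = g v :=
  Df.comp2 (P := fun _ x y => x = y) (Df.eq_var 0 1)

instance Df.bex [hC : ImpTrans C] {f : (Fin n → ZFSet.{0}) → ZFSet.{0}} [hf : Tm C f]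
    [Df C (fun W (w : Fin (n + 1) → ZFSet.{0}) => Q W (w 0) (Fin.tail w))] :
    Df C (fun W v => ∃ x ∈ f v, Q W x v) :=
  have := hf.weak
  (inferInstance : Df C fun W v => ∃ x ∈ W, x ∈ f v ∧ Q W x v).congr fun W hW v hv =>
    exists_congr fun _ => ⟨fun h => h.2, fun h => ⟨hC.out W hW _ (hf.mem W hW v hv) _ h.1, h⟩⟩

instance Df.ball [hC : ImpTrans C] {f : (Fin n → ZFSet.{0}) → ZFSet.{0}} [hf : Tm C f]
    [Df C (fun W (w : Fin (n + 1) → ZFSet.{0}) => Q W (w 0) (Fin.tail w))] :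
    Df C (fun W v => ∀ x ∈ f v, Q W x v) :=
  (inferInstance : Df C fun W v => ¬ ∃ x ∈ f v, ¬ Q W x v).congr fun _ _ _ _ => by
    push Not; rfl

end Df

/-! ### Semantic models of `ZF` without power sets -/

/-- Transitive classes satisfying the axioms of `ZF` without the power set axiom. -/
structure ZF (W : Set ZFSet.{0}) : Prop where
  trans : TransCl W
  ind : ∃ o ∈ W, ∅ ∈ o ∧ ∀ n ∈ o, insert n n ∈ o
  pair : ∀ x ∈ W, ∀ y ∈ W, ({x, y} : ZFSet.{0}) ∈ W
  sUnion : ∀ x ∈ W, (⋃₀ x : ZFSet.{0}) ∈ W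
  sep : ∀ {n : ℕ} (φ : Fml (n + 1)) (v : Fin n → ZFSet.{0}), (∀ i, v i ∈ W) → ∀ a ∈ W,
    ZFSet.sep (fun z => Sat W φ (Fin.cons z v)) a ∈ W
  coll : ∀ {n : ℕ} (φ : Fml (n + 2)) (v : Fin n → ZFSet.{0}), (∀ i, v i ∈ W) → ∀ a ∈ W,
    (∀ x ∈ a, ∃ y ∈ W, Sat W φ (Fin.cons y (Fin.cons x v))) →
      ∃ b ∈ W, ∀ x ∈ a, ∃ y ∈ b, y ∈ W ∧ Sat W φ (Fin.cons y (Fin.cons x v))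

instance : ImpTrans ZF := ⟨fun _ h => h.trans⟩

theorem mem_img {f : ZFSet.{0} → ZFSet.{0}} {a y : ZFSet.{0}} :
    y ∈ img f a ↔ ∃ x ∈ a, f x = y :=
  @ZFSet.mem_image f (Classical.allZFSetDefinable _) a y

theorem img_congr {f g : ZFSet.{0} → ZFSet.{0}} {a : ZFSet.{0}} (h : ∀ x ∈ a, f x = g x) :
    img f a = img g a := by
  ext y
  simp only [mem_img]
  exact exists_congr fun x => and_congr_right fun hx => by rw [h x hx]

theorem sep_congr {p q : ZFSet.{0} → Prop} {a : ZFSet.{0}} (h : ∀ x ∈ a, (p x ↔ q x)) :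
    ZFSet.sep p a = ZFSet.sep q a := by
  ext y
  simp only [ZFSet.mem_sep]
  exact and_congr_right fun hx => h y hx

section ZF

variable {W : Set ZFSet.{0}} (hW : ZF W)
include hW

theorem ZF.sep' {n : ℕ} {R : Set ZFSet.{0} → (Fin (n + 1) → ZFSet.{0}) → Prop} (hR : Df ZF R)
    {v : Fin n → ZFSet.{0}} (hv : ∀ i, v i ∈ W) {a : ZFSet.{0}} (ha : a ∈ W) :
    ZFSet.sep (fun z => R W (Fin.cons z v)) a ∈ W := by
  obtain ⟨φ, hφ⟩ := hR.out
  rw [← sep_congr fun z hz => hφ W hW _ (cons_mem (hW.trans a ha z hz) hv)]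
  exact hW.sep φ v hv a ha

theorem ZF.coll' {n : ℕ} {R : Set ZFSet.{0} → (Fin (n + 2) → ZFSet.{0}) → Prop} (hR : Df ZF R)
    {v : Fin n → ZFSet.{0}} (hv : ∀ i, v i ∈ W) {a : ZFSet.{0}} (ha : a ∈ W)
    (h : ∀ x ∈ a, ∃ y ∈ W, R W (Fin.cons y (Fin.cons x v))) :
    ∃ b ∈ W, ∀ x ∈ a, ∃ y ∈ b, y ∈ W ∧ R W (Fin.cons y (Fin.cons x v)) := by
  obtain ⟨φ, hφ⟩ := hR.out
  have key : ∀ x ∈ a, ∀ y ∈ W, (Sat W φ (Fin.cons y (Fin.cons x v)) ↔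
      R W (Fin.cons y (Fin.cons x v))) := fun x hx y hy =>
    hφ W hW _ (cons_mem hy (cons_mem (hW.trans a ha x hx) hv))
  obtain ⟨b, hb, h'⟩ := hW.coll φ v hv a ha fun x hx =>
    let ⟨y, hy, hh⟩ := h x hx
    ⟨y, hy, (key x hx y hy).2 hh⟩
  exact ⟨b, hb, fun x hx => let ⟨y, hy, hyW, hh⟩ := h' x hx; ⟨y, hy, hyW, (key x hx y hyW).1 hh⟩⟩

theorem ZF.img' {n : ℕ} {f : ZFSet.{0} → (Fin n → ZFSet.{0}) → ZFSet.{0}}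
    (hf : Df ZF fun _ (w : Fin (n + 2) → ZFSet.{0}) =>
      w 0 = f (Fin.tail w 0) (Fin.tail (Fin.tail w)))
    {v : Fin n → ZFSet.{0}} (hv : ∀ i, v i ∈ W) {a : ZFSet.{0}} (ha : a ∈ W)
    (h : ∀ x ∈ a, f x v ∈ W) : img (fun x => f x v) a ∈ W := by
  obtain ⟨b, hb, h'⟩ := hW.coll' hf hv ha fun x hx => ⟨f x v, h x hx, rfl⟩
  have hsep := hW.sep' (R := fun _ (w : Fin (n + 2) → ZFSet.{0}) =>
    ∃ x ∈ Fin.tail w 0, w 0 = f x (Fin.tail (Fin.tail w)))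
    (by
      have := hf.comp (Fin.cases 1 (Fin.cases 0 fun i => i.succ.succ.succ) :
        Fin (n + 2) → Fin (n + 3))
      have h' : Df ZF fun _ (w : Fin (n + 3) → ZFSet.{0}) =>
        Fin.tail w 0 = f (w 0) (Fin.tail (Fin.tail (Fin.tail w))) := this
      exact Df.bex) (cons_mem ha hv) hb
  convert hsep using 1
  ext y
  simp only [mem_img, ZFSet.mem_sep]
  constructor
  · rintro ⟨x, hx, rfl⟩
    obtain ⟨y, hy, -, e⟩ := h' x hx
    simp at e
    subst e
    exact ⟨hy, x, hx, rfl⟩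
  · rintro ⟨hy, x, hx, e⟩
    exact ⟨x, hx, e.symm⟩

theorem ZF.insert {x y : ZFSet.{0}} (hx : x ∈ W) (hy : y ∈ W) : insert x y ∈ W := by
  have h := hW.sUnion _ (hW.pair _ (hW.pair x hx x hx) _ hy)
  convert h using 1
  ext z
  simp

theorem ZF.empty : (∅ : ZFSet.{0}) ∈ W :=
  let ⟨o, ho, h, _⟩ := hW.ind
  hW.trans o ho _ h

theorem ZF.pair_mem {x y : ZFSet.{0}} (hx : x ∈ W) (hy : y ∈ W) : ZFSet.pair x y ∈ W :=
  hW.pair _ (by simpa using hW.pair x hx x hx) _ (hW.pair x hx y hy)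

end ZF

/-! ### Basic operations -/

theorem isOrd_iff {x : ZFSet.{0}} : IsOrd x ↔ x.IsOrdinal :=
  ZFSet.isOrdinal_iff_forall_mem_isTransitive.symm

/-- The first component of an ordered pair. -/
def zfst (e : ZFSet.{0}) : ZFSet.{0} :=
  ⋃₀ ZFSet.sep (fun x => ∃ y ∈ (⋃₀ e : ZFSet.{0}), e = pair x y) (⋃₀ e)

/-- The second component of an ordered pair. -/
def zsnd (e : ZFSet.{0}) : ZFSet.{0} :=
  ⋃₀ ZFSet.sep (fun y => ∃ x ∈ (⋃₀ e : ZFSet.{0}), e = pair x y) (⋃₀ e)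

/-- Application of a set function. -/
def app (g a : ZFSet.{0}) : ZFSet.{0} :=
  ⋃₀ ZFSet.sep (fun b => pair a b ∈ g) (⋃₀ (⋃₀ g : ZFSet.{0}))

/-- The graph of `f` on `a`. -/
def gr (f : ZFSet.{0} → ZFSet.{0}) (a : ZFSet.{0}) : ZFSet.{0} := img (fun z => pair z (f z)) a

theorem left_mem_sUnion_pair (x y : ZFSet.{0}) : x ∈ (⋃₀ pair x y : ZFSet.{0}) :=
  ZFSet.mem_sUnion.2 ⟨{x}, by simp [pair], by simp⟩

theorem right_mem_sUnion_pair (x y : ZFSet.{0}) : y ∈ (⋃₀ pair x y : ZFSet.{0}) :=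
  ZFSet.mem_sUnion.2 ⟨{x, y}, by simp [pair], by simp⟩

theorem sUnion_sep_eq {p : ZFSet.{0} → Prop} {a x : ZFSet.{0}} (hx : x ∈ a) (hp : p x)
    (h : ∀ y, p y → y = x) : (⋃₀ ZFSet.sep p a : ZFSet.{0}) = x := by
  ext z
  simp only [ZFSet.mem_sUnion, ZFSet.mem_sep]
  constructor
  · rintro ⟨y, ⟨_, hy⟩, hz⟩
    exact h y hy ▸ hz
  · exact fun hz => ⟨x, ⟨hx, hp⟩, hz⟩

@[simp] theorem zfst_pair (x y : ZFSet.{0}) : zfst (pair x y) = x :=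
  sUnion_sep_eq (left_mem_sUnion_pair x y) ⟨y, right_mem_sUnion_pair x y, rfl⟩
    fun _ ⟨_, _, h⟩ => (ZFSet.pair_inj.1 h).1.symm

@[simp] theorem zsnd_pair (x y : ZFSet.{0}) : zsnd (pair x y) = y :=
  sUnion_sep_eq (right_mem_sUnion_pair x y) ⟨x, left_mem_sUnion_pair x y, rfl⟩
    fun _ ⟨_, _, h⟩ => (ZFSet.pair_inj.1 h).2.symm

theorem app_eq {g a b : ZFSet.{0}} (h : pair a b ∈ g) (hu : ∀ c, pair a c ∈ g → c = b) :
    app g a = b := by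
  refine sUnion_sep_eq ?_ h hu
  refine ZFSet.mem_sUnion.2 ⟨{a, b}, ZFSet.mem_sUnion.2 ⟨_, h, by simp [pair]⟩, by simp⟩

theorem mem_gr {f : ZFSet.{0} → ZFSet.{0}} {a p : ZFSet.{0}} :
    p ∈ gr f a ↔ ∃ z ∈ a, pair z (f z) = p := mem_img

theorem pair_mem_gr {f : ZFSet.{0} → ZFSet.{0}} {a x y : ZFSet.{0}} :
    pair x y ∈ gr f a ↔ x ∈ a ∧ f x = y := by
  simp only [mem_gr, ZFSet.pair_inj]
  constructor
  · rintro ⟨z, hz, rfl, h⟩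
    exact ⟨hz, h⟩
  · rintro ⟨h, h'⟩
    exact ⟨x, h, rfl, h'⟩

theorem app_gr {f : ZFSet.{0} → ZFSet.{0}} {a x : ZFSet.{0}} (hx : x ∈ a) :
    app (gr f a) x = f x :=
  app_eq (pair_mem_gr.2 ⟨hx, rfl⟩) fun _ h => (pair_mem_gr.1 h).2.symm

theorem gr_congr {f g : ZFSet.{0} → ZFSet.{0}} {a : ZFSet.{0}} (h : ∀ x ∈ a, f x = g x) :
    gr f a = gr g a :=
  img_congr fun x hx => by rw [h x hx]

theorem mem_omega {z : ZFSet.{0}} : z ∈ ZFSet.omega ↔ ∃ n, natZ n = z := by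
  constructor
  · refine Quotient.inductionOn z fun p hp => ?_
    have key : ∀ n, natZ n = ZFSet.mk (PSet.ofNat n) := by
      intro n
      induction n with
      | zero => rfl
      | succ n ih => rw [natZ, ih]; rfl
    obtain ⟨⟨n⟩, hn⟩ : p ∈ PSet.omega := hp
    exact ⟨n, (key n).trans (ZFSet.sound hn.symm)⟩
  · rintro ⟨n, rfl⟩
    induction n with
    | zero => exact ZFSet.omega_zero
    | succ n ih => exact ZFSet.omega_succ ih

theorem isOrdinal_natZ : ∀ n, (natZ n).IsOrdinal
  | 0 => ZFSet.isOrdinal_empty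
  | n + 1 => ZFSet.isOrdinal_succ (isOrdinal_natZ n)

theorem isOrdinal_omega : ZFSet.omega.{0}.IsOrdinal := by
  refine ZFSet.isOrdinal_iff_forall_mem_isOrdinal.2 ⟨fun x hx => ?_, fun x hx => ?_⟩
  · obtain ⟨n, rfl⟩ := mem_omega.1 hx
    clear hx
    induction n with
    | zero => exact fun y hy => absurd hy (ZFSet.notMem_empty y)
    | succ n ih =>
      intro y hy
      rcases ZFSet.mem_insert_iff.1 hy with rfl | hy
      exacts [mem_omega.2 ⟨_, rfl⟩, ih hy]
  · obtain ⟨n, rfl⟩ := mem_omega.1 hx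
    exact isOrdinal_natZ n

/-! ### Definability of the basic operations over models of `ZF` -/

section Basic

variable {n : ℕ} {f g k : (Fin n → ZFSet.{0}) → ZFSet.{0}}

instance [Tm ZF f] [Tm ZF g] : Df ZF fun _ v => f v ⊆ g v :=
  Df.comp2 (P := fun _ x y => x ⊆ y) <|
    (inferInstance : Df ZF fun _ (w : Fin 2 → ZFSet.{0}) => ∀ z ∈ w 0, z ∈ w 1).congr
      fun _ _ _ _ => Iff.rfl

instance [Tm ZF f] : Df ZF fun _ v => ZFSet.IsTransitive (f v) :=
  Df.comp1 (P := fun _ x => ZFSet.IsTransitive x) <|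
    (inferInstance : Df ZF fun _ (w : Fin 1 → ZFSet.{0}) => ∀ z ∈ w 0, z ⊆ w 0).congr
      fun _ _ _ _ => Iff.rfl

instance [Tm ZF f] : Df ZF fun _ v => IsOrd (f v) :=
  Df.comp1 (P := fun _ x => IsOrd x) <|
    (inferInstance : Df ZF fun _ (w : Fin 1 → ZFSet.{0}) =>
      (w 0).IsTransitive ∧ ∀ z ∈ w 0, ZFSet.IsTransitive z)

theorem Tm.of_mem {F : (Fin n → ZFSet.{0}) → ZFSet.{0}}
    (hm : ∀ W, ZF W → ∀ v, (∀ i, v i ∈ W) → F v ∈ W)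
    {R : ZFSet.{0} → (Fin n → ZFSet.{0}) → Prop} (hF : ∀ z v, z ∈ F v ↔ R z v)
    (hR : Df ZF fun _ (w : Fin (n + 1) → ZFSet.{0}) => R (w 0) (Fin.tail w)) : Tm ZF F := by
  refine ⟨hm, ?_⟩
  have := hR.comp (Fin.cases 0 fun i => i.succ.succ : Fin (n + 1) → Fin (n + 2))
  have h' : Df ZF fun _ (w : Fin (n + 2) → ZFSet.{0}) => R (w 0) (Fin.tail (Fin.tail w)) := this
  refine (inferInstance : Df ZF fun W (w : Fin (n + 1) → ZFSet.{0}) =>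
    ∀ z ∈ W, (z ∈ w 0 ↔ R z (Fin.tail w))).congr fun W hW w hw => ?_
  constructor
  · intro h
    ext z
    rw [hF]
    constructor
    · exact fun hz => (h z (hW.trans _ (hw 0) _ hz)).1 hz
    · exact fun hz =>
        (h z (hW.trans _ (hm W hW (Fin.tail w) fun i => hw i.succ) _ ((hF _ _).2 hz))).2 hz
  · intro h z _
    rw [h, hF]

instance : Tm ZF fun _ : Fin n → ZFSet.{0} => (∅ : ZFSet.{0}) :=
  Tm.of_mem (R := fun z _ => ¬ z = z) (fun _ hW _ _ => hW.empty) (fun z v => by simp)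
    inferInstance

instance [Tm ZF f] [Tm ZF g] : Tm ZF fun v => (insert (f v) (g v) : ZFSet.{0}) :=
  Tm.comp2 (F := fun x y => insert x y) <|
    Tm.of_mem (R := fun z w => z = w 0 ∨ z ∈ w 1) (fun _ hW _ hv => hW.insert (hv 0) (hv 1))
      (fun z v => by simp) inferInstance

instance [Tm ZF f] : Tm ZF fun v => ({f v} : ZFSet.{0}) :=
  Tm.comp1 (F := fun x => {x}) <|
    Tm.of_mem (R := fun z w => z = w 0) (fun _ hW _ hv => by
      simpa using hW.pair _ (hv 0) _ (hv 0)) (fun z v => by simp) inferInstance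

instance [Tm ZF f] [Tm ZF g] : Tm ZF fun v => pair (f v) (g v) :=
  (inferInstance : Tm ZF fun v => ({{f v}, {f v, g v}} : ZFSet.{0}))

instance [Tm ZF f] : Tm ZF fun v => (⋃₀ f v : ZFSet.{0}) :=
  Tm.comp1 (F := fun x => ⋃₀ x) <|
    Tm.of_mem (R := fun z w => ∃ y ∈ w 0, z ∈ y) (fun _ hW _ hv => hW.sUnion _ (hv 0))
      (fun z v => by simp) inferInstance

instance [hf : Tm ZF f] [hg : Tm ZF g] : Tm ZF fun v => f v ∪ g v :=
  (inferInstance : Tm ZF fun v => (⋃₀ {f v, g v} : ZFSet.{0}))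

instance Tm.sep {R : ZFSet.{0} → (Fin n → ZFSet.{0}) → Prop} [hf : Tm ZF f]
    [hR : Df ZF fun _ (w : Fin (n + 1) → ZFSet.{0}) => R (w 0) (Fin.tail w)] :
    Tm ZF fun v => ZFSet.sep (fun z => R z v) (f v) :=
  have := hf.weak
  Tm.of_mem (R := fun z w => z ∈ f w ∧ R z w)
    (fun W hW v hv => hW.sep' hR hv (hf.mem W hW v hv)) (fun z v => by simp) inferInstance

instance Tm.img {F : ZFSet.{0} → (Fin n → ZFSet.{0}) → ZFSet.{0}} [hf : Tm ZF f]
    [hF : Tm ZF fun w : Fin (n + 1) → ZFSet.{0} => F (w 0) (Fin.tail w)] :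
    Tm ZF fun v => SRPPaper.img (fun z => F z v) (f v) := by
  have := hf.weak
  refine Tm.of_mem (R := fun z w => ∃ x ∈ f w, F x w = z)
    (fun W hW v hv => hW.img' hF.graph hv (hf.mem W hW v hv) fun x hx =>
      hF.mem W hW (Fin.cons x v) (cons_mem (hW.trans _ (hf.mem W hW v hv) _ hx) hv))
    (fun z v => by simp [mem_img]) ?_
  have := hF.graph.comp (Fin.cases 1 (Fin.cases 0 fun i => i.succ.succ) :
    Fin (n + 2) → Fin (n + 2))
  have h' : Df ZF fun _ (w : Fin (n + 2) → ZFSet.{0}) =>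
    Fin.tail w 0 = F (w 0) (Fin.tail (Fin.tail w)) := this
  have h2 : Df ZF fun _ (w : Fin (n + 2) → ZFSet.{0}) =>
    F (w 0) (Fin.tail (Fin.tail w)) = Fin.tail w 0 := h'.congr fun _ _ _ _ => eq_comm
  exact Df.bex

instance Tm.gr {F : ZFSet.{0} → (Fin n → ZFSet.{0}) → ZFSet.{0}} [Tm ZF f]
    [Tm ZF fun w : Fin (n + 1) → ZFSet.{0} => F (w 0) (Fin.tail w)] :
    Tm ZF fun v => SRPPaper.gr (fun z => F z v) (f v) :=
  (inferInstance : Tm ZF fun v => SRPPaper.img (fun z => ZFSet.pair z (F z v)) (f v))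

instance Tm.ite {R : (Fin n → ZFSet.{0}) → Prop} [hf : Tm ZF f] [hg : Tm ZF g]
    [hR : Df ZF fun _ v => R v] : Tm ZF fun v => if R v then f v else g v := by
  have h1 := hf.weak
  have h2 := hg.weak
  have h3 := hR.tail
  refine Tm.of_mem (R := fun z v => (R v ∧ z ∈ f v) ∨ (¬ R v ∧ z ∈ g v)) ?_ ?_ inferInstance
  · intro W hW v hv
    by_cases h : R v
    · simpa only [h, if_true] using hf.mem W hW v hv
    · simpa only [h, if_false] using hg.mem W hW v hv
  · intro z v
    by_cases h : R v <;> simp [h]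

instance [Tm ZF f] [Tm ZF g] : Tm ZF fun v => f v \ g v :=
  Tm.comp2 (F := fun x y => x \ y) <|
    (inferInstance : Tm ZF fun v : Fin 2 → ZFSet.{0} => ZFSet.sep (fun z => ¬ z ∈ v 1) (v 0))

instance [Tm ZF f] : Tm ZF fun v => zfst (f v) :=
  Tm.comp1 (F := zfst) <| by unfold zfst; infer_instance

instance [Tm ZF f] : Tm ZF fun v => zsnd (f v) :=
  Tm.comp1 (F := zsnd) <| by unfold zsnd; infer_instance

instance [Tm ZF f] [Tm ZF g] : Tm ZF fun v => app (f v) (g v) :=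
  Tm.comp2 (F := app) <| by unfold app; infer_instance

/-- `a × b`, as an operation built from images. -/
def zprod (a b : ZFSet.{0}) : ZFSet.{0} := ⋃₀ img (fun x => img (fun y => pair x y) b) a

theorem mem_zprod {a b p : ZFSet.{0}} : p ∈ zprod a b ↔ ∃ x ∈ a, ∃ y ∈ b, pair x y = p := by
  simp only [zprod, ZFSet.mem_sUnion, mem_img]
  constructor
  · rintro ⟨_, ⟨x, hx, rfl⟩, h⟩
    obtain ⟨y, hy, h⟩ := mem_img.1 h
    exact ⟨x, hx, y, hy, h⟩
  · rintro ⟨x, hx, y, hy, h⟩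
    exact ⟨_, ⟨x, hx, rfl⟩, mem_img.2 ⟨y, hy, h⟩⟩

theorem pair_mem_zprod {a b x y : ZFSet.{0}} : pair x y ∈ zprod a b ↔ x ∈ a ∧ y ∈ b := by
  rw [mem_zprod]
  constructor
  · rintro ⟨x', hx, y', hy, h⟩
    obtain ⟨rfl, rfl⟩ := ZFSet.pair_inj.1 h
    exact ⟨hx, hy⟩
  · exact fun h => ⟨x, h.1, y, h.2, rfl⟩

theorem zprod_eq_prod (a b : ZFSet.{0}) : zprod a b = ZFSet.prod a b := by
  ext p
  rw [mem_zprod, ZFSet.mem_prod]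
  simp only [eq_comm]

instance [Tm ZF f] [Tm ZF g] : Tm ZF fun v => zprod (f v) (g v) :=
  Tm.comp2 (F := zprod) <| by unfold zprod; infer_instance

theorem omega_induction {a : ZFSet.{0}} (h0 : ∅ ∈ a) (hs : ∀ n ∈ a, insert n n ∈ a) :
    ZFSet.omega ⊆ a := by
  intro z hz
  obtain ⟨n, rfl⟩ := mem_omega.1 hz
  clear hz
  induction n with
  | zero => exact h0
  | succ n ih => exact hs _ ih

theorem natZ_cases {z : ZFSet.{0}} : (∃ n, natZ n = z) ↔
    z.IsTransitive ∧ ∀ y ∈ (insert z z : ZFSet.{0}), y = ∅ ∨ ∃ u ∈ y, y = insert u u := by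
  constructor
  · rintro ⟨n, rfl⟩
    refine ⟨(isOrdinal_natZ n).isTransitive, fun y hy => ?_⟩
    have : y ∈ ZFSet.omega := by
      rcases ZFSet.mem_insert_iff.1 hy with rfl | hy
      · exact mem_omega.2 ⟨n, rfl⟩
      · exact isOrdinal_omega.isTransitive _ (mem_omega.2 ⟨n, rfl⟩) hy
    obtain ⟨m, rfl⟩ := mem_omega.1 this
    cases m with
    | zero => exact Or.inl rfl
    | succ m => exact Or.inr ⟨natZ m, by simp [natZ], rfl⟩
  · induction z using ZFSet.inductionOn with
    | _ z ih =>
      rintro ⟨h1, h2⟩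
      rcases h2 z (by simp) with rfl | ⟨u, hu, e⟩
      · exact ⟨0, rfl⟩
      · obtain ⟨n, rfl⟩ := ih u hu ⟨fun y hy w hw => by
          have h3 := h1 y (h1 u hu hy) hw
          rw [e] at h3
          rcases ZFSet.mem_insert_iff.1 h3 with rfl | h3
          · exact absurd hy (ZFSet.mem_asymm hw)
          · exact h3, fun y hy => h2 y <| by
            rw [← e] at hy
            exact ZFSet.mem_insert_iff.2 (Or.inr hy)⟩
        exact ⟨n + 1, e.symm⟩

instance : Tm ZF fun _ : Fin n → ZFSet.{0} => ZFSet.omega.{0} := by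
  refine Tm.of_mem (R := fun z _ => z.IsTransitive ∧
    ∀ y ∈ (insert z z : ZFSet.{0}), y = ∅ ∨ ∃ u ∈ y, y = insert u u) ?_
    (fun z v => mem_omega.trans natZ_cases) inferInstance
  intro W hW v hv
  obtain ⟨o, ho, h0, hs⟩ := hW.ind
  have hsub := omega_induction h0 hs
  have := (inferInstance : Tm ZF fun v : Fin 1 → ZFSet.{0} => ZFSet.sep (fun z =>
    z.IsTransitive ∧ ∀ y ∈ (insert z z : ZFSet.{0}), y = ∅ ∨ ∃ u ∈ y, y = insert u u) (v 0)).mem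
    W hW (fun _ => o) fun _ => ho
  convert this using 1
  ext z
  rw [ZFSet.mem_sep, ← natZ_cases, ← mem_omega]
  exact ⟨fun h => ⟨hsub h, h⟩, fun h => h.2⟩

instance [Tm ZF f] [Tm ZF g] [Tm ZF k] : Df ZF fun _ v => IsSurjF (f v) (g v) (k v) := by
  refine Df.comp3 (P := fun _ x y z => IsSurjF x y z) ?_
  refine (inferInstance : Df ZF fun _ (v : Fin 3 → ZFSet.{0}) => (v 2 ⊆ zprod (v 0) (v 1) ∧
    ∀ z ∈ v 0, ∃ w ∈ v 1, pair z w ∈ v 2 ∧ ∀ w' ∈ v 1, pair z w' ∈ v 2 → w' = w) ∧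
    ∀ y ∈ v 1, ∃ x ∈ v 0, pair x y ∈ v 2).congr fun W _ v _ => ?_
  unfold IsSurjF ZFSet.IsFunc
  rw [zprod_eq_prod]
  refine and_congr_left fun _ => and_congr_right fun h => forall₂_congr fun z hz => ?_
  constructor
  · rintro ⟨w, -, h1, h2⟩
    exact ⟨w, h1, fun w' hw' => h2 w' (ZFSet.pair_mem_prod.1 (h hw')).2 hw'⟩
  · rintro ⟨w, h1, h2⟩
    exact ⟨w, (ZFSet.pair_mem_prod.1 (h h1)).2, h1, fun w' _ => h2 w'⟩

end Basic

/-! ### Definability of operations defined by `∈`-recursion -/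

/-- The operation defined by `∈`-recursion from `G`, with a parameter `p`. -/
def recF (G : ZFSet.{0} → ZFSet.{0} → ZFSet.{0} → ZFSet.{0}) (p : ZFSet.{0}) :
    ZFSet.{0} → ZFSet.{0} :=
  ZFSet.mem_wf.fix fun x ih => G p x (gr (fun z => if h : z ∈ x then ih z h else ∅) x)

section recF

variable {G : ZFSet.{0} → ZFSet.{0} → ZFSet.{0} → ZFSet.{0}} {p : ZFSet.{0}}

theorem recF_eq (x : ZFSet.{0}) : recF G p x = G p x (gr (recF G p) x) := by
  rw [recF, WellFounded.fix_eq]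
  congr 1
  exact gr_congr fun z hz => by simp [hz]

theorem approx_iff {t g : ZFSet.{0}} (ht : t.IsTransitive) :
    g = gr (fun z => G p z (gr (fun y => app g y) z)) t ↔ g = gr (recF G p) t := by
  constructor
  · intro h
    have key : ∀ z, z ∈ t → app g z = recF G p z := by
      intro z
      induction z using ZFSet.inductionOn with
      | _ z ih =>
        intro hz
        rw [h, app_gr hz, recF_eq]
        exact congrArg (G p z) (gr_congr fun y hy => ih y hy (ht z hz hy))
    rw [h]
    refine gr_congr fun z hz => ?_
    rw [recF_eq]
    exact congrArg (G p z) (gr_congr fun y hy => key y (ht z hz hy))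
  · intro h
    rw [h]
    refine gr_congr fun z hz => ?_
    rw [recF_eq]
    exact congrArg (G p z) (gr_congr fun y hy => (app_gr (ht z hz hy)).symm)

theorem exists_approx (hG : Tm ZF fun w : Fin 3 → ZFSet.{0} => G (w 0) (w 1) (w 2))
    {W : Set ZFSet.{0}} (hW : ZF W) (hp : p ∈ W) (x : ZFSet.{0}) :
    x ∈ W → ∃ t ∈ W, gr (recF G p) t ∈ W ∧ t.IsTransitive ∧ x ∈ t := by
  induction x using ZFSet.inductionOn with
  | _ x ih =>
    intro hx
    have hI : ∀ {n} {a b c : (Fin n → ZFSet.{0}) → ZFSet.{0}} [Tm ZF a] [Tm ZF b] [Tm ZF c],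
        Tm ZF fun v => G (a v) (b v) (c v) := fun {_ _ _ _} _ _ _ => hG.comp3
    have hA : Df ZF fun _ (w : Fin 2 → ZFSet.{0}) => (zfst (w 0)).IsTransitive ∧
        zsnd (w 0) = gr (fun z => G (w 1) z (gr (fun y => app (zsnd (w 0)) y) z)) (zfst (w 0)) :=
      inferInstance
    have hA' : ∀ q, ((zfst q).IsTransitive ∧
        zsnd q = gr (fun z => G p z (gr (fun y => app (zsnd q) y) z)) (zfst q)) ↔
        (zfst q).IsTransitive ∧ zsnd q = gr (recF G p) (zfst q) :=
      fun q => and_congr_right fun h => approx_iff h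
    have hR : Df ZF fun _ (w : Fin 3 → ZFSet.{0}) => ((zfst (w 0)).IsTransitive ∧
        zsnd (w 0) = gr (fun z => G (w 2) z (gr (fun y => app (zsnd (w 0)) y) z)) (zfst (w 0))) ∧
          w 1 ∈ zfst (w 0) := inferInstance
    obtain ⟨b, hb, hb'⟩ := hW.coll' hR (v := fun _ : Fin 1 => p) (fun _ => hp) hx fun u hu => by
      obtain ⟨t, ht, hg, htr, hut⟩ := ih u hu (hW.trans x hx u hu)
      refine ⟨pair t (gr (recF G p) t), hW.pair_mem ht hg, (hA' _).2 ?_, ?_⟩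
      · simpa using htr
      · simpa using hut
    have hb0 := hW.sep' hA (v := fun _ : Fin 1 => p) (fun _ => hp) hb
    set b0 := ZFSet.sep (fun q => (zfst q).IsTransitive ∧
      zsnd q = gr (fun z => G p z (gr (fun y => app (zsnd q) y) z)) (zfst q)) b with hb0def
    replace hb0 : b0 ∈ W := hb0
    have hmem : ∀ q, q ∈ b0 ↔ q ∈ b ∧ (zfst q).IsTransitive ∧
        zsnd q = gr (recF G p) (zfst q) := fun q => by rw [hb0def, ZFSet.mem_sep, hA']
    set T := (⋃₀ img zfst b0 : ZFSet.{0}) with hT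
    have hTW : T ∈ W := (inferInstance : Tm ZF fun v : Fin 1 → ZFSet.{0} =>
      (⋃₀ img (fun q => zfst q) (v 0) : ZFSet.{0})).mem W hW (fun _ => b0) fun _ => hb0
    have hgW : (⋃₀ img zsnd b0 : ZFSet.{0}) ∈ W := (inferInstance : Tm ZF fun v : Fin 1 → ZFSet.{0} =>
      (⋃₀ img (fun q => zsnd q) (v 0) : ZFSet.{0})).mem W hW (fun _ => b0) fun _ => hb0
    have hmT : ∀ z, z ∈ T ↔ ∃ q ∈ b0, z ∈ zfst q := fun z => by
      simp [hT, ZFSet.mem_sUnion, mem_img]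
    have hgT : (⋃₀ img zsnd b0 : ZFSet.{0}) = gr (recF G p) T := by
      ext e
      simp only [ZFSet.mem_sUnion, mem_img, mem_gr, hmT]
      constructor
      · rintro ⟨_, ⟨q, hq, rfl⟩, he⟩
        rw [((hmem q).1 hq).2.2, mem_gr] at he
        obtain ⟨z, hz, rfl⟩ := he
        exact ⟨z, ⟨q, hq, hz⟩, rfl⟩
      · rintro ⟨z, ⟨q, hq, hz⟩, rfl⟩
        refine ⟨_, ⟨q, hq, rfl⟩, ?_⟩
        rw [((hmem q).1 hq).2.2, pair_mem_gr]
        exact ⟨hz, rfl⟩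
    rw [hgT] at hgW
    have hTt : T.IsTransitive := fun z hz y hy => by
      obtain ⟨q, hq, hz⟩ := (hmT z).1 hz
      exact (hmT y).2 ⟨q, hq, ((hmem q).1 hq).2.1 z hz hy⟩
    have hxT : ∀ u ∈ x, u ∈ T := fun u hu => by
      obtain ⟨q, hq, -, h1, h2⟩ := hb' u hu
      exact (hmT u).2 ⟨q, (hmem q).2 ⟨hq, (hA' q).1 h1⟩, h2⟩
    refine ⟨insert x T, hW.insert hx hTW, ?_, ?_, by simp⟩
    · have h1 : insert (pair x (G p x (gr (fun y => app (gr (recF G p) T) y) x)))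
          (gr (recF G p) T) ∈ W :=
        (inferInstance : Tm ZF fun v : Fin 3 → ZFSet.{0} =>
          (insert (pair (v 0) (G (v 1) (v 0) (gr (fun y => app (v 2) y) (v 0))))
            (v 2) : ZFSet.{0})).mem W hW ![x, p, gr (recF G p) T] (fun i => by
              fin_cases i
              exacts [hx, hp, hgW])
      convert h1 using 1
      have h2 : G p x (gr (fun y => app (gr (recF G p) T) y) x) = recF G p x := by
        rw [recF_eq]
        exact congrArg (G p x) (gr_congr fun y hy => app_gr (hxT y hy))
      rw [h2]
      ext e
      simp only [mem_gr, ZFSet.mem_insert_iff]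
      constructor
      · rintro ⟨z, rfl | hz, rfl⟩
        exacts [Or.inl rfl, Or.inr ⟨z, hz, rfl⟩]
      · rintro (rfl | ⟨z, hz, rfl⟩)
        exacts [⟨x, Or.inl rfl, rfl⟩, ⟨z, Or.inr hz, rfl⟩]
    · intro z hz y hy
      rw [ZFSet.mem_insert_iff] at hz ⊢
      rcases hz with rfl | hz
      exacts [Or.inr (hxT y hy), Or.inr (hTt z hz hy)]

theorem Tm.recF (hG : Tm ZF fun w : Fin 3 → ZFSet.{0} => G (w 0) (w 1) (w 2)) :
    Tm ZF fun w : Fin 2 → ZFSet.{0} => recF G (w 0) (w 1) := by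
  have hI : ∀ {n} {a b c : (Fin n → ZFSet.{0}) → ZFSet.{0}} [Tm ZF a] [Tm ZF b] [Tm ZF c],
      Tm ZF fun v => G (a v) (b v) (c v) := fun {_ _ _ _} _ _ _ => hG.comp3
  refine ⟨fun W hW v hv => ?_, ?_⟩
  · obtain ⟨t, ht, hg, -, hx⟩ := exists_approx hG hW (hv 0) (v 1) (hv 1)
    rw [← app_gr (f := SRPPaper.recF G (v 0)) hx]
    exact (inferInstance : Tm ZF fun v : Fin 2 → ZFSet.{0} => app (v 0) (v 1)).mem W hW
      ![_, _] (fun i => by fin_cases i; exacts [hg, hv 1])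
  · refine (inferInstance : Df ZF fun W (w : Fin 3 → ZFSet.{0}) => ∃ t ∈ W, ∃ g ∈ W,
      (t.IsTransitive ∧ g = SRPPaper.gr (fun z => G (w 1) z (SRPPaper.gr (fun y => app g y) z)) t)
        ∧ w 2 ∈ t ∧ w 0 = app g (w 2)).congr fun W hW w hw => ?_
    constructor
    · rintro ⟨t, ht, g, hg, ⟨h1, h2⟩, hx, e⟩
      rw [approx_iff h1] at h2
      rw [e, h2, app_gr hx]
      rfl
    · intro e
      obtain ⟨t, ht, hg, htr, hx⟩ := exists_approx hG hW (hw 1) (w 2) (hw 2)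
      exact ⟨t, ht, _, hg, ⟨htr, (approx_iff htr).2 rfl⟩, hx, by rw [app_gr hx, e]; rfl⟩

end recF

/-! ### Iteration along `ω` and closures -/

@[simp] theorem sUnion_natZ_succ (n : ℕ) : (⋃₀ natZ (n + 1) : ZFSet.{0}) = natZ n := by
  ext z
  simp only [natZ, ZFSet.mem_sUnion, ZFSet.mem_insert_iff]
  constructor
  · rintro ⟨y, rfl | hy, hz⟩
    exacts [hz, (isOrdinal_natZ n).isTransitive y hy hz]
  · exact fun hz => ⟨_, Or.inl rfl, hz⟩

theorem natZ_succ_ne (n : ℕ) : natZ (n + 1) ≠ ∅ := fun h =>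
  ZFSet.notMem_empty (natZ n) (h ▸ by simp [natZ])

theorem natZ_injective : Function.Injective natZ := by
  intro m
  induction m with
  | zero =>
    intro n h
    cases n with
    | zero => rfl
    | succ n => exact absurd h.symm (natZ_succ_ne n)
  | succ m ih =>
    intro n h
    cases n with
    | zero => exact absurd h (natZ_succ_ne m)
    | succ n =>
      have e : natZ m = natZ n := by rw [← sUnion_natZ_succ m, h, sUnion_natZ_succ]
      rw [ih e]

/-- Iteration along `ω` of the step `St p`, starting at `a`; here `q = (p, a)`. -/
def iterF (St : ZFSet.{0} → ZFSet.{0} → ZFSet.{0}) (q : ZFSet.{0}) : ZFSet.{0} → ZFSet.{0} :=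
  recF (fun q n g => if n = ∅ then zsnd q else St (zfst q) (app g (⋃₀ n))) q

theorem Tm.iterF {St : ZFSet.{0} → ZFSet.{0} → ZFSet.{0}}
    (h : Tm ZF fun w : Fin 2 → ZFSet.{0} => St (w 0) (w 1)) :
    Tm ZF fun w : Fin 2 → ZFSet.{0} => iterF St (w 0) (w 1) := by
  have hI : ∀ {n} {a b : (Fin n → ZFSet.{0}) → ZFSet.{0}} [Tm ZF a] [Tm ZF b],
      Tm ZF fun v => St (a v) (b v) := fun {_ _ _} _ _ => h.comp2
  exact Tm.recF inferInstance

section iter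

variable {St : ZFSet.{0} → ZFSet.{0} → ZFSet.{0}} {q p a : ZFSet.{0}}

theorem iterF_zero : iterF St q (natZ 0) = zsnd q := by
  rw [iterF, recF_eq]; simp [natZ]

theorem iterF_succ (k : ℕ) :
    iterF St q (natZ (k + 1)) = St (zfst q) (iterF St q (natZ k)) := by
  rw [iterF, recF_eq, if_neg (natZ_succ_ne k), sUnion_natZ_succ, app_gr (by simp [natZ])]

/-- The union of the iterates. -/
def iterU (St : ZFSet.{0} → ZFSet.{0} → ZFSet.{0}) (p a : ZFSet.{0}) : ZFSet.{0} :=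
  ⋃₀ img (fun n => iterF St (pair p a) n) ZFSet.omega

theorem Tm.iterU (h : Tm ZF fun w : Fin 2 → ZFSet.{0} => St (w 0) (w 1)) :
    Tm ZF fun w : Fin 2 → ZFSet.{0} => iterU St (w 0) (w 1) := by
  have hI : ∀ {n} {a b : (Fin n → ZFSet.{0}) → ZFSet.{0}} [Tm ZF a] [Tm ZF b],
      Tm ZF fun v => SRPPaper.iterF St (a v) (b v) := fun {_ _ _} _ _ => (Tm.iterF h).comp2
  unfold SRPPaper.iterU
  infer_instance

theorem mem_iterU {x : ZFSet.{0}} :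
    x ∈ iterU St p a ↔ ∃ k, x ∈ iterF St (pair p a) (natZ k) := by
  simp only [iterU, ZFSet.mem_sUnion, mem_img]
  constructor
  · rintro ⟨_, ⟨z, hz, rfl⟩, hx⟩
    obtain ⟨k, rfl⟩ := mem_omega.1 hz
    exact ⟨k, hx⟩
  · rintro ⟨k, hx⟩
    exact ⟨_, ⟨_, mem_omega.2 ⟨k, rfl⟩, rfl⟩, hx⟩

end iter

/-- The closure of `a` under the operations `(A, B) ↦ h p (c, (A, B))`, for `c ∈ C`. -/
def Cl (h : ZFSet.{0} → ZFSet.{0} → ZFSet.{0}) (p C a : ZFSet.{0}) : ZFSet.{0} :=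
  iterU (fun q A => A ∪ img (fun e => h (zfst q) e) (zprod (zsnd q) (zprod A A))) (pair p C) a

section Cl

variable {h : ZFSet.{0} → ZFSet.{0} → ZFSet.{0}} {p C a : ZFSet.{0}}

theorem Tm.Cl (hh : Tm ZF fun w : Fin 2 → ZFSet.{0} => h (w 0) (w 1)) :
    Tm ZF fun w : Fin 3 → ZFSet.{0} => Cl h (w 0) (w 1) (w 2) := by
  have hI : ∀ {n} {a b : (Fin n → ZFSet.{0}) → ZFSet.{0}} [Tm ZF a] [Tm ZF b],
      Tm ZF fun v => h (a v) (b v) := fun {_ _ _} _ _ => hh.comp2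
  have hJ : ∀ {n} {a b : (Fin n → ZFSet.{0}) → ZFSet.{0}} [Tm ZF a] [Tm ZF b],
      Tm ZF fun v => SRPPaper.iterU (fun q A => A ∪ SRPPaper.img (fun e => h (zfst q) e)
        (zprod (zsnd q) (zprod A A))) (a v) (b v) :=
    fun {_ _ _} _ _ => (Tm.iterU inferInstance).comp2
  unfold SRPPaper.Cl
  infer_instance

theorem subset_Cl {x : ZFSet.{0}} (hx : x ∈ a) : x ∈ Cl h p C a :=
  mem_iterU.2 ⟨0, by rwa [iterF_zero, zsnd_pair]⟩

theorem Cl_step {c A B : ZFSet.{0}} (hc : c ∈ C) (hA : A ∈ Cl h p C a) (hB : B ∈ Cl h p C a) :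
    h p (pair c (pair A B)) ∈ Cl h p C a := by
  obtain ⟨k, hk⟩ := mem_iterU.1 hA
  obtain ⟨l, hl⟩ := mem_iterU.1 hB
  set St : ZFSet.{0} → ZFSet.{0} → ZFSet.{0} :=
    fun q A => A ∪ img (fun e => h (zfst q) e) (zprod (zsnd q) (zprod A A)) with hSt
  have mono : ∀ {x i j}, i ≤ j → x ∈ iterF St (pair (pair p C) a) (natZ i) →
      x ∈ iterF St (pair (pair p C) a) (natZ j) := by
    intro x i j hij hx
    induction hij with
    | refl => exact hx
    | step _ ih =>
      rw [Nat.succ_eq_add_one, iterF_succ]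
      exact ZFSet.mem_union.2 (Or.inl ih)
  refine mem_iterU.2 ⟨max k l + 1, ?_⟩
  rw [iterF_succ]
  refine ZFSet.mem_union.2 (Or.inr (mem_img.2 ⟨pair c (pair A B), ?_, by simp⟩))
  rw [pair_mem_zprod, pair_mem_zprod]
  exact ⟨by simpa using hc, mono (le_max_left k l) hk, mono (le_max_right k l) hl⟩

theorem Cl_induction {P : ZFSet.{0} → Prop} (h0 : ∀ x ∈ a, P x)
    (hs : ∀ c ∈ C, ∀ A ∈ Cl h p C a, ∀ B ∈ Cl h p C a, P A → P B → P (h p (pair c (pair A B))))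
    {x : ZFSet.{0}} (hx : x ∈ Cl h p C a) : P x := by
  obtain ⟨k, hk⟩ := mem_iterU.1 hx
  suffices H : ∀ k x, x ∈ iterF (fun q A => A ∪ img (fun e => h (zfst q) e)
      (zprod (zsnd q) (zprod A A))) (pair (pair p C) a) (natZ k) → P x from H k x hk
  clear hk k hx x
  intro k
  induction k with
  | zero =>
    intro x hx
    rw [iterF_zero, zsnd_pair] at hx
    exact h0 x hx
  | succ k ih =>
    intro x hx
    rw [iterF_succ] at hx
    rcases ZFSet.mem_union.1 hx with hx | hx
    · exact ih x hx
    · obtain ⟨e, he, rfl⟩ := mem_img.1 hx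
      obtain ⟨c, hc, e', he', rfl⟩ := mem_zprod.1 he
      obtain ⟨A, hA, B, hB, rfl⟩ := mem_zprod.1 he'
      have := hs c (by simpa using hc) A (mem_iterU.2 ⟨k, hA⟩) B (mem_iterU.2 ⟨k, hB⟩)
        (ih A hA) (ih B hB)
      simpa using this

end Cl

/-! ### Tuples and definable relations as sets -/

/-- Finite tuples as sets. -/
def tup : ∀ {n : ℕ}, (Fin n → ZFSet.{0}) → ZFSet.{0}
  | 0, _ => ∅
  | _ + 1, v => pair (v 0) (tup (Fin.tail v))

@[simp] theorem tup_cons {n : ℕ} (x : ZFSet.{0}) (v : Fin n → ZFSet.{0}) :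
    tup (Fin.cons x v : Fin (n + 1) → ZFSet.{0}) = pair x (tup v) := rfl

theorem pair_ne_empty (x y : ZFSet.{0}) : pair x y ≠ ∅ := fun h =>
  ZFSet.notMem_empty {x} (h ▸ by simp [pair])

theorem tup_inj : ∀ {n m : ℕ} {v : Fin n → ZFSet.{0}} {w : Fin m → ZFSet.{0}}, tup v = tup w →
    ∃ h : n = m, v = w ∘ Fin.cast h
  | 0, 0, v, w, _ => ⟨rfl, funext fun i => i.elim0⟩
  | 0, m + 1, v, w, h => absurd h.symm (pair_ne_empty _ _)
  | n + 1, 0, v, w, h => absurd h (pair_ne_empty _ _)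
  | n + 1, m + 1, v, w, h => by
    obtain ⟨h0, h1⟩ := ZFSet.pair_inj.1 h
    obtain ⟨rfl, e⟩ := tup_inj h1
    refine ⟨rfl, funext fun i => ?_⟩
    refine Fin.cases h0 (fun i => ?_) i
    exact congrFun e i

theorem tup_injective {n : ℕ} {v w : Fin n → ZFSet.{0}} (h : tup v = tup w) : v = w := by
  obtain ⟨_, e⟩ := tup_inj h
  exact e

/-- The set of all finite tuples from `X`. -/
def Tup (X : ZFSet.{0}) : ZFSet.{0} :=
  Cl (fun _ e => pair (zfst e) (zfst (zsnd e))) ∅ X {∅}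

instance {n : ℕ} {f : (Fin n → ZFSet.{0}) → ZFSet.{0}} [Tm ZF f] : Tm ZF fun v => Tup (f v) := by
  refine Tm.comp1 (F := Tup) ?_
  have hJ : ∀ {n} {a b c : (Fin n → ZFSet.{0}) → ZFSet.{0}} [Tm ZF a] [Tm ZF b] [Tm ZF c],
      Tm ZF fun v => Cl (fun _ e => pair (zfst e) (zfst (zsnd e))) (a v) (b v) (c v) :=
    fun {_ _ _ _} _ _ _ => (Tm.Cl inferInstance).comp3
  unfold Tup
  infer_instance

theorem mem_Tup {X t : ZFSet.{0}} :
    t ∈ Tup X ↔ ∃ (n : ℕ) (v : Fin n → ZFSet.{0}), (∀ i, v i ∈ X) ∧ tup v = t := by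
  constructor
  · intro ht
    refine Cl_induction (P := fun t => ∃ (n : ℕ) (v : Fin n → ZFSet.{0}),
      (∀ i, v i ∈ X) ∧ tup v = t) (fun x hx => ?_) ?_ ht
    · exact ⟨0, Fin.elim0, fun i => i.elim0, (ZFSet.mem_singleton.1 hx).symm⟩
    · rintro c hc _ - B - ⟨n, v, hv, rfl⟩ -
      exact ⟨n + 1, Fin.cons c v, cons_mem (W := {x | x ∈ X}) hc hv, by simp⟩
  · rintro ⟨n, v, hv, rfl⟩
    induction n with
    | zero => exact subset_Cl (ZFSet.mem_singleton.2 rfl)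
    | succ n ih =>
      have h1 := ih (Fin.tail v) fun i => hv i.succ
      have := Cl_step (h := fun _ e => pair (zfst e) (zfst (zsnd e))) (p := ∅) (hv 0) h1 h1
      simp only [zfst_pair, zsnd_pair] at this
      exact this

/-- The relation `R` on `X`, as a set of tuples. -/
def relS (X : ZFSet.{0}) {n : ℕ} (R : (Fin n → ZFSet.{0}) → Prop) : ZFSet.{0} :=
  ZFSet.sep (fun t => ∃ v : Fin n → ZFSet.{0}, (∀ i, v i ∈ X) ∧ R v ∧ tup v = t) (Tup X)

section relS

variable {X t x y : ZFSet.{0}} {n : ℕ} {R : (Fin n → ZFSet.{0}) → Prop}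

theorem mem_relS : t ∈ relS X R ↔
    ∃ v : Fin n → ZFSet.{0}, (∀ i, v i ∈ X) ∧ R v ∧ tup v = t := by
  rw [relS, ZFSet.mem_sep]
  exact ⟨fun h => h.2, fun h => ⟨let ⟨v, hv, _, e⟩ := h; mem_Tup.2 ⟨n, v, hv, e⟩, h⟩⟩

theorem tup_mem_relS {v : Fin n → ZFSet.{0}} (hv : ∀ i, v i ∈ X) : tup v ∈ relS X R ↔ R v := by
  rw [mem_relS]
  constructor
  · rintro ⟨w, _, hw, e⟩
    rwa [← tup_injective e]
  · exact fun h => ⟨v, hv, h, rfl⟩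

theorem relS_congr {S : (Fin n → ZFSet.{0}) → Prop}
    (h : ∀ v : Fin n → ZFSet.{0}, (∀ i, v i ∈ X) → (R v ↔ S v)) : relS X R = relS X S := by
  ext t
  rw [mem_relS, mem_relS]
  exact exists_congr fun v => and_congr_right fun hv => and_congr_left fun _ => h v hv

theorem mem_relS_succ {R : (Fin (n + 1) → ZFSet.{0}) → Prop} : t ∈ relS X R ↔
    ∃ x ∈ X, ∃ v : Fin n → ZFSet.{0}, (∀ i, v i ∈ X) ∧ R (Fin.cons x v) ∧
      pair x (tup v) = t := by
  rw [mem_relS]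
  constructor
  · rintro ⟨v, hv, h, e⟩
    exact ⟨v 0, hv 0, Fin.tail v, fun i => hv i.succ, by simpa using h, e⟩
  · rintro ⟨x, hx, v, hv, h, e⟩
    exact ⟨Fin.cons x v, cons_mem (W := {x | x ∈ X}) hx hv, h, e⟩

theorem pair_mem_relS {R : (Fin (n + 1) → ZFSet.{0}) → Prop} : pair x t ∈ relS X R ↔
    x ∈ X ∧ t ∈ relS X fun v => R (Fin.cons x v) := by
  rw [mem_relS_succ, mem_relS]
  constructor
  · rintro ⟨x, hx, v, hv, h, e⟩
    obtain ⟨rfl, rfl⟩ := ZFSet.pair_inj.1 e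
    exact ⟨hx, v, hv, h, rfl⟩
  · rintro ⟨hx, v, hv, h, rfl⟩
    exact ⟨x, hx, v, hv, h, rfl⟩

theorem zprod_relS : zprod X (relS X R) = relS X fun v : Fin (n + 1) → ZFSet.{0} =>
    R (Fin.tail v) := by
  ext t
  simp only [mem_zprod, mem_relS_succ, mem_relS, Fin.tail_cons]
  constructor
  · rintro ⟨x, hx, _, ⟨v, hv, h, rfl⟩, rfl⟩
    exact ⟨x, hx, v, hv, h, rfl⟩
  · rintro ⟨x, hx, v, hv, h, rfl⟩
    exact ⟨x, hx, _, ⟨v, hv, h, rfl⟩, rfl⟩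

theorem sep_relS {P : ZFSet.{0} → ZFSet.{0} → Prop}
    {R : (Fin (n + 2) → ZFSet.{0}) → Prop} :
    ZFSet.sep (fun s => P (zfst s) (zfst (zsnd s))) (relS X R) =
      relS X fun v => R v ∧ P (v 0) (v 1) := by
  ext t
  simp only [ZFSet.mem_sep, mem_relS_succ]
  constructor
  · rintro ⟨⟨x, hx, v, hv, h, rfl⟩, hP⟩
    exact ⟨x, hx, v, hv, ⟨h, by simpa [tup] using hP⟩, rfl⟩
  · rintro ⟨x, hx, v, hv, ⟨h, hP⟩, rfl⟩
    exact ⟨⟨x, hx, v, hv, h, rfl⟩, by simpa [tup] using hP⟩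

/-- Exchanging the first two entries of a tuple. -/
def zswap (s : ZFSet.{0}) : ZFSet.{0} := pair (zfst (zsnd s)) (pair (zfst s) (zsnd (zsnd s)))

@[simp] theorem zswap_pair {x y t : ZFSet.{0}} :
    zswap (pair x (pair y t)) = pair y (pair x t) := by
  simp [zswap]

theorem img_zswap {R : (Fin (n + 2) → ZFSet.{0}) → Prop} : img zswap (relS X R) =
    relS X fun v : Fin (n + 2) → ZFSet.{0} =>
      R (Fin.cons (v 1) (Fin.cons (v 0) (Fin.tail (Fin.tail v)))) := by
  ext t
  simp only [mem_img]
  constructor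
  · rintro ⟨_, h, rfl⟩
    obtain ⟨x, hx, v, hv, h', rfl⟩ := mem_relS_succ.1 h
    rw [tup, zswap_pair, pair_mem_relS, pair_mem_relS]
    refine ⟨hv 0, hx, (tup_mem_relS fun i => hv i.succ).2 ?_⟩
    rw [← Fin.cons_self_tail v] at h'
    exact h'
  · intro h
    obtain ⟨x, hx, v, hv, h', rfl⟩ := mem_relS_succ.1 h
    refine ⟨pair (v 0) (pair x (tup (Fin.tail v))), ?_, by simp [tup]⟩
    rw [pair_mem_relS, pair_mem_relS]
    refine ⟨hv 0, hx, (tup_mem_relS fun i => hv i.succ).2 ?_⟩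
    exact h'

theorem img_zsnd {R : (Fin (n + 1) → ZFSet.{0}) → Prop} : img zsnd (relS X R) =
    relS X fun v : Fin n → ZFSet.{0} => ∃ x ∈ X, R (Fin.cons x v) := by
  ext t
  simp only [mem_img, mem_relS]
  constructor
  · rintro ⟨_, h, rfl⟩
    obtain ⟨v, hv, h, rfl⟩ := h
    exact ⟨Fin.tail v, fun i => hv i.succ, ⟨v 0, hv 0, by simpa using h⟩, by simp [tup]⟩
  · rintro ⟨v, hv, ⟨x, hx, h⟩, rfl⟩
    exact ⟨_, ⟨Fin.cons x v, cons_mem (W := {x | x ∈ X}) hx hv, h, rfl⟩, by simp⟩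

theorem relS_diff {S : (Fin n → ZFSet.{0}) → Prop} :
    relS X R \ relS X S = relS X fun v => R v ∧ ¬ S v := by
  ext t
  simp only [ZFSet.mem_sdiff, mem_relS]
  constructor
  · rintro ⟨⟨v, hv, h, rfl⟩, h'⟩
    exact ⟨v, hv, ⟨h, fun hs => h' ⟨v, hv, hs, rfl⟩⟩, rfl⟩
  · rintro ⟨v, hv, ⟨h, h'⟩, rfl⟩
    refine ⟨⟨v, hv, h, rfl⟩, ?_⟩
    rintro ⟨w, _, hs, e⟩
    exact h' (tup_injective e ▸ hs)

theorem relS_diff_of_ne {m : ℕ} {S : (Fin m → ZFSet.{0}) → Prop} (hnm : n ≠ m) :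
    relS X R \ relS X S = relS X R := by
  ext t
  simp only [ZFSet.mem_sdiff, mem_relS]
  refine ⟨fun h => h.1, ?_⟩
  rintro ⟨v, hv, h, rfl⟩
  exact ⟨⟨v, hv, h, rfl⟩, fun ⟨w, _, _, e⟩ => hnm (tup_inj e).1.symm⟩

end relS

/-- The basic operations generating the definable relations. -/
def hD (X e : ZFSet.{0}) : ZFSet.{0} :=
  if zfst e = natZ 0 then zprod X (zfst (zsnd e))
  else if zfst e = natZ 1 then
    ZFSet.sep (fun s => zfst s ∈ zfst (zsnd s)) (zprod X (zprod X (zfst (zsnd e))))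
  else if zfst e = natZ 2 then
    ZFSet.sep (fun s => zfst s = zfst (zsnd s)) (zprod X (zprod X (zfst (zsnd e))))
  else if zfst e = natZ 3 then
    if zfst (zsnd e) ⊆ zprod X (zprod X (img (fun s => zsnd (zsnd s)) (zfst (zsnd e)))) then
      img (fun s => pair (zfst (zsnd s)) (pair (zfst s) (zsnd (zsnd s)))) (zfst (zsnd e))
    else zfst (zsnd e)
  else if zfst e = natZ 4 then zfst (zsnd e) \ zsnd (zsnd e)
  else if zfst e = natZ 5 then
    if zfst (zsnd e) ⊆ zprod X (img (fun s => zsnd s) (zfst (zsnd e))) then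
      img (fun s => zsnd s) (zfst (zsnd e))
    else zfst (zsnd e)
  else zfst (zsnd e)

theorem Tm.natZ {n : ℕ} : ∀ k, Tm ZF fun _ : Fin n → ZFSet.{0} => SRPPaper.natZ k
  | 0 => (inferInstance : Tm ZF fun _ : Fin n → ZFSet.{0} => (∅ : ZFSet.{0}))
  | k + 1 =>
    have := Tm.natZ (n := n) k
    (inferInstance : Tm ZF fun _ : Fin n → ZFSet.{0} =>
      (insert (SRPPaper.natZ k) (SRPPaper.natZ k) : ZFSet.{0}))

instance {n k : ℕ} : Tm ZF fun _ : Fin n → ZFSet.{0} => natZ k := Tm.natZ k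

theorem Tm.hD : Tm ZF fun w : Fin 2 → ZFSet.{0} => hD (w 0) (w 1) := by
  unfold SRPPaper.hD
  infer_instance

/-- The set of all relations on `X` that are definable without parameters. -/
def DD (X : ZFSet.{0}) : ZFSet.{0} := Cl hD X ZFSet.omega {{∅}}

instance {n : ℕ} {f : (Fin n → ZFSet.{0}) → ZFSet.{0}} [Tm ZF f] : Tm ZF fun v => DD (f v) := by
  refine Tm.comp1 (F := DD) ?_
  have hJ : ∀ {n} {a b c : (Fin n → ZFSet.{0}) → ZFSet.{0}} [Tm ZF a] [Tm ZF b] [Tm ZF c],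
      Tm ZF fun v => Cl hD (a v) (b v) (c v) :=
    fun {_ _ _ _} _ _ _ => (Tm.Cl Tm.hD).comp3
  unfold DD
  infer_instance

section DD

variable {X : ZFSet.{0}} {n : ℕ}

theorem nat_ne {i j : ℕ} (h : i ≠ j) : natZ i ≠ natZ j := fun e => h (natZ_injective e)

theorem hD_prod (A B : ZFSet.{0}) : hD X (pair (natZ 0) (pair A B)) = zprod X A := by
  simp [hD]

theorem hD_mem (A B : ZFSet.{0}) : hD X (pair (natZ 1) (pair A B)) =
    ZFSet.sep (fun s => zfst s ∈ zfst (zsnd s)) (zprod X (zprod X A)) := by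
  simp [hD, nat_ne]

theorem hD_eq (A B : ZFSet.{0}) : hD X (pair (natZ 2) (pair A B)) =
    ZFSet.sep (fun s => zfst s = zfst (zsnd s)) (zprod X (zprod X A)) := by
  simp [hD, nat_ne]

theorem hD_swap (A B : ZFSet.{0}) : hD X (pair (natZ 3) (pair A B)) =
    if A ⊆ zprod X (zprod X (img (fun s => zsnd (zsnd s)) A)) then img zswap A else A := by
  simp [hD, nat_ne]
  rfl

theorem hD_diff (A B : ZFSet.{0}) : hD X (pair (natZ 4) (pair A B)) = A \ B := by
  simp [hD, nat_ne]

theorem hD_proj (A B : ZFSet.{0}) : hD X (pair (natZ 5) (pair A B)) =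
    if A ⊆ zprod X (img zsnd A) then img zsnd A else A := by
  simp [hD, nat_ne]

theorem hD_other {c : ℕ} (hc : 5 < c) (A B : ZFSet.{0}) :
    hD X (pair (natZ c) (pair A B)) = A := by
  have h : ∀ i, i ≤ 5 → natZ c ≠ natZ i := fun i hi => nat_ne (by omega)
  simp [hD, h]

theorem exists_of_mem_DD {A : ZFSet.{0}} (hA : A ∈ DD X) :
    ∃ (n : ℕ) (φ : Fml n), A = relS X (Sat X.toSet φ) := by
  refine Cl_induction (P := fun A => ∃ (n : ℕ) (φ : Fml n), A = relS X (Sat X.toSet φ))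
    ?_ ?_ hA
  · intro A hA
    rw [ZFSet.mem_singleton.1 hA]
    refine ⟨0, .not (.ex (.not (.eq 0 0))), ?_⟩
    ext t
    rw [mem_relS, ZFSet.mem_singleton]
    constructor
    · rintro rfl
      exact ⟨Fin.elim0, fun i => i.elim0, by simp [Sat, SatAB], rfl⟩
    · rintro ⟨v, -, -, rfl⟩
      rfl
  · rintro c hc _ - _ - ⟨n, φ, rfl⟩ ⟨m, ψ, rfl⟩
    obtain ⟨c, rfl⟩ := mem_omega.1 hc
    by_cases hc5 : 5 < c
    · exact ⟨n, φ, hD_other hc5 _ _⟩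
    obtain rfl | rfl | rfl | rfl | rfl | rfl : c = 0 ∨ c = 1 ∨ c = 2 ∨ c = 3 ∨ c = 4 ∨ c = 5 := by
      omega
    · refine ⟨n + 1, φ.rename Fin.succ, ?_⟩
      rw [hD_prod, zprod_relS]
      exact relS_congr fun v _ => (sat_rename _ _ _).symm
    · refine ⟨n + 2, .and (φ.rename fun i => i.succ.succ) (.mem 0 1), ?_⟩
      rw [hD_mem, zprod_relS, zprod_relS, sep_relS (P := fun x y => x ∈ y)]
      exact relS_congr fun v _ => and_congr_left fun _ =>
        (sat_rename (fun i => i.succ.succ) φ v).symm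
    · refine ⟨n + 2, .and (φ.rename fun i => i.succ.succ) (.eq 0 1), ?_⟩
      rw [hD_eq, zprod_relS, zprod_relS, sep_relS (P := fun x y => x = y)]
      exact relS_congr fun v _ => and_congr_left fun _ =>
        (sat_rename (fun i => i.succ.succ) φ v).symm
    · rw [hD_swap]
      split_ifs with h
      · match n, φ, h with
        | n + 2, φ, _ =>
          refine ⟨n + 2, φ.rename (Fin.cases 1 (Fin.cases 0 fun i => i.succ.succ)), ?_⟩
          rw [img_zswap]
          refine relS_congr fun v _ => ?_
          rw [sat_rename]
          refine iff_of_eq (congrArg _ (funext fun i => ?_))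
          refine Fin.cases rfl (fun i => Fin.cases rfl (fun i => rfl) i) i
        | 0, φ, h =>
          refine ⟨0, φ, ?_⟩
          have h0 : relS X (Sat X.toSet φ) = ∅ := by
            rw [ZFSet.eq_empty]
            intro t ht
            have h1 := h ht
            obtain ⟨v, -, -, rfl⟩ := mem_relS.1 ht
            obtain ⟨x, -, y, -, e⟩ := mem_zprod.1 h1
            exact pair_ne_empty _ _ e
          rw [h0]
          ext; simp [mem_img]
        | 1, φ, h =>
          refine ⟨1, φ, ?_⟩
          have h0 : relS X (Sat X.toSet φ) = ∅ := by
            rw [ZFSet.eq_empty]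
            intro t ht
            have h1 := h ht
            obtain ⟨v, -, -, rfl⟩ := mem_relS.1 ht
            obtain ⟨-, h1⟩ := pair_mem_zprod.1 h1
            obtain ⟨x, -, y, -, e⟩ := mem_zprod.1 h1
            exact pair_ne_empty _ _ e
          rw [h0]
          ext; simp [mem_img]
      · exact ⟨n, φ, rfl⟩
    · rw [hD_diff]
      by_cases hnm : n = m
      · subst hnm
        exact ⟨n, .and φ (.not ψ), relS_diff⟩
      · exact ⟨n, φ, relS_diff_of_ne hnm⟩
    · rw [hD_proj]
      split_ifs with h
      · match n, φ, h with
        | n + 1, φ, _ => exact ⟨n, .ex φ, img_zsnd⟩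
        | 0, φ, h =>
          refine ⟨0, φ, ?_⟩
          have h0 : relS X (Sat X.toSet φ) = ∅ := by
            rw [ZFSet.eq_empty]
            intro t ht
            have h1 := h ht
            obtain ⟨v, -, -, rfl⟩ := mem_relS.1 ht
            obtain ⟨x, -, y, -, e⟩ := mem_zprod.1 h1
            exact pair_ne_empty _ _ e
          rw [h0]
          ext; simp [mem_img]
      · exact ⟨n, φ, rfl⟩

theorem nat_mem_omega (k : ℕ) : natZ k ∈ ZFSet.omega := mem_omega.2 ⟨k, rfl⟩

section

variable {R S : (Fin n → ZFSet.{0}) → Prop}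

theorem DD_prod (h : relS X R ∈ DD X) :
    relS X (fun v : Fin (n + 1) → ZFSet.{0} => R (Fin.tail v)) ∈ DD X := by
  have := Cl_step (nat_mem_omega 0) h h
  rwa [hD_prod, zprod_relS] at this

theorem DD_mem (h : relS X R ∈ DD X) : relS X (fun v : Fin (n + 2) → ZFSet.{0} =>
    R (Fin.tail (Fin.tail v)) ∧ v 0 ∈ v 1) ∈ DD X := by
  have := Cl_step (nat_mem_omega 1) h h
  rwa [hD_mem, zprod_relS, zprod_relS, sep_relS (P := fun x y => x ∈ y)] at this

theorem DD_eq (h : relS X R ∈ DD X) : relS X (fun v : Fin (n + 2) → ZFSet.{0} =>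
    R (Fin.tail (Fin.tail v)) ∧ v 0 = v 1) ∈ DD X := by
  have := Cl_step (nat_mem_omega 2) h h
  rwa [hD_eq, zprod_relS, zprod_relS, sep_relS (P := fun x y => x = y)] at this

theorem DD_swap {R : (Fin (n + 2) → ZFSet.{0}) → Prop} (h : relS X R ∈ DD X) :
    relS X (fun v : Fin (n + 2) → ZFSet.{0} =>
      R (Fin.cons (v 1) (Fin.cons (v 0) (Fin.tail (Fin.tail v))))) ∈ DD X := by
  have := Cl_step (nat_mem_omega 3) h h
  rwa [hD_swap, img_zswap, if_pos] at this
  intro t ht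
  have ht' := ht
  obtain ⟨x, hx, v, hv, -, rfl⟩ := mem_relS_succ.1 ht
  refine pair_mem_zprod.2 ⟨hx, pair_mem_zprod.2 ⟨hv 0, mem_img.2 ⟨_, ht', ?_⟩⟩⟩
  simp [tup]

theorem DD_diff (h : relS X R ∈ DD X) (h' : relS X S ∈ DD X) :
    relS X (fun v => R v ∧ ¬ S v) ∈ DD X := by
  have := Cl_step (nat_mem_omega 4) h h'
  rwa [hD_diff, relS_diff] at this

theorem DD_proj {R : (Fin (n + 1) → ZFSet.{0}) → Prop} (h : relS X R ∈ DD X) :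
    relS X (fun v : Fin n → ZFSet.{0} => ∃ x ∈ X, R (Fin.cons x v)) ∈ DD X := by
  have := Cl_step (nat_mem_omega 5) h h
  rwa [hD_proj, if_pos, img_zsnd] at this
  intro t ht
  have ht' := ht
  obtain ⟨x, hx, v, hv, -, rfl⟩ := mem_relS_succ.1 ht
  exact pair_mem_zprod.2 ⟨hx, (mem_img (f := zsnd)).2 ⟨_, ht', zsnd_pair _ _⟩⟩

theorem DD_and (h : relS X R ∈ DD X) (h' : relS X S ∈ DD X) :
    relS X (fun v => R v ∧ S v) ∈ DD X := by
  have := DD_diff h (DD_diff h h')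
  rwa [relS_congr (S := fun v => R v ∧ S v) fun v _ => by tauto] at this

theorem DD_top : ∀ n : ℕ, relS X (fun _ : Fin n → ZFSet.{0} => True) ∈ DD X
  | 0 => by
    refine subset_Cl (ZFSet.mem_singleton.2 ?_)
    ext t
    rw [mem_relS, ZFSet.mem_singleton]
    constructor
    · rintro ⟨v, -, -, rfl⟩
      rfl
    · rintro rfl
      exact ⟨Fin.elim0, fun i => i.elim0, trivial, rfl⟩
  | n + 1 => DD_prod (DD_top n)

theorem DD_not (h : relS X R ∈ DD X) : relS X (fun v => ¬ R v) ∈ DD X := by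
  have := DD_diff (DD_top n) h
  rwa [relS_congr (S := fun v => ¬ R v) fun v _ => by tauto] at this

theorem DD_coord : ∀ {n : ℕ} (i : Fin n),
    relS X (fun v : Fin (n + 1) → ZFSet.{0} => v 0 = v i.succ) ∈ DD X
  | n + 1, i => by
    refine Fin.cases ?_ (fun i => ?_) i
    · have := DD_eq (DD_top (X := X) n)
      rwa [relS_congr (S := fun v => v 0 = v (Fin.succ 0)) fun v _ => by simp] at this
    · have := DD_swap (DD_prod (DD_coord i))
      rwa [relS_congr (S := fun v => v 0 = v i.succ.succ) fun v _ => by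
        simp [Fin.tail]] at this

theorem DD_atom (P : ZFSet.{0} → ZFSet.{0} → Prop)
    (h : relS X (fun v : Fin (n + 2) → ZFSet.{0} => P (v 0) (v 1)) ∈ DD X) (i j : Fin n) :
    relS X (fun v : Fin n → ZFSet.{0} => P (v i) (v j)) ∈ DD X := by
  have := DD_proj (DD_proj (DD_and h (DD_and (DD_prod (DD_coord (X := X) j))
    (DD_coord (X := X) i.succ))))
  rwa [relS_congr (S := fun v => P (v i) (v j)) fun v hv => ?_] at this
  constructor
  · rintro ⟨y, -, x, -, h1, h2, h3⟩
    simp [Fin.tail, Fin.cons_succ] at h1 h2 h3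
    rw [← h2, ← h3]
    exact h1
  · intro h1
    refine ⟨v j, hv j, v i, hv i, ?_⟩
    simpa [Fin.tail, Fin.cons_succ] using h1

theorem relS_sat_mem_DD : ∀ {n : ℕ} (φ : Fml n), relS X (Sat X.toSet φ) ∈ DD X
  | n, .mem i j => DD_atom (fun x y => x ∈ y) (by
      have := DD_mem (DD_top (X := X) n)
      rwa [relS_congr (S := fun v => v 0 ∈ v 1) fun v _ => by simp] at this) i j
  | n, .eq i j => DD_atom (fun x y => x = y) (by
      have := DD_eq (DD_top (X := X) n)
      rwa [relS_congr (S := fun v => v 0 = v 1) fun v _ => by simp] at this) i j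
  | n, .inA i => by
      have := DD_not (DD_top (X := X) n)
      rwa [relS_congr (S := Sat X.toSet (.inA i)) fun v _ => by simp [Sat, SatAB]] at this
  | n, .inB i => by
      have := DD_not (DD_top (X := X) n)
      rwa [relS_congr (S := Sat X.toSet (.inB i)) fun v _ => by simp [Sat, SatAB]] at this
  | _, .not φ => DD_not (relS_sat_mem_DD φ)
  | _, .and φ ψ => DD_and (relS_sat_mem_DD φ) (relS_sat_mem_DD ψ)
  | _, .ex φ => DD_proj (relS_sat_mem_DD φ)

end

end DD

theorem DefSetA_eq (X : ZFSet.{0}) : DefSetA ∅ X =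
    ⋃₀ img (fun A => img (fun t => ZFSet.sep (fun z => pair z t ∈ A) X) (Tup X)) (DD X) := by
  ext B
  simp only [DefSetA, ZFSet.mem_sep, ZFSet.mem_powerset, ZFSet.mem_sUnion, mem_img]
  constructor
  · rintro ⟨-, n, φ, v, hv, rfl⟩
    refine ⟨_, ⟨_, relS_sat_mem_DD φ, rfl⟩, mem_img.2 ⟨tup v, mem_Tup.2 ⟨n, v, hv, rfl⟩, ?_⟩⟩
    refine sep_congr fun z hz => ?_
    rw [← tup_cons, tup_mem_relS (cons_mem (W := {x | x ∈ X}) hz hv)]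
    rfl
  · rintro ⟨_, ⟨A, hA, rfl⟩, hB⟩
    obtain ⟨t, ht, rfl⟩ := mem_img.1 hB
    obtain ⟨m, v, hv, rfl⟩ := mem_Tup.1 ht
    obtain ⟨n, φ, rfl⟩ := exists_of_mem_DD hA
    refine ⟨fun z hz => (ZFSet.mem_sep.1 hz).1, ?_⟩
    by_cases hnm : n = m + 1
    · subst hnm
      refine ⟨m, φ, v, hv, sep_congr fun z hz => ?_⟩
      rw [← tup_cons, tup_mem_relS (cons_mem (W := {x | x ∈ X}) hz hv)]
      rfl
    · refine ⟨0, .not (.eq 0 0), Fin.elim0, fun i => i.elim0, sep_congr fun z hz => ?_⟩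
      rw [← tup_cons, mem_relS]
      constructor
      · rintro ⟨w, -, -, e⟩
        exact absurd (tup_inj e).1 hnm
      · exact fun h => absurd rfl h

instance {n : ℕ} {f : (Fin n → ZFSet.{0}) → ZFSet.{0}} [Tm ZF f] :
    Tm ZF fun v => DefSetA ∅ (f v) := by
  refine Tm.comp1 (F := fun X => DefSetA ∅ X) ?_
  simp only [DefSetA_eq]
  infer_instance

theorem Lstage_eq (α : ZFSet.{0}) :
    Lstage α = ⋃₀ img (fun β => DefSetA ∅ (Lstage β)) α := by
  rw [Lstage, LstageA, WellFounded.fix_eq]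
  congr 1
  exact img_congr fun z hz => by simp [hz]

theorem mem_Lstage {x α : ZFSet.{0}} : x ∈ Lstage α ↔ ∃ β ∈ α, x ∈ DefSetA ∅ (Lstage β) := by
  rw [Lstage_eq]
  simp [ZFSet.mem_sUnion, mem_img]

theorem recF_unique {G : ZFSet.{0} → ZFSet.{0} → ZFSet.{0} → ZFSet.{0}} {p : ZFSet.{0}}
    {F : ZFSet.{0} → ZFSet.{0}} (h : ∀ x, F x = G p x (gr F x)) (x : ZFSet.{0}) :
    F x = recF G p x := by
  induction x using ZFSet.inductionOn with
  | _ x ih => rw [h, recF_eq, gr_congr ih]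

instance {n : ℕ} {f : (Fin n → ZFSet.{0}) → ZFSet.{0}} [hf : Tm ZF f] :
    Tm ZF fun v => Lstage (f v) := by
  have : Lstage = recF (fun _ x g => ⋃₀ img (fun β => DefSetA ∅ (app g β)) x) ∅ :=
    funext <| recF_unique fun x => by
      rw [Lstage_eq]
      exact congrArg _ (img_congr fun z hz => by rw [app_gr hz])
  rw [this]
  exact (Tm.recF inferInstance).comp2

theorem collapse_eq (X y : ZFSet.{0}) :
    collapse X y = img (fun z => collapse X z) (ZFSet.sep (fun z => z ∈ X) y) := by
  conv_lhs => rw [collapse, WellFounded.fix_eq]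
  refine img_congr fun z hz => ?_
  simp [(ZFSet.mem_sep.1 hz).1, collapse]

instance {n : ℕ} {f g : (Fin n → ZFSet.{0}) → ZFSet.{0}} [hf : Tm ZF f] [hg : Tm ZF g] :
    Tm ZF fun v => collapse (f v) (g v) := by
  have : collapse = fun X => recF (fun X y g => img (fun z => app g z)
      (ZFSet.sep (fun z => z ∈ X) y)) X := by
    funext X y
    refine recF_unique (fun y => ?_) y
    rw [collapse_eq]
    exact img_congr fun z hz => by rw [app_gr (ZFSet.mem_sep.1 hz).1]
  rw [this]
  exact (Tm.recF inferInstance).comp2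

/-! ### Elementary submodels and their transitive collapses -/

theorem mem_collapse {X x y : ZFSet.{0}} :
    x ∈ collapse X y ↔ ∃ z ∈ y, z ∈ X ∧ collapse X z = x := by
  rw [collapse_eq, mem_img]
  simp only [ZFSet.mem_sep, and_assoc]

theorem mem_collapseSet {X x : ZFSet.{0}} : x ∈ collapseSet X ↔ ∃ z ∈ X, collapse X z = x :=
  mem_img

theorem collapse_mem {X x : ZFSet.{0}} (hx : x ∈ X) : collapse X x ∈ collapseSet X :=
  mem_collapseSet.2 ⟨x, hx, rfl⟩

theorem transCl_collapseSet (X : ZFSet.{0}) : TransCl (collapseSet X).toSet := by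
  intro x hx y hy
  obtain ⟨x, hx, rfl⟩ := mem_collapseSet.1 hx
  obtain ⟨z, _, hz, rfl⟩ := mem_collapse.1 hy
  exact collapse_mem hz

theorem elemSub_of_exists {X : ZFSet.{0}} {S : Set ZFSet.{0}} (hXS : ∀ x ∈ X, x ∈ S)
    (h : ∀ {n : ℕ} (φ : Fml (n + 1)) (v : Fin n → ZFSet.{0}), (∀ i, v i ∈ X) →
      (∃ x ∈ S, Sat S φ (Fin.cons x v)) → ∃ x ∈ X, Sat S φ (Fin.cons x v)) : ElemSub X S := by
  refine ⟨fun x hx => hXS x hx, ?_⟩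
  intro n φ v hv
  induction φ with
  | mem i j => exact Iff.rfl
  | eq i j => exact Iff.rfl
  | inA i => exact Iff.rfl
  | inB i => exact Iff.rfl
  | not φ ih => exact not_congr (ih v hv)
  | and φ ψ ih ih' => exact and_congr (ih v hv) (ih' v hv)
  | ex φ ih =>
    constructor
    · rintro ⟨x, hx, hs⟩
      exact ⟨x, hXS x hx, (ih _ (cons_mem (W := X.toSet) hx hv)).1 hs⟩
    · intro hs
      obtain ⟨x, hx, hs⟩ := h φ v hv hs
      exact ⟨x, hx, (ih _ (cons_mem (W := X.toSet) hx hv)).2 hs⟩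

section ElemSub

variable {X : ZFSet.{0}} {S : Set ZFSet.{0}} (hX : ElemSub X S)
include hX

theorem ElemSub.mem {x : ZFSet.{0}} (hx : x ∈ X) : x ∈ S := hX.1 hx

theorem ElemSub.exists {C : Set ZFSet.{0} → Prop} (hS : C S) {n : ℕ}
    {R : Set ZFSet.{0} → (Fin (n + 1) → ZFSet.{0}) → Prop} (hR : Df C R)
    {v : Fin n → ZFSet.{0}} (hv : ∀ i, v i ∈ X) (h : ∃ x ∈ S, R S (Fin.cons x v)) :
    ∃ x ∈ X, R S (Fin.cons x v) := by
  obtain ⟨φ, hφ⟩ := hR.out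
  have hv' : ∀ i, v i ∈ S := fun i => hX.mem (hv i)
  obtain ⟨x, hx, hs⟩ := h
  obtain ⟨x, hx, hs⟩ := (hX.2 φ.ex v hv).2 ⟨x, hx, (hφ S hS _ (cons_mem hx hv')).2 hs⟩
  exact ⟨x, hx, (hφ S hS _ (cons_mem (hX.mem hx) hv')).1
    ((hX.2 φ _ (cons_mem (W := X.toSet) hx hv)).1 hs)⟩

theorem ElemSub.term {C : Set ZFSet.{0} → Prop} (hS : C S) {n : ℕ}
    {f : (Fin n → ZFSet.{0}) → ZFSet.{0}} (hf : Tm C f)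
    {v : Fin n → ZFSet.{0}} (hv : ∀ i, v i ∈ X) : f v ∈ X := by
  obtain ⟨x, hx, e⟩ := hX.exists hS hf.graph hv
    ⟨f v, hf.mem S hS v fun i => hX.mem (hv i), by simp⟩
  simp only [Fin.cons_zero, Fin.tail_cons] at e
  exact e ▸ hx

theorem collapse_inj (hS : TransCl S) {y z : ZFSet.{0}} (hy : y ∈ X) (hz : z ∈ X)
    (h : collapse X y = collapse X z) : y = z := by
  induction y using ZFSet.inductionOn generalizing z with
  | _ y ih =>
    by_contra hne
    have h' : ∃ w ∈ S, ¬ (w ∈ y ↔ w ∈ z) := by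
      by_contra hc
      push Not at hc
      refine hne (ZFSet.ext fun w => ⟨fun hw => ?_, fun hw => ?_⟩)
      · exact (hc w (hS y (hX.mem hy) w hw)).1 hw
      · exact (hc w (hS z (hX.mem hz) w hw)).2 hw
    obtain ⟨w, hw, hc⟩ := hX.exists (C := TransCl) hS (n := 2)
      (R := fun _ w => ¬ (w 0 ∈ Fin.tail w 0 ↔ w 0 ∈ Fin.tail w 1)) inferInstance
      (v := ![y, z]) (by simp [Fin.forall_fin_two, hy, hz]) h'
    simp only [Fin.cons_zero, Fin.tail_cons, Matrix.cons_val_zero, Matrix.cons_val_one] at hc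
    by_cases hwy : w ∈ y
    · obtain ⟨w', hw', hw'X, e⟩ := mem_collapse.1 (h ▸ mem_collapse.2 ⟨w, hwy, hw, rfl⟩)
      exact hc ⟨fun _ => (ih w hwy hw hw'X e.symm) ▸ hw', fun _ => hwy⟩
    · refine hc ⟨fun hwy' => absurd hwy' hwy, fun hwz => ?_⟩
      obtain ⟨w', hw', hw'X, e⟩ := mem_collapse.1 (h.symm ▸ mem_collapse.2 ⟨w, hwz, hw, rfl⟩)
      exact (ih w' hw' hw'X hw e) ▸ hw'

theorem collapse_mem_iff (hS : TransCl S) {y z : ZFSet.{0}} (hy : y ∈ X) :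
    collapse X y ∈ collapse X z ↔ y ∈ z := by
  rw [mem_collapse]
  constructor
  · rintro ⟨w, hw, hwX, e⟩
    exact collapse_inj hX hS hwX hy e ▸ hw
  · exact fun h => ⟨y, h, hy, rfl⟩

theorem sat_collapse (hS : TransCl S) {n : ℕ} (φ : Fml n) (v : Fin n → ZFSet.{0})
    (hv : ∀ i, v i ∈ X) :
    Sat (collapseSet X).toSet φ (fun i => collapse X (v i)) ↔ Sat X.toSet φ v := by
  induction φ with
  | mem i j => exact collapse_mem_iff hX hS (hv i)
  | eq i j => exact ⟨collapse_inj hX hS (hv i) (hv j), congrArg _⟩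
  | inA i => exact Iff.rfl
  | inB i => exact Iff.rfl
  | not φ ih => exact not_congr (ih v hv)
  | and φ ψ ih ih' => exact and_congr (ih v hv) (ih' v hv)
  | ex φ ih =>
    have e : ∀ x, (Fin.cons (collapse X x) fun i => collapse X (v i) : Fin _ → ZFSet.{0}) =
        fun i => collapse X ((Fin.cons x v : Fin _ → ZFSet.{0}) i) := fun x =>
      funext fun i => Fin.cases rfl (fun _ => rfl) i
    constructor
    · rintro ⟨x', hx', hs⟩
      obtain ⟨x, hx, rfl⟩ := mem_collapseSet.1 hx'
      exact ⟨x, hx, (ih _ (cons_mem (W := X.toSet) hx hv)).1 (e x ▸ hs)⟩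
    · rintro ⟨x, hx, hs⟩
      exact ⟨_, collapse_mem hx, (e x).symm ▸ (ih _ (cons_mem (W := X.toSet) hx hv)).2 hs⟩

theorem ElemSub.sat (hS : TransCl S) {n : ℕ} (φ : Fml n) (v : Fin n → ZFSet.{0})
    (hv : ∀ i, v i ∈ X) :
    Sat (collapseSet X).toSet φ (fun i => collapse X (v i)) ↔ Sat S φ v :=
  (sat_collapse hX hS φ v hv).trans (hX.2 φ v hv)

theorem ElemSub.transfer {C : Set ZFSet.{0} → Prop} (hS : C S) (hM : C (collapseSet X).toSet)
    (hS' : TransCl S) {n : ℕ} {R : Set ZFSet.{0} → (Fin n → ZFSet.{0}) → Prop} (hR : Df C R)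
    (v : Fin n → ZFSet.{0}) (hv : ∀ i, v i ∈ X) :
    R (collapseSet X).toSet (fun i => collapse X (v i)) ↔ R S v := by
  obtain ⟨φ, hφ⟩ := hR.out
  rw [← hφ S hS v fun i => hX.mem (hv i), ← hφ _ hM _ fun i => collapse_mem (hv i)]
  exact hX.sat hS' φ v hv

theorem ElemSub.collapse_term (hS : ZF S) (hM : ZF (collapseSet X).toSet) {n : ℕ}
    {f : (Fin n → ZFSet.{0}) → ZFSet.{0}} (hf : Tm ZF f)
    {v : Fin n → ZFSet.{0}} (hv : ∀ i, v i ∈ X) :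
    collapse X (f v) = f fun i => collapse X (v i) :=
  (hX.transfer hS hM hS.trans hf.graph (Fin.cons (f v) v)
    (cons_mem (W := X.toSet) (hX.term hS hf hv) hv)).2 rfl

theorem ElemSub.zf (hS : ZF S) : ZF (collapseSet X).toSet := by
  have ht := transCl_collapseSet X
  have tr : ∀ {n : ℕ} {R : Set ZFSet.{0} → (Fin n → ZFSet.{0}) → Prop} (_ : Df TransCl R)
    (v : Fin n → ZFSet.{0}) (_ : ∀ i, v i ∈ X),
    R (collapseSet X).toSet (fun i => collapse X (v i)) ↔ R S v := fun hR v hv =>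
      hX.transfer hS.trans ht hS.trans hR v hv
  refine ⟨ht, ?_, ?_, ?_, ?_, ?_⟩
  · have h := (tr (n := 0) (R := fun W _ => ∃ o ∈ W, (∃ e ∈ o, ∀ x ∈ e, x ≠ x) ∧
      ∀ n ∈ o, ∃ s ∈ o, ∀ x ∈ W, x ∈ s ↔ (x ∈ n ∨ x = n)) inferInstance Fin.elim0
      fun i => i.elim0).2 ?_
    · obtain ⟨o, ho, ⟨e, he, he'⟩, h⟩ := h
      refine ⟨o, ho, ?_, fun n hn => ?_⟩
      · rwa [← (ZFSet.eq_empty e).2 fun x hx => he' x hx rfl]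
      · obtain ⟨s, hs, h⟩ := h n hn
        convert hs
        ext x
        rw [ZFSet.mem_insert_iff]
        constructor
        · rintro (rfl | hx)
          · exact (h _ (ht o ho _ hn)).2 (.inr rfl)
          · exact (h _ (ht _ (ht o ho _ hn) _ hx)).2 (.inl hx)
        · intro hx
          exact ((h _ (ht _ (ht o ho _ hs) _ hx)).1 hx).symm
    · obtain ⟨o, ho, he, h⟩ := hS.ind
      refine ⟨o, ho, ⟨∅, he, fun x hx => absurd hx (ZFSet.notMem_empty x)⟩,
        fun n hn => ⟨_, h n hn, fun x _ => ?_⟩⟩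
      rw [ZFSet.mem_insert_iff, or_comm]
  · have h := (tr (n := 0) (R := fun W _ => ∀ x ∈ W, ∀ y ∈ W, ∃ p ∈ W, ∀ z ∈ W,
      z ∈ p ↔ (z = x ∨ z = y)) inferInstance Fin.elim0 fun i => i.elim0).2 ?_
    · intro x hx y hy
      obtain ⟨p, hp, h⟩ := h x hx y hy
      convert hp
      ext z
      rw [ZFSet.mem_pair]
      constructor
      · rintro (rfl | rfl)
        · exact (h _ hx).2 (.inl rfl)
        · exact (h _ hy).2 (.inr rfl)
      · exact fun hz => (h z (ht _ hp _ hz)).1 hz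
    · exact fun x hx y hy => ⟨_, hS.pair x hx y hy, fun z _ => ZFSet.mem_pair⟩
  · have h := (tr (n := 0) (R := fun W _ => ∀ x ∈ W, ∃ p ∈ W, ∀ z ∈ W,
      z ∈ p ↔ ∃ y ∈ x, z ∈ y) inferInstance Fin.elim0 fun i => i.elim0).2 ?_
    · intro x hx
      obtain ⟨p, hp, h⟩ := h x hx
      convert hp
      ext z
      rw [ZFSet.mem_sUnion]
      constructor
      · rintro ⟨y, hy, hz⟩
        exact (h _ (ht _ (ht _ hx _ hy) _ hz)).2 ⟨y, hy, hz⟩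
      · exact fun hz => (h z (ht _ hp _ hz)).1 hz
    · exact fun x hx => ⟨_, hS.sUnion x hx, fun z _ => ZFSet.mem_sUnion⟩
  · intro n φ v hv a ha
    choose v' hv' e using fun i => mem_collapseSet.1 (hv i)
    obtain rfl : (fun i => collapse X (v' i)) = v := funext e
    have hd : Df TransCl fun W (w : Fin (n + 3) → ZFSet.{0}) => Sat W φ (Fin.cons (w 0)
        (Fin.tail (Fin.tail (Fin.tail w)))) :=
      ((Df.sat φ).comp (Fin.cases 0 fun i => i.succ.succ.succ)).congr fun W _ w _ =>
        iff_of_eq <| congrArg _ <| funext fun i => Fin.cases rfl (fun _ => rfl) i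
    have h := (tr (R := fun W v => ∀ a ∈ W, ∃ b ∈ W, ∀ z ∈ W,
      z ∈ b ↔ (z ∈ a ∧ Sat W φ (Fin.cons z v))) inferInstance v' hv').2 ?_
    · obtain ⟨b, hb, h⟩ := h a ha
      convert hb
      ext z
      rw [ZFSet.mem_sep]
      constructor
      · exact fun hz => (h z (ht _ ha _ hz.1)).2 hz
      · exact fun hz => (h z (ht _ hb _ hz)).1 hz
    · exact fun a ha => ⟨_, hS.sep φ v' (fun i => hX.mem (hv' i)) a ha,
        fun z _ => ZFSet.mem_sep⟩
  · intro n φ v hv a ha hh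
    choose v' hv' e using fun i => mem_collapseSet.1 (hv i)
    obtain rfl : (fun i => collapse X (v' i)) = v := funext e
    have hd : Df TransCl fun W (w : Fin (n + 3) → ZFSet.{0}) => Sat W φ (Fin.cons (w 0)
        (Fin.cons (Fin.tail w 0) (Fin.tail (Fin.tail (Fin.tail w))))) :=
      ((Df.sat φ).comp (Fin.cases 0 (Fin.cases 1 fun i => i.succ.succ.succ))).congr
        fun W _ w _ => iff_of_eq <| congrArg _ <| funext fun i =>
          Fin.cases rfl (fun i => Fin.cases rfl (fun _ => rfl) i) i
    have hd' : Df TransCl fun W (w : Fin (n + 4) → ZFSet.{0}) => Sat W φ (Fin.cons (w 0)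
        (Fin.cons (Fin.tail w 0) (Fin.tail (Fin.tail (Fin.tail (Fin.tail w)))))) :=
      ((Df.sat φ).comp (Fin.cases 0 (Fin.cases 1 fun i => i.succ.succ.succ.succ))).congr
        fun W _ w _ => iff_of_eq <| congrArg _ <| funext fun i =>
          Fin.cases rfl (fun i => Fin.cases rfl (fun _ => rfl) i) i
    have h := (tr (R := fun W v => ∀ a ∈ W,
      (∀ x ∈ a, ∃ y ∈ W, Sat W φ (Fin.cons y (Fin.cons x v))) →
      ∃ b ∈ W, ∀ x ∈ a, ∃ y ∈ b, Sat W φ (Fin.cons y (Fin.cons x v))) inferInstance v' hv').2 ?_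
    · obtain ⟨b, hb, h⟩ := h a ha hh
      exact ⟨b, hb, fun x hx => let ⟨y, hy, h'⟩ := h x hx; ⟨y, hy, ht b hb _ hy, h'⟩⟩
    · intro a ha hh
      obtain ⟨b, hb, h⟩ := hS.coll φ v' (fun i => hX.mem (hv' i)) a ha hh
      exact ⟨b, hb, fun x hx => let ⟨y, hy, _, h'⟩ := h x hx; ⟨y, hy, h'⟩⟩

end ElemSub

/-! ### The constructible hierarchy -/

theorem mem_DefSet {X B : ZFSet.{0}} : B ∈ DefSetA ∅ X ↔
    ∃ (n : ℕ) (φ : Fml (n + 1)) (v : Fin n → ZFSet.{0}), (∀ i, v i ∈ X) ∧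
      B = ZFSet.sep (fun z => Sat X.toSet φ (Fin.cons z v)) X := by
  rw [DefSetA, ZFSet.mem_sep, ZFSet.mem_powerset]
  refine ⟨fun h => h.2, fun h => ⟨?_, h⟩⟩
  obtain ⟨n, φ, v, hv, rfl⟩ := h
  exact fun z hz => (ZFSet.mem_sep.1 hz).1

theorem sep_mem_DefSet {X : ZFSet.{0}} {C : Set ZFSet.{0} → Prop} (hX : C X.toSet) {n : ℕ}
    {R : Set ZFSet.{0} → (Fin (n + 1) → ZFSet.{0}) → Prop} (hR : Df C R)
    {v : Fin n → ZFSet.{0}} (hv : ∀ i, v i ∈ X) :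
    ZFSet.sep (fun z => R X.toSet (Fin.cons z v)) X ∈ DefSetA ∅ X := by
  obtain ⟨φ, hφ⟩ := hR.out
  exact mem_DefSet.2 ⟨n, φ, v, hv, sep_congr fun z hz =>
    (hφ _ hX _ (cons_mem (W := X.toSet) hz hv)).symm⟩

theorem subset_of_mem_DefSet {X B : ZFSet.{0}} (h : B ∈ DefSetA ∅ X) : B ⊆ X :=
  ZFSet.mem_powerset.1 (ZFSet.mem_sep.1 h).1

theorem self_mem_DefSet (X : ZFSet.{0}) : X ∈ DefSetA ∅ X := by
  convert sep_mem_DefSet (X := X) (C := fun _ => True) trivial (n := 0)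
    (R := fun _ w => w 0 = w 0) inferInstance (v := Fin.elim0) (fun i => i.elim0) using 1
  ext z
  simp

theorem Lstage_mono {α β : ZFSet.{0}} (h : α ⊆ β) : Lstage α ⊆ Lstage β := fun _ hx =>
  let ⟨γ, hγ, hx⟩ := mem_Lstage.1 hx
  mem_Lstage.2 ⟨γ, h hγ, hx⟩

theorem Lstage_mem {α β : ZFSet.{0}} (h : α ∈ β) : Lstage α ∈ Lstage β :=
  mem_Lstage.2 ⟨α, h, self_mem_DefSet _⟩

theorem Lstage_trans {α : ZFSet.{0}} (hα : α.IsOrdinal) : TransCl (Lstage α).toSet :=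
  fun _ hx _ hy =>
    let ⟨_, hγ, hx⟩ := mem_Lstage.1 hx
    Lstage_mono (hα.subset_of_mem hγ) (subset_of_mem_DefSet hx hy)

theorem isOrdinal_iff' {x : ZFSet.{0}} : x.IsOrdinal ↔
    ∀ y ∈ x, (∀ z ∈ y, z ∈ x) ∧ ∀ z ∈ y, ∀ w ∈ z, w ∈ y := by
  rw [← isOrd_iff]
  exact ⟨fun h y hy => ⟨fun z hz => h.1 y hy hz, fun z hz w hw => h.2 y hy z hz hw⟩,
    fun h => ⟨fun y hy z hz => (h y hy).1 z hz, fun y hy z hz w hw => (h y hy).2 z hz w hw⟩⟩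

theorem mem_of_mem_Lstage {α x : ZFSet.{0}} (hα : α.IsOrdinal) (hx : x.IsOrdinal)
    (h : x ∈ Lstage α) : x ∈ α := by
  induction α using ZFSet.inductionOn generalizing x with
  | _ α ih =>
    obtain ⟨γ, hγ, h⟩ := mem_Lstage.1 h
    have hsub : x ⊆ γ := fun y hy =>
      ih γ hγ (hα.mem hγ) (hx.mem hy) (subset_of_mem_DefSet h hy)
    exact hx.mem_of_subset_of_mem hα hsub hγ

theorem mem_Lstage_of_mem {α x : ZFSet.{0}} (hα : α.IsOrdinal) (h : x ∈ α) :
    x ∈ Lstage α := by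
  induction α using ZFSet.inductionOn generalizing x with
  | _ α ih =>
    have hx := hα.mem h
    refine mem_Lstage.2 ⟨x, h, ?_⟩
    convert sep_mem_DefSet (X := Lstage x) (C := TransCl) (Lstage_trans hx) (n := 0)
      (R := fun _ w => ∀ y ∈ w 0, (∀ z ∈ y, z ∈ w 0) ∧ ∀ z ∈ y, ∀ u ∈ z, u ∈ y) inferInstance
      (v := Fin.elim0) (fun i => i.elim0) using 1
    ext y
    simp only [ZFSet.mem_sep, Fin.cons_zero, ← isOrdinal_iff']
    exact ⟨fun hy => ⟨ih x h hx hy, hx.mem hy⟩, fun hy => mem_of_mem_Lstage hx hy.2 hy.1⟩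

/-- Regular classes of ordinals containing `ω`. -/
structure OrdIdx (I : Set ZFSet.{0}) : Prop where
  ord : ∀ α ∈ I, α.IsOrdinal
  down : ∀ α ∈ I, ∀ β ∈ α, β ∈ I
  succ : ∀ α ∈ I, insert α α ∈ I
  omega : ZFSet.omega ∈ I
  reg : ∀ a : ZFSet.{0}, (∃ α ∈ I, a ∈ Lstage α) → ∀ r : ZFSet.{0} → ZFSet.{0},
    (∀ x ∈ a, r x ∈ I) → ∃ β ∈ I, ∀ x ∈ a, r x ∈ β

/-- The union of the `L_α` for `α ∈ I`. -/
def LW (I : Set ZFSet.{0}) : Set ZFSet.{0} := {x | ∃ α ∈ I, x ∈ Lstage α}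

section LW

variable {I : Set ZFSet.{0}} (hI : OrdIdx I)
include hI

theorem OrdIdx.max {α β : ZFSet.{0}} (hα : α ∈ I) (hβ : β ∈ I) :
    ∃ γ ∈ I, α ∈ γ ∧ β ∈ γ := by
  rcases (hI.ord α hα).mem_or_subset (hI.ord β hβ) with h | h
  · exact ⟨_, hI.succ β hβ, by simp [h], by simp⟩
  · refine ⟨_, hI.succ α hα, by simp, ?_⟩
    rcases ((hI.ord β hβ).subset_iff_eq_or_mem (hI.ord α hα)).1 h with rfl | h <;> simp [*]

theorem OrdIdx.Lstage_subset {α β : ZFSet.{0}} (hα : α ∈ I) (h : β ∈ α) :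
    Lstage β ⊆ Lstage α := Lstage_mono ((hI.ord α hα).subset_of_mem h)

theorem LW_trans : TransCl (LW I) := fun x ⟨α, hα, hx⟩ y hy =>
  ⟨α, hα, Lstage_trans (hI.ord α hα) x hx y hy⟩

theorem LW_of_DefSet {α x : ZFSet.{0}} (hα : α ∈ I) (hx : x ∈ DefSetA ∅ (Lstage α)) :
    x ∈ LW I := ⟨_, hI.succ α hα, mem_Lstage.2 ⟨α, by simp, hx⟩⟩

theorem OrdIdx.mem_LW {α : ZFSet.{0}} (hα : α ∈ I) : α ∈ LW I :=
  ⟨_, hI.succ α hα, mem_Lstage_of_mem (hI.ord _ (hI.succ α hα)) (by simp)⟩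

theorem LW_max {n : ℕ} {v : Fin n → ZFSet.{0}} (hv : ∀ i, v i ∈ LW I) {α : ZFSet.{0}}
    (hα : α ∈ I) : ∃ β ∈ I, α ∈ β ∧ ∀ i, v i ∈ Lstage β := by
  induction n with
  | zero => exact ⟨_, hI.succ α hα, by simp, fun i => i.elim0⟩
  | succ n ih =>
    obtain ⟨β, hβ, hαβ, h⟩ := ih (v := Fin.tail v) fun i => hv i.succ
    obtain ⟨γ, hγ, h0⟩ := hv 0
    obtain ⟨δ, hδ, hβδ, hγδ⟩ := hI.max hβ hγ
    refine ⟨δ, hδ, (hI.ord δ hδ).mem_trans hαβ hβδ, fun i => ?_⟩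
    exact Fin.cases (hI.Lstage_subset hδ hγδ h0)
      (fun i => hI.Lstage_subset hδ hβδ (h i)) i

theorem OrdIdx.bound {n : ℕ} (P : (Fin n → ZFSet.{0}) → ZFSet.{0}) {a : ZFSet.{0}}
    (ha : ∃ α ∈ I, a ∈ Lstage α) (hP : ∀ v, (∀ i, v i ∈ a) → P v ∈ I) :
    ∃ β ∈ I, ∀ v, (∀ i, v i ∈ a) → P v ∈ β := by
  induction n with
  | zero =>
    refine ⟨_, hI.succ _ (hP Fin.elim0 fun i => i.elim0), fun v _ => ?_⟩
    rw [Subsingleton.elim v Fin.elim0]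
    simp
  | succ n ih =>
    have h : ∀ x ∈ a, ∃ β ∈ I, ∀ v : Fin n → ZFSet.{0}, (∀ i, v i ∈ a) →
        P (Fin.cons x v) ∈ β := fun x hx =>
      ih (fun v => P (Fin.cons x v)) fun v hv => hP _ (cons_mem (W := a.toSet) hx hv)
    have h' : ∀ x, ∃ β, x ∈ a → β ∈ I ∧ ∀ v : Fin n → ZFSet.{0}, (∀ i, v i ∈ a) →
        P (Fin.cons x v) ∈ β := fun x => by
      by_cases hx : x ∈ a
      · obtain ⟨β, h⟩ := h x hx
        exact ⟨β, fun _ => h⟩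
      · exact ⟨∅, fun h => absurd h hx⟩
    choose r hr using h'
    obtain ⟨β, hβ, hb⟩ := hI.reg a ha r fun x hx => (hr x hx).1
    refine ⟨β, hβ, fun v hv => ?_⟩
    have := (hr (v 0) (hv 0)).2 (Fin.tail v) fun i => hv i.succ
    rw [Fin.cons_self_tail] at this
    exact (hI.ord β hβ).mem_trans this (hb _ (hv 0))

omit hI in
theorem exists_Lstage_of_limit {β : ZFSet.{0}} (ho : β.IsOrdinal) (hne : ∃ α, α ∈ β)
    (hs : ∀ α ∈ β, insert α α ∈ β) {n : ℕ} {v : Fin n → ZFSet.{0}}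
    (hv : ∀ i, v i ∈ Lstage β) : ∃ α ∈ β, ∀ i, v i ∈ Lstage α := by
  induction n with
  | zero => exact hne.imp fun α hα => ⟨hα, fun i => i.elim0⟩
  | succ n ih =>
    obtain ⟨α, hα, h⟩ := ih (v := Fin.tail v) fun i => hv i.succ
    obtain ⟨γ, hγ, h0⟩ := mem_Lstage.1 (hv 0)
    have h0 : v 0 ∈ Lstage (insert γ γ) := mem_Lstage.2 ⟨γ, by simp, h0⟩
    have hγ' := hs γ hγ
    rcases (ho.mem hα).subset_total (ho.mem hγ') with hh | hh
    · exact ⟨_, hγ', fun i => Fin.cases h0 (fun i => Lstage_mono hh (h i)) i⟩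
    · exact ⟨_, hα, fun i => Fin.cases (Lstage_mono hh h0) h i⟩

/-- Limit ordinals in `I` closed under `F`. -/
def ClosedUnder (I : Set ZFSet.{0}) (F : ZFSet.{0} → ZFSet.{0}) (β : ZFSet.{0}) : Prop :=
  β ∈ I ∧ (∃ α, α ∈ β) ∧ (∀ α ∈ β, insert α α ∈ β) ∧ ∀ α ∈ β, F α ∈ β

theorem exists_closedUnder {F : ZFSet.{0} → ZFSet.{0}} (hF : ∀ α ∈ I, F α ∈ I)
    {α : ZFSet.{0}} (hα : α ∈ I) : ∃ β, α ∈ β ∧ ClosedUnder I F β := by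
  have h : ∀ γ, ∃ δ, γ ∈ I → δ ∈ I ∧ γ ∈ δ ∧ ∀ ξ ∈ insert γ γ, F ξ ∈ δ := fun γ => by
    by_cases hγ : γ ∈ I
    · have hs := hI.mem_LW (hI.succ γ hγ)
      obtain ⟨δ, hδ, h⟩ := hI.reg _ hs F fun ξ hξ => hF ξ (by
        rcases ZFSet.mem_insert_iff.1 hξ with rfl | hξ
        · exact hγ
        · exact hI.down γ hγ ξ hξ)
      obtain ⟨ε, hε, h1, h2⟩ := hI.max hγ hδ
      exact ⟨ε, fun _ => ⟨hε, h1, fun ξ hξ => (hI.ord ε hε).mem_trans (h ξ hξ) h2⟩⟩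
    · exact ⟨∅, fun h => absurd h hγ⟩
  choose g hg using h
  have hs : ∀ n, g^[n] α ∈ I := fun n => by
    induction n with
    | zero => exact hα
    | succ n ih => rw [Function.iterate_succ_apply']; exact (hg _ ih).1
  have homega := hI.mem_LW hI.omega
  obtain ⟨β, hβ, hb⟩ := hI.reg _ homega (fun k => g^[Function.invFun natZ k] α) fun k _ => hs _
  have hb' : ∀ n, g^[n] α ∈ β := fun n => by
    have := hb (natZ n) (nat_mem_omega n)
    rwa [Function.leftInverse_invFun natZ_injective] at this
  have hβo := hI.ord β hβ
  set γ := ZFSet.sep (fun ξ => ∃ n, ξ ∈ g^[n] α) β with hγ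
  have hm : ∀ {ξ}, ξ ∈ γ ↔ ∃ n, ξ ∈ g^[n] α := fun {ξ} => by
    rw [hγ, ZFSet.mem_sep]
    exact ⟨fun h => h.2, fun h => ⟨let ⟨n, hn⟩ := h; hβo.mem_trans hn (hb' n), h⟩⟩
  have hγo : γ.IsOrdinal := by
    rw [isOrdinal_iff']
    intro y hy
    obtain ⟨n, hn⟩ := hm.1 hy
    have ho := hI.ord _ (hs n)
    exact ⟨fun z hz => hm.2 ⟨n, ho.mem_trans hz hn⟩,
      fun z hz w hw => (ho.mem hn).mem_trans hw hz⟩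
  have hγI : γ ∈ I := by
    have : γ ⊆ β := fun x hx => (ZFSet.mem_sep.1 hx).1
    rcases (hγo.subset_iff_eq_or_mem hβo).1 this with h | h
    · exact h ▸ hβ
    · exact hI.down β hβ _ h
  have hstep : ∀ n, g^[n] α ∈ g^[n + 1] α := fun n => by
    rw [Function.iterate_succ_apply']
    exact (hg _ (hs n)).2.1
  refine ⟨γ, hm.2 ⟨1, hstep 0⟩, hγI, ⟨α, hm.2 ⟨1, hstep 0⟩⟩, fun ξ hξ => ?_, fun ξ hξ => ?_⟩
  · obtain ⟨n, hn⟩ := hm.1 hξ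
    refine hm.2 ⟨n + 1, ?_⟩
    refine (ZFSet.isOrdinal_succ (hγo.mem hξ)).mem_of_subset_of_mem (hI.ord _ (hs (n + 1)))
      (y := g^[n] α) (fun z hz => ?_) (hstep n)
    rcases ZFSet.mem_insert_iff.1 hz with rfl | hz
    · exact hn
    · exact (hI.ord _ (hs n)).mem_trans hz hn
  · obtain ⟨n, hn⟩ := hm.1 hξ
    refine hm.2 ⟨n + 1, ?_⟩
    rw [Function.iterate_succ_apply']
    exact (hg _ (hs n)).2.2 ξ (by simp [hn])

theorem reflection {n : ℕ} (φ : Fml n) : ∃ F : ZFSet.{0} → ZFSet.{0}, (∀ α ∈ I, F α ∈ I) ∧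
    ∀ β, ClosedUnder I F β → ∀ v : Fin n → ZFSet.{0}, (∀ i, v i ∈ Lstage β) →
      (Sat (Lstage β).toSet φ v ↔ Sat (LW I) φ v) := by
  have triv : ∀ α ∈ I, (fun x : ZFSet.{0} => x) α ∈ I := fun α h => h
  induction φ with
  | mem i j => exact ⟨_, triv, fun β _ v _ => Iff.rfl⟩
  | eq i j => exact ⟨_, triv, fun β _ v _ => Iff.rfl⟩
  | inA i => exact ⟨_, triv, fun β _ v _ => Iff.rfl⟩
  | inB i => exact ⟨_, triv, fun β _ v _ => Iff.rfl⟩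
  | not φ ih =>
    obtain ⟨F, hF, h⟩ := ih
    exact ⟨F, hF, fun β hβ v hv => not_congr (h β hβ v hv)⟩
  | and φ ψ ih ih' =>
    obtain ⟨F, hF, h⟩ := ih
    obtain ⟨F', hF', h'⟩ := ih'
    have hc : ∀ α, ∃ γ, α ∈ I → γ ∈ I ∧ F α ∈ γ ∧ F' α ∈ γ := fun α => by
      by_cases hα : α ∈ I
      · obtain ⟨γ, hγ⟩ := hI.max (hF α hα) (hF' α hα)
        exact ⟨γ, fun _ => hγ⟩
      · exact ⟨∅, fun h => absurd h hα⟩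
    choose G hG using hc
    refine ⟨G, fun α hα => (hG α hα).1, fun β ⟨hβ, hne, hs, hc⟩ v hv => ?_⟩
    have ho := hI.ord β hβ
    exact and_congr
      (h β ⟨hβ, hne, hs, fun α hα =>
        ho.mem_trans (hG α (hI.down β hβ α hα)).2.1 (hc α hα)⟩ v hv)
      (h' β ⟨hβ, hne, hs, fun α hα =>
        ho.mem_trans (hG α (hI.down β hβ α hα)).2.2 (hc α hα)⟩ v hv)
  | @ex n φ ih =>
    obtain ⟨F, hF, h⟩ := ih
    have hw : ∀ v : Fin n → ZFSet.{0}, ∃ γ ∈ I, (∃ x ∈ LW I, Sat (LW I) φ (Fin.cons x v)) →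
        ∃ x ∈ Lstage γ, Sat (LW I) φ (Fin.cons x v) := fun v => by
      by_cases hx : ∃ x ∈ LW I, Sat (LW I) φ (Fin.cons x v)
      · obtain ⟨x, ⟨γ, hγ, hx⟩, hs⟩ := hx
        exact ⟨γ, hγ, fun _ => ⟨x, hx, hs⟩⟩
      · exact ⟨_, hI.omega, fun h => absurd h hx⟩
    choose P hPI hP using hw
    have hc : ∀ α, ∃ γ, α ∈ I → γ ∈ I ∧ F α ∈ γ ∧
        ∀ v : Fin n → ZFSet.{0}, (∀ i, v i ∈ Lstage α) → P v ∈ γ := fun α => by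
      by_cases hα : α ∈ I
      · obtain ⟨γ, hγ, h⟩ := hI.bound P (a := Lstage α)
          ⟨_, hI.succ α hα, Lstage_mem (by simp)⟩ fun v _ => hPI v
        obtain ⟨δ, hδ, h1, h2⟩ := hI.max hγ (hF α hα)
        exact ⟨δ, fun _ => ⟨hδ, h2, fun v hv => (hI.ord δ hδ).mem_trans (h v hv) h1⟩⟩
      · exact ⟨∅, fun h => absurd h hα⟩
    choose G hG using hc
    refine ⟨G, fun α hα => (hG α hα).1, fun β ⟨hβ, hne, hs, hc⟩ v hv => ?_⟩
    have ho := hI.ord β hβ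
    have hβ' : ClosedUnder I F β := ⟨hβ, hne, hs, fun α hα =>
        ho.mem_trans (hG α (hI.down β hβ α hα)).2.1 (hc α hα)⟩
    constructor
    · rintro ⟨x, hx, hsat⟩
      exact ⟨x, ⟨β, hβ, hx⟩, (h β hβ' _ (cons_mem (W := (Lstage β).toSet) hx hv)).1 hsat⟩
    · intro hsat
      obtain ⟨x, hx, hsat⟩ := hP v hsat
      obtain ⟨α, hα, hvα⟩ := exists_Lstage_of_limit ho hne hs hv
      have hPβ : P v ∈ β := ho.mem_trans ((hG α (hI.down β hβ α hα)).2.2 v hvα) (hc α hα)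
      have hx' := hI.Lstage_subset hβ hPβ hx
      exact ⟨x, hx', (h β hβ' _ (cons_mem (W := (Lstage β).toSet) hx' hv)).2 hsat⟩


theorem LW_zf : ZF (LW I) := by
  have ht := LW_trans hI
  refine ⟨ht, ⟨_, hI.mem_LW hI.omega, ZFSet.omega_zero, fun n => ZFSet.omega_succ⟩, ?_, ?_, ?_, ?_⟩
  · intro x hx y hy
    obtain ⟨β, hβ, -, h⟩ := LW_max hI (v := ![x, y]) (by simp [Fin.forall_fin_two, hx, hy]) hI.omega
    refine LW_of_DefSet hI hβ ?_
    convert sep_mem_DefSet (X := Lstage β) (C := TransCl) (Lstage_trans (hI.ord β hβ))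
      (R := fun _ w => w 0 = Fin.tail w 0 ∨ w 0 = Fin.tail w 1) inferInstance h using 1
    ext z
    simp only [ZFSet.mem_sep, ZFSet.mem_pair, Fin.cons_zero, Fin.tail_cons, Matrix.cons_val_zero,
      Matrix.cons_val_one]
    refine ⟨fun hz => ⟨?_, hz⟩, fun hz => hz.2⟩
    rcases hz with rfl | rfl
    · exact h 0
    · exact h 1
  · intro x ⟨β, hβ, hx⟩
    have hβt := Lstage_trans (hI.ord β hβ)
    refine LW_of_DefSet hI hβ ?_
    convert sep_mem_DefSet (X := Lstage β) (C := TransCl) hβt (n := 1)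
      (R := fun _ w => ∃ y ∈ Fin.tail w 0, w 0 ∈ y) inferInstance (v := fun _ => x)
      (fun _ => hx) using 1
    ext z
    simp only [ZFSet.mem_sep, ZFSet.mem_sUnion, Fin.cons_zero, Fin.tail_cons]
    exact ⟨fun hz => ⟨let ⟨y, hy, hz⟩ := hz; hβt _ (hβt _ hx _ hy) _ hz, hz⟩, fun hz => hz.2⟩
  · intro n φ v hv a ha
    obtain ⟨F, hF, hrefl⟩ := reflection hI φ
    obtain ⟨α, hα, -, h⟩ := LW_max hI (cons_mem ha hv) hI.omega
    obtain ⟨β, hαβ, hβ⟩ := exists_closedUnder hI hF hα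
    have hsub := hI.Lstage_subset hβ.1 hαβ
    have hβt := Lstage_trans (hI.ord β hβ.1)
    refine LW_of_DefSet hI hβ.1 ?_
    have hd : Df TransCl fun W (w : Fin (n + 2) → ZFSet.{0}) => Sat W φ (Fin.cons (w 0)
        (Fin.tail (Fin.tail w))) :=
      ((Df.sat φ).comp (Fin.cases 0 fun i => i.succ.succ)).congr fun W _ w _ =>
        iff_of_eq <| congrArg _ <| funext fun i => Fin.cases rfl (fun _ => rfl) i
    convert sep_mem_DefSet (X := Lstage β) (C := TransCl) hβt
      (R := fun W w => w 0 ∈ Fin.tail w 0 ∧ Sat W φ (Fin.cons (w 0) (Fin.tail (Fin.tail w))))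
      inferInstance (v := Fin.cons a v) (fun i => hsub (h i)) using 1
    have haβ : a ∈ Lstage β := hsub (h 0)
    have hvβ : ∀ i, v i ∈ Lstage β := fun i => hsub (h i.succ)
    ext z
    simp only [ZFSet.mem_sep, Fin.cons_zero, Fin.tail_cons]
    constructor
    · rintro ⟨hz, hs⟩
      have hzβ := hβt _ haβ _ hz
      exact ⟨hzβ, hz, (hrefl β hβ _ (cons_mem (W := (Lstage β).toSet) hzβ hvβ)).2 hs⟩
    · rintro ⟨hzβ, hz, hs⟩
      exact ⟨hz, (hrefl β hβ _ (cons_mem (W := (Lstage β).toSet) hzβ hvβ)).1 hs⟩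
  · intro n φ v hv a ha h
    have h' : ∀ x, ∃ γ, x ∈ a → γ ∈ I ∧ ∃ y ∈ Lstage γ, Sat (LW I) φ (Fin.cons y (Fin.cons x v)) := by
      intro x
      by_cases hx : x ∈ a
      · obtain ⟨y, ⟨γ, hγ, hy⟩, hs⟩ := h x hx
        exact ⟨γ, fun _ => ⟨hγ, y, hy, hs⟩⟩
      · exact ⟨∅, fun h => absurd h hx⟩
    choose r hr using h'
    obtain ⟨β, hβ, hb⟩ := hI.reg a ha r fun x hx => (hr x hx).1
    refine ⟨Lstage β, ⟨_, hI.succ β hβ, Lstage_mem (by simp)⟩, fun x hx => ?_⟩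
    obtain ⟨y, hy, hs⟩ := (hr x hx).2
    have hy' := hI.Lstage_subset hβ (hb x hx) hy
    exact ⟨y, hy', ⟨β, hβ, hy'⟩, hs⟩

end LW

theorem isOrdinal_sUnion {a : ZFSet.{0}} (h : ∀ x ∈ a, x.IsOrdinal) :
    (⋃₀ a : ZFSet.{0}).IsOrdinal := by
  rw [isOrdinal_iff']
  intro y hy
  obtain ⟨x, hx, hy⟩ := ZFSet.mem_sUnion.1 hy
  exact ⟨fun z hz => ZFSet.mem_sUnion.2 ⟨x, hx, (h x hx).mem_trans hz hy⟩,
    fun z hz w hw => ((h x hx).mem hy).mem_trans hw hz⟩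

theorem ordIdx_ord : OrdIdx {α | IsOrd α} where
  ord α h := isOrd_iff.1 h
  down α h β hβ := isOrd_iff.2 ((isOrd_iff.1 h).mem hβ)
  succ α h := isOrd_iff.2 (ZFSet.isOrdinal_succ (isOrd_iff.1 h))
  omega := isOrd_iff.2 isOrdinal_omega
  reg a _ r hr := by
    have ho : ∀ x ∈ a, (r x).IsOrdinal := fun x hx => isOrd_iff.1 (hr x hx)
    refine ⟨⋃₀ img (fun x => insert (r x) (r x)) a, isOrd_iff.2 (isOrdinal_sUnion ?_),
      fun x hx => ZFSet.mem_sUnion.2 ⟨_, mem_img.2 ⟨x, hx, rfl⟩, by simp⟩⟩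
    intro y hy
    obtain ⟨x, hx, rfl⟩ := mem_img.1 hy
    exact ZFSet.isOrdinal_succ (ho x hx)

theorem LClass_zf : ZF LClass := LW_zf ordIdx_ord

/-! ### Cardinality and `H_κ` -/

theorem cardLE_iff {x y : ZFSet.{0}} : CardLE x y ↔ x.card ≤ y.card := by
  rw [CardLE, ← Cardinal.lift_le.{1}, ← ZFSet.cardinalMk_coe_sort, ← ZFSet.cardinalMk_coe_sort]
  exact (Cardinal.le_def _ _).symm

theorem eqNum_iff {x y : ZFSet.{0}} : EqNum x y ↔ x.card = y.card := by
  rw [EqNum, ← Cardinal.lift_inj.{0, 1}, ← ZFSet.cardinalMk_coe_sort,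
    ← ZFSet.cardinalMk_coe_sort]
  exact Cardinal.eq.symm

theorem card_img_le (F : ZFSet.{0} → ZFSet.{0}) (a : ZFSet.{0}) : (img F a).card ≤ a.card :=
  @ZFSet.card_image_le a F (Classical.allZFSetDefinable _)

theorem card_sUnion_img_le {F : ZFSet.{0} → ZFSet.{0}} {a : ZFSet.{0}} {c : Cardinal.{0}}
    (h : ∀ x ∈ a, (F x).card ≤ c) : (⋃₀ img F a : ZFSet.{0}).card ≤ a.card * c := by
  rw [← Cardinal.lift_le.{1}, Cardinal.lift_mul, ← ZFSet.cardinalMk_coe_sort,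
    ← ZFSet.cardinalMk_coe_sort]
  have e : ((⋃₀ img F a : ZFSet.{0}) : Set ZFSet.{0}) = ⋃ x : a, (F x : Set ZFSet.{0}) := by
    ext z
    simp [mem_img]
  have := Cardinal.mk_iUnion_le (fun x : a => (F x : Set ZFSet.{0}))
  rw [← e] at this
  refine this.trans (mul_le_mul_right (ciSup_le' fun x => ?_) _)
  have := h x x.2
  rw [← Cardinal.lift_le.{1}, ← ZFSet.cardinalMk_coe_sort] at this
  exact this

theorem card_eq_card_rank {x : ZFSet.{0}} (hx : x.IsOrdinal) : x.card = x.rank.card := by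
  conv_lhs => rw [← hx.toZFSet_rank_eq]
  exact Ordinal.card_toZFSet _

theorem IsCard.cardLT_iff {κ t : ZFSet.{0}} (hκ : IsCard κ) : CardLT t κ ↔ t.card < κ.card := by
  have ho := isOrd_iff.1 hκ.1
  constructor
  · rintro ⟨α, hα, h⟩
    refine (cardLE_iff.1 h).trans_lt (lt_of_le_of_ne (ZFSet.card_mono (ho.subset_of_mem hα)) ?_)
    exact fun e => hκ.2 α hα (eqNum_iff.2 e)
  · intro h
    refine ⟨t.card.ord.toZFSet, ?_, cardLE_iff.2 (by simp)⟩
    rw [← ho.toZFSet_rank_eq, Ordinal.toZFSet_mem_toZFSet_iff]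
    by_contra hc
    have := Ordinal.card_le_card (not_lt.1 hc)
    rw [Cardinal.card_ord, ← card_eq_card_rank ho] at this
    exact this.not_gt h

theorem IsCard.card_lt {κ α : ZFSet.{0}} (hκ : IsCard κ) (h : α ∈ κ) : α.card < κ.card :=
  hκ.cardLT_iff.1 ⟨α, h, cardLE_iff.2 le_rfl⟩

theorem IsRegular.bound {κ a : ZFSet.{0}} (hκ : IsRegular κ) (ha : a.card < κ.card)
    {r : ZFSet.{0} → ZFSet.{0}} (hr : ∀ x ∈ a, r x ∈ κ) : ∃ β ∈ κ, ∀ x ∈ a, r x ∈ β := by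
  by_contra hc
  push Not at hc
  have ho := isOrd_iff.1 hκ.1.1
  have := hκ.2 (img r a) (fun y hy => by
    obtain ⟨x, hx, rfl⟩ := mem_img.1 hy
    exact hr x hx) fun β hβ => by
      obtain ⟨x, hx, h⟩ := hc β hβ
      refine ⟨_, mem_img.2 ⟨x, hx, rfl⟩, ?_⟩
      rcases (ho.mem hβ).mem_trichotomous (ho.mem (hr x hx)) with h' | h' | h'
      · exact .inl h'
      · exact .inr h'
      · exact absurd h' h
  exact ((eqNum_iff.1 this).symm.le.trans (card_img_le r a)).not_gt ha

theorem aleph0_le_card_omega : Cardinal.aleph0 ≤ ZFSet.omega.{0}.card := by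
  rw [← Cardinal.lift_le.{1}, ← ZFSet.cardinalMk_coe_sort, Cardinal.lift_aleph0,
    Cardinal.aleph0_le_mk_iff]
  exact Infinite.of_injective (fun n => (⟨natZ n, nat_mem_omega n⟩ : ZFSet.omega.{0}))
    fun m n h => natZ_injective (congrArg Subtype.val h)

section Hset

variable {κ : ZFSet.{0}} (hκ : IsRegular κ) (hω : ZFSet.omega ∈ κ)

include hκ in
theorem mem_Hset {x : ZFSet.{0}} : x ∈ Hset κ ↔
    ∃ t : ZFSet.{0}, t.IsTransitive ∧ x ∈ t ∧ t.card < κ.card :=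
  exists_congr fun _ => and_congr_right fun _ => and_congr_right fun _ => hκ.1.cardLT_iff

theorem Hset_trans : TransCl (Hset κ) := fun _ ⟨t, ht, hx, hc⟩ _ hy =>
  ⟨t, ht, ht _ hx hy, hc⟩

include hκ in
theorem card_lt_of_mem_Hset {x : ZFSet.{0}} (hx : x ∈ Hset κ) : x.card < κ.card := by
  obtain ⟨t, ht, hx, hc⟩ := (mem_Hset hκ).1 hx
  exact (ZFSet.card_mono (ht x hx)).trans_lt hc

include hκ hω

theorem aleph0_le_card : Cardinal.aleph0 ≤ κ.card :=
  aleph0_le_card_omega.trans (ZFSet.card_mono ((isOrd_iff.1 hκ.1.1).subset_of_mem hω))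

theorem card_insert_lt {x t : ZFSet.{0}} (ht : t.card < κ.card) : (insert x t).card < κ.card :=
  ZFSet.card_insert_le.trans_lt (Cardinal.add_lt_of_lt (aleph0_le_card hκ hω) ht
    (Cardinal.one_lt_aleph0.trans_le (aleph0_le_card hκ hω)))

theorem Hset_img {a : ZFSet.{0}} (ha : a.card < κ.card) {F : ZFSet.{0} → ZFSet.{0}}
    (hF : ∀ x ∈ a, F x ∈ Hset κ) : img F a ∈ Hset κ := by
  have h : ∀ x, ∃ t α : ZFSet.{0}, x ∈ a → t.IsTransitive ∧ F x ∈ t ∧ α ∈ κ ∧ CardLE t α := by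
    intro x
    by_cases hx : x ∈ a
    · obtain ⟨t, ht, hF, α, hα, hc⟩ := hF x hx
      exact ⟨t, α, fun _ => ⟨ht, hF, hα, hc⟩⟩
    · exact ⟨∅, ∅, fun h => absurd h hx⟩
  choose t α h using h
  obtain ⟨β, hβ, hb⟩ := hκ.bound ha (r := α) fun x hx => (h x hx).2.2.1
  have ho := isOrd_iff.1 hκ.1.1
  refine (mem_Hset hκ).2 ⟨insert (img F a) (⋃₀ img t a), ?_, by simp, ?_⟩
  · intro y hy z hz
    refine ZFSet.mem_insert_iff.2 (.inr (ZFSet.mem_sUnion.2 ?_))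
    rcases ZFSet.mem_insert_iff.1 hy with rfl | hy
    · obtain ⟨x, hx, rfl⟩ := mem_img.1 hz
      exact ⟨_, mem_img.2 ⟨x, hx, rfl⟩, (h x hx).2.1⟩
    · obtain ⟨_, hw, hy⟩ := ZFSet.mem_sUnion.1 hy
      obtain ⟨x, hx, rfl⟩ := mem_img.1 hw
      exact ⟨_, hw, (h x hx).1 y hy hz⟩
  · refine card_insert_lt hκ hω ((card_sUnion_img_le (c := β.card) fun x hx => ?_).trans_lt ?_)
    · exact (cardLE_iff.1 (h x hx).2.2.2).trans
        (ZFSet.card_mono ((ho.mem hβ).subset_of_mem (hb x hx)))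
    · exact Cardinal.mul_lt_of_lt (aleph0_le_card hκ hω) ha (hκ.1.card_lt hβ)

theorem Hset_of_subset {a : ZFSet.{0}} (ha : a.card < κ.card) (h : ∀ x ∈ a, x ∈ Hset κ) :
    a ∈ Hset κ := by
  convert Hset_img hκ hω ha (F := fun x => x) h
  ext x
  simp [mem_img]

theorem Hset_subset {a b : ZFSet.{0}} (hb : b ∈ Hset κ) (h : a ⊆ b) : a ∈ Hset κ :=
  Hset_of_subset hκ hω ((ZFSet.card_mono h).trans_lt (card_lt_of_mem_Hset hκ hb))
    fun x hx => Hset_trans b hb x (h hx)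

theorem Hset_of_mem {α : ZFSet.{0}} (hα : α ∈ κ) : α ∈ Hset κ := by
  have ho := (isOrd_iff.1 hκ.1.1).mem hα
  exact (mem_Hset hκ).2 ⟨insert α α, (ZFSet.isOrdinal_succ ho).isTransitive, by simp,
    card_insert_lt hκ hω (hκ.1.card_lt hα)⟩

omit hω in
theorem mem_of_mem_Hset {α : ZFSet.{0}} (ho : α.IsOrdinal) (hα : α ∈ Hset κ) : α ∈ κ := by
  rcases ho.mem_or_subset (isOrd_iff.1 hκ.1.1) with h | h
  · exact h
  · exact absurd (card_lt_of_mem_Hset hκ hα) (ZFSet.card_mono h).not_gt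

theorem Hset_zf : ZF (Hset κ) := by
  have hemp : ∅ ∈ Hset κ := Hset_subset hκ hω (Hset_of_mem hκ hω hω) (ZFSet.empty_subset _)
  refine ⟨Hset_trans, ⟨_, Hset_of_mem hκ hω hω, ZFSet.omega_zero, fun n => ZFSet.omega_succ⟩,
    ?_, ?_, ?_, ?_⟩
  · intro x hx y hy
    refine Hset_of_subset hκ hω (card_insert_lt hκ hω ?_) ?_
    · rw [ZFSet.card_singleton]
      exact Cardinal.one_lt_aleph0.trans_le (aleph0_le_card hκ hω)
    · intro z hz
      rcases ZFSet.mem_pair.1 hz with rfl | rfl <;> assumption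
  · intro x hx
    obtain ⟨t, ht, hx, hc⟩ := hx
    refine Hset_subset hκ hω (b := t) (Hset_of_subset hκ hω (hκ.1.cardLT_iff.1 hc)
      fun y hy => ⟨t, ht, hy, hc⟩) fun y hy => ?_
    obtain ⟨z, hz, hy⟩ := ZFSet.mem_sUnion.1 hy
    exact ht _ (ht _ hx hz) hy
  · intro n φ v _ a ha
    exact Hset_subset hκ hω ha fun z hz => (ZFSet.mem_sep.1 hz).1
  · intro n φ v _ a ha h
    have h' : ∀ x, ∃ y, x ∈ a → y ∈ Hset κ ∧ Sat (Hset κ) φ (Fin.cons y (Fin.cons x v)) := by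
      intro x
      by_cases hx : x ∈ a
      · obtain ⟨y, hy⟩ := h x hx
        exact ⟨y, fun _ => hy⟩
      · exact ⟨∅, fun h => absurd h hx⟩
    choose F hF using h'
    exact ⟨_, Hset_img hκ hω (card_lt_of_mem_Hset hκ ha) fun x hx => (hF x hx).1,
      fun x hx => ⟨_, mem_img.2 ⟨x, hx, rfl⟩, hF x hx⟩⟩

theorem Lstage_mem_Hset {α : ZFSet.{0}} (hα : α ∈ κ) : Lstage α ∈ Hset κ :=
  (inferInstance : Tm ZF fun v : Fin 1 → ZFSet.{0} => Lstage (v 0)).mem _ (Hset_zf hκ hω)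
    (fun _ => α) fun _ => Hset_of_mem hκ hω hα

theorem ordIdx_regular : OrdIdx κ.toSet where
  ord _ h := (isOrd_iff.1 hκ.1.1).mem h
  down _ h _ hβ := (isOrd_iff.1 hκ.1.1).mem_trans hβ h
  succ _ h := mem_of_mem_Hset hκ (ZFSet.isOrdinal_succ ((isOrd_iff.1 hκ.1.1).mem h))
    ((Hset_zf hκ hω).insert (Hset_of_mem hκ hω h) (Hset_of_mem hκ hω h))
  omega := hω
  reg _ := fun ⟨_, hα, ha⟩ _ hr => hκ.bound (card_lt_of_mem_Hset hκ
    (Hset_trans _ (Lstage_mem_Hset hκ hω hα) _ ha)) hr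

omit hω in
theorem LCard_regular : LCard κ := by
  refine ⟨hκ.1.1, fun α hα f _ hf => ?_⟩
  have h : CardLE κ α := by
    choose g hg using fun y : κ.toSet => hf.2 y y.2
    refine ⟨⟨fun y => ⟨g y, (hg y).1⟩, fun y z e => ?_⟩⟩
    have e' : g y = g z := congrArg Subtype.val e
    obtain ⟨w, -, hw⟩ := hf.1.2 _ (hg y).1
    exact Subtype.ext ((hw _ (hg y).2).trans (hw _ (e' ▸ (hg z).2)).symm)
  exact (cardLE_iff.1 h).not_gt (hκ.1.card_lt hα)

end Hset

/-- There are arbitrarily large regular cardinals. -/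
theorem exists_regular (α : ZFSet.{0}) (hα : α.IsOrdinal) :
    ∃ κ, IsRegular κ ∧ ZFSet.omega ∈ κ ∧ α ∈ κ := by
  set c : Cardinal.{0} := Order.succ (max Cardinal.aleph0 α.rank.card) with hc
  have hreg : c.IsRegular := Cardinal.isRegular_succ (le_max_left _ _)
  have hmem : ∀ {x : ZFSet.{0}}, x.IsOrdinal → (x ∈ c.ord.toZFSet ↔ x.card < c) := fun {x} hx => by
    rw [← hx.toZFSet_rank_eq, Ordinal.toZFSet_mem_toZFSet_iff, Cardinal.lt_ord,
      Ordinal.card_toZFSet]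
  have ho := ZFSet.isOrdinal_toZFSet c.ord
  have hcc : c.ord.toZFSet.card = c := by simp
  refine ⟨c.ord.toZFSet, ⟨⟨isOrd_iff.2 ho, ?_⟩, ?_⟩, ?_, ?_⟩
  · intro β hβ e
    have := (hmem (ho.mem hβ)).1 hβ
    rw [eqNum_iff.1 e, hcc] at this
    exact this.false
  · intro x hx hunb
    rw [eqNum_iff, hcc]
    refine le_antisymm ((ZFSet.card_mono hx).trans hcc.le) ?_
    by_contra hlt
    rw [not_le] at hlt
    set d := max Cardinal.aleph0 α.rank.card with hd
    have hd0 : Cardinal.aleph0 ≤ d := le_max_left _ _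
    have hsub : c.ord.toZFSet ⊆ ⋃₀ img (fun y => insert y y) x := fun β hβ => by
      obtain ⟨y, hy, h⟩ := hunb β hβ
      refine ZFSet.mem_sUnion.2 ⟨_, mem_img.2 ⟨y, hy, rfl⟩, ?_⟩
      rw [ZFSet.mem_insert_iff]
      exact h.symm
    have h1 : ∀ y ∈ x, (insert y y : ZFSet).card ≤ d := fun y hy =>
      ZFSet.card_insert_le.trans <| Cardinal.add_le_of_le hd0
        (Order.lt_succ_iff.1 ((hmem (ho.mem (hx hy))).1 (hx hy)))
        (Cardinal.one_le_aleph0.trans hd0)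
    have h2 := (ZFSet.card_mono hsub).trans (card_sUnion_img_le h1)
    rw [hcc] at h2
    have h3 : x.card * d ≤ d :=
      (mul_le_mul_left (Order.lt_succ_iff.1 hlt) _).trans (Cardinal.mul_eq_self hd0).le
    exact (h2.trans h3).not_gt (Order.lt_succ d)
  · refine (hmem isOrdinal_omega).2 (Order.lt_succ_of_le (le_trans ?_ (le_max_left _ _)))
    rw [← Cardinal.lift_le.{1}, ← ZFSet.cardinalMk_coe_sort, Cardinal.lift_aleph0]
    refine (Cardinal.mk_le_of_surjective
      (f := fun n : ULift.{1} ℕ => (⟨natZ n.down, nat_mem_omega _⟩ : ZFSet.omega.{0})) ?_).trans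
      (by simp)
    rintro ⟨z, hz⟩
    obtain ⟨n, rfl⟩ := mem_omega.1 hz
    exact ⟨⟨n⟩, rfl⟩
  · refine (hmem hα).2 ?_
    rw [card_eq_card_rank hα, hc]
    exact Order.lt_succ_of_le (le_max_right _ _)

/-! ### Sizes of sets inside a class -/

/-- In `W` there is a function on `δ` whose values cover `y`. -/
def Sz (W : Set ZFSet.{0}) (δ y : ZFSet.{0}) : Prop := ∃ g ∈ W, ∀ b ∈ y, ∃ a ∈ δ, app g a = b

section Sz

variable {W : Set ZFSet.{0}} (hW : ZF W) {δ p x y z : ZFSet.{0}}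

theorem Sz.mono (h : Sz W δ y) (hz : z ⊆ y) : Sz W δ z := by
  obtain ⟨g, hg, h⟩ := h
  exact ⟨g, hg, fun b hb => h b (hz hb)⟩

include hW

theorem Sz.map {F : ZFSet.{0} → ZFSet.{0} → ZFSet.{0}}
    (hF : Tm ZF fun w : Fin 2 → ZFSet.{0} => F (w 0) (w 1)) (hδ : δ ∈ W) (hp : p ∈ W)
    (hy : Sz W δ y) (h : ∀ b ∈ z, ∃ a ∈ y, F p a = b) : Sz W δ z := by
  obtain ⟨g, hg, hgy⟩ := hy
  have hI : ∀ {n} {a b : (Fin n → ZFSet.{0}) → ZFSet.{0}} [Tm ZF a] [Tm ZF b],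
      Tm ZF fun v => F (a v) (b v) := fun {_ _ _} _ _ => hF.comp2
  refine ⟨gr (fun a => F p (app g a)) δ, (inferInstance : Tm ZF fun v : Fin 3 → ZFSet.{0} =>
    gr (fun a => F (v 0) (app (v 1) a)) (v 2)).mem W hW ![p, g, δ] ?_, fun b hb => ?_⟩
  · simp [Fin.forall_fin_succ, hp, hg, hδ]
  · obtain ⟨c, hc, rfl⟩ := h b hb
    obtain ⟨a, ha, rfl⟩ := hgy c hc
    exact ⟨a, ha, app_gr ha⟩

theorem Sz.refl (hδ : δ ∈ W) : Sz W δ δ := by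
  refine ⟨gr (fun a => a) δ, (inferInstance : Tm ZF fun v : Fin 1 → ZFSet.{0} =>
    gr (fun a => a) (v 0)).mem W hW ![δ] ?_, fun b hb => ⟨b, hb, app_gr hb⟩⟩
  simp [hδ]

theorem Sz.prod (hδ : δ ∈ W) (h : Sz W δ (zprod δ δ)) (hx : Sz W δ x) (hy : Sz W δ y) :
    Sz W δ (zprod x y) := by
  obtain ⟨g, hg, hx⟩ := hx
  obtain ⟨k, hk, hy⟩ := hy
  refine Sz.map hW (F := fun p a => pair (app (zfst p) (zfst a)) (app (zsnd p) (zsnd a)))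
    inferInstance hδ (p := pair g k) (hW.pair_mem hg hk) h fun b hb => ?_
  obtain ⟨u, hu, v, hv, rfl⟩ := mem_zprod.1 hb
  obtain ⟨a, ha, rfl⟩ := hx u hu
  obtain ⟨c, hc, rfl⟩ := hy v hv
  exact ⟨pair a c, pair_mem_zprod.2 ⟨ha, hc⟩, by simp⟩

theorem Sz.insert (hδ : δ ∈ W) (hω : ZFSet.omega ⊆ δ) (h : Sz W δ (zprod δ δ))
    (hx : Sz W δ x) (hy : y ∈ W) : Sz W δ (insert y x : ZFSet.{0}) := by
  obtain ⟨g, hg, hx⟩ := hx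
  refine Sz.map hW (F := fun p a => if zfst a = ∅ then app (zfst p) (zsnd a) else zsnd p)
    inferInstance hδ (hW.pair_mem hg hy) h fun b hb => ?_
  have h0 : ∅ ∈ δ := hω (nat_mem_omega 0)
  rcases ZFSet.mem_insert_iff.1 hb with rfl | hb
  · refine ⟨pair (natZ 1) ∅, pair_mem_zprod.2 ⟨hω (nat_mem_omega 1), h0⟩, ?_⟩
    simp [natZ_succ_ne]
  · obtain ⟨a, ha, rfl⟩ := hx b hb
    exact ⟨pair ∅ a, pair_mem_zprod.2 ⟨h0, ha⟩, by simp⟩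

theorem Sz.exists_surj (hδ : δ ∈ W) (hy : y ∈ W) (h : Sz W δ y) (h0 : ∃ a, a ∈ y) :
    ∃ f ∈ W, IsSurjF δ y f := by
  obtain ⟨g, hg, h⟩ := h
  obtain ⟨d, hd⟩ := h0
  refine ⟨gr (fun a => if app g a ∈ y then app g a else d) δ,
    (inferInstance : Tm ZF fun v : Fin 4 → ZFSet.{0} =>
      gr (fun a => if app (v 0) a ∈ v 1 then app (v 0) a else v 2) (v 3)).mem W hW ![g, y, d, δ] ?_,
    ⟨?_, ?_⟩, ?_⟩
  · simp [Fin.forall_fin_succ, hg, hy, hδ, hW.trans _ hy _ hd]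
  · intro q hq
    obtain ⟨a, ha, rfl⟩ := mem_img.1 hq
    refine ZFSet.pair_mem_prod.2 ⟨ha, ?_⟩
    dsimp only
    split_ifs with hh
    exacts [hh, hd]
  · intro a ha
    exact ⟨_, pair_mem_gr.2 ⟨ha, rfl⟩, fun b hb => (pair_mem_gr.1 hb).2.symm⟩
  · intro b hb
    obtain ⟨a, ha, rfl⟩ := h b hb
    exact ⟨a, ha, pair_mem_gr.2 ⟨ha, by simp [hb]⟩⟩

end Sz

/-! ### Least elements -/

/-- The least element of a set of ordinals. -/
def minO (X : ZFSet.{0}) : ZFSet.{0} := ZFSet.sep (fun z => ∀ y ∈ X, z ∈ y) (⋃₀ X)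

theorem minO_spec {X : ZFSet.{0}} (hX : ∀ y ∈ X, y.IsOrdinal) (h : ∃ y, y ∈ X) :
    minO X ∈ X ∧ ∀ y ∈ X, minO X ⊆ y := by
  obtain ⟨y, hy, hm⟩ := ZFSet.mem_wf.has_min X.toSet h
  have hsub : ∀ z ∈ X, y ⊆ z := fun z hz =>
    ((hX z hz).mem_or_subset (hX y hy)).resolve_left (hm z hz)
  have e : minO X = y := by
    ext z
    rw [minO, ZFSet.mem_sep, ZFSet.mem_sUnion]
    exact ⟨fun h => h.2 y hy, fun h => ⟨⟨y, hy, h⟩, fun w hw => hsub w hw h⟩⟩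
  rw [e]
  exact ⟨hy, hsub⟩

instance {n : ℕ} {f : (Fin n → ZFSet.{0}) → ZFSet.{0}} [Tm ZF f] : Tm ZF fun v => minO (f v) :=
  Tm.comp1 (F := minO) <| by unfold minO; infer_instance

/-- The maximum of the components of a pair of ordinals. -/
def maxP (q : ZFSet.{0}) : ZFSet.{0} := zfst q ∪ zsnd q

instance {n : ℕ} {f : (Fin n → ZFSet.{0}) → ZFSet.{0}} [Tm ZF f] : Tm ZF fun v => maxP (f v) :=
  Tm.comp1 (F := maxP) <| by unfold maxP; infer_instance

/-- The pairs in `s` minimising `r`. -/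
def argmin (r : ZFSet.{0} → ZFSet.{0}) (s : ZFSet.{0}) : ZFSet.{0} :=
  ZFSet.sep (fun q => r q = minO (img r s)) s

theorem argmin_spec {r : ZFSet.{0} → ZFSet.{0}} {s : ZFSet.{0}} (hr : ∀ q ∈ s, (r q).IsOrdinal)
    (h : ∃ q, q ∈ s) : (∃ q, q ∈ argmin r s) ∧ ∀ q ∈ argmin r s, q ∈ s ∧ ∀ q' ∈ s, r q ⊆ r q' := by
  obtain ⟨q, hq⟩ := h
  obtain ⟨h1, h2⟩ := minO_spec (X := img r s) (fun y hy => by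
    obtain ⟨q, hq, rfl⟩ := mem_img.1 hy
    exact hr q hq) ⟨_, mem_img.2 ⟨q, hq, rfl⟩⟩
  refine ⟨?_, fun q hq => ?_⟩
  · obtain ⟨q, hq, e⟩ := mem_img.1 h1
    exact ⟨q, ZFSet.mem_sep.2 ⟨hq, e⟩⟩
  · obtain ⟨hq, e⟩ := ZFSet.mem_sep.1 hq
    exact ⟨hq, fun q' hq' => e ▸ h2 _ (mem_img.2 ⟨q', hq', rfl⟩)⟩

/-- The least pair of a set of pairs of ordinals, comparing maxima first. -/
def leastP (s : ZFSet.{0}) : ZFSet.{0} := ⋃₀ argmin zsnd (argmin zfst (argmin maxP s))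

instance {n : ℕ} {f : (Fin n → ZFSet.{0}) → ZFSet.{0}} [Tm ZF f] : Tm ZF fun v => leastP (f v) :=
  Tm.comp1 (F := leastP) <| by unfold leastP argmin; infer_instance

theorem maxP_pair {a b : ZFSet.{0}} (ha : a.IsOrdinal) (hb : b.IsOrdinal) :
    a ∪ b = a ∨ a ∪ b = b := by
  rcases ha.mem_or_subset hb with h | h
  · right
    ext z
    simpa using fun hz => hb.isTransitive a h hz
  · left
    ext z
    simpa using fun hz => h hz

theorem leastP_spec {s : ZFSet.{0}}
    (hs : ∀ q ∈ s, ∃ a b : ZFSet.{0}, a.IsOrdinal ∧ b.IsOrdinal ∧ pair a b = q) (h : ∃ q, q ∈ s) :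
    leastP s ∈ s ∧ ∀ q ∈ s, maxP (leastP s) ⊆ maxP q := by
  obtain ⟨h1, h1'⟩ := argmin_spec (r := maxP) (s := s) (fun q hq => by
    obtain ⟨a, b, ha, hb, rfl⟩ := hs q hq
    rw [maxP, zfst_pair, zsnd_pair]
    rcases maxP_pair ha hb with e | e <;> rw [e] <;> assumption) h
  obtain ⟨h2, h2'⟩ := argmin_spec (r := zfst) (fun q hq => by
    obtain ⟨a, b, ha, hb, rfl⟩ := hs q (h1' q hq).1
    simpa using ha) h1
  obtain ⟨h3, h3'⟩ := argmin_spec (r := zsnd) (fun q hq => by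
    obtain ⟨a, b, ha, hb, rfl⟩ := hs q (h1' q (h2' q hq).1).1
    simpa using hb) h2
  obtain ⟨q, hq⟩ := h3
  have hu : leastP s = q := by
    have : argmin zsnd (argmin zfst (argmin maxP s)) = {q} := by
      ext q'
      rw [ZFSet.mem_singleton]
      refine ⟨fun hq' => ?_, fun h => h ▸ hq⟩
      have e1 := (ZFSet.mem_sep.1 hq).2.trans (ZFSet.mem_sep.1 hq').2.symm
      have e2 := (ZFSet.mem_sep.1 (h3' q hq).1).2.trans
        (ZFSet.mem_sep.1 (h3' q' hq').1).2.symm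
      obtain ⟨a, b, -, -, rfl⟩ := hs q (h1' q (h2' q (h3' q hq).1).1).1
      obtain ⟨a', b', -, -, rfl⟩ := hs q' (h1' q' (h2' q' (h3' q' hq').1).1).1
      simp only [zfst_pair, zsnd_pair] at e1 e2
      rw [e1, e2]
    rw [leastP, this, ZFSet.sUnion_singleton]
  rw [hu]
  exact h1' q (h2' q (h3' q hq).1).1

/-! ### Hessenberg's theorem inside a class -/

theorem mem_omega_or {x : ZFSet.{0}} (hx : x.IsOrdinal) : x ∈ ZFSet.omega ∨ ZFSet.omega ⊆ x :=
  hx.mem_or_subset isOrdinal_omega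

theorem finite_of_mem_omega {x : ZFSet.{0}} (hx : x ∈ ZFSet.omega) : x.toSet.Finite := by
  obtain ⟨n, rfl⟩ := mem_omega.1 hx
  clear hx
  induction n with
  | zero => exact Set.finite_empty.subset fun z hz => absurd hz (ZFSet.notMem_empty z)
  | succ n ih => exact (ih.insert (natZ n)).subset fun z hz => ZFSet.mem_insert_iff.1 hz

theorem infinite_of_omega_subset {x : ZFSet.{0}} (hx : ZFSet.omega ⊆ x) : x.toSet.Infinite :=
  Set.infinite_of_injective_forall_mem (f := natZ) (fun _ _ h => natZ_injective h)
    fun n => hx (nat_mem_omega n)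

/-- The enumeration of `P` in the order of `leastP`. -/
def enumP : ZFSet.{0} → ZFSet.{0} → ZFSet.{0} := recF fun P _ g => leastP (P \ img zsnd g)

theorem enumP_eq (P ξ : ZFSet.{0}) : enumP P ξ = leastP (P \ img (enumP P) ξ) := by
  rw [enumP, recF_eq]
  congr 2
  ext z
  simp [mem_img, gr]

instance {n : ℕ} {f g : (Fin n → ZFSet.{0}) → ZFSet.{0}} [Tm ZF f] [Tm ZF g] :
    Tm ZF fun v => enumP (f v) (g v) :=
  Tm.comp2 (F := enumP) (Tm.recF inferInstance)

theorem hessenberg {W : Set ZFSet.{0}} (hW : ZF W) {δ : ZFSet.{0}} :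
    δ.IsOrdinal → ZFSet.omega ⊆ δ → δ ∈ W → Sz W δ (zprod δ δ) := by
  induction δ using ZFSet.inductionOn with
  | _ δ ih =>
  intro ho hω hδ
  by_cases hc : CardIn W δ
  swap
  · simp only [CardIn, isOrd_iff, ho, true_and, not_forall, not_not] at hc
    obtain ⟨α, hα, f, hf, hs⟩ := hc
    have hs' : Sz W α δ := ⟨f, hf, fun b hb => by
      obtain ⟨a, ha, h⟩ := hs.2 b hb
      obtain ⟨c, -, hu⟩ := hs.1.2 a ha
      exact ⟨a, ha, app_eq h fun d hd => (hu d hd).trans (hu b h).symm⟩⟩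
    have hαW := hW.trans _ hδ _ hα
    rcases mem_omega_or (ho.mem hα) with hfin | hinf
    · obtain ⟨f, -, hf⟩ := hs'
      refine absurd (((finite_of_mem_omega hfin).image (app f)).subset fun b hb => ?_)
        (infinite_of_omega_subset hω)
      exact hf b hb
    · have := Sz.prod hW hαW (ih α hα (ho.mem hα) hinf hαW) hs' hs'
      obtain ⟨g, hg, h⟩ := this
      exact ⟨g, hg, fun b hb => by
        obtain ⟨a, ha, h⟩ := h b hb
        exact ⟨a, ho.subset_of_mem hα ha, h⟩⟩
  · by_cases hall : ∀ q ∈ zprod δ δ, ∃ ξ ∈ δ, enumP (zprod δ δ) ξ = q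
    · exact Sz.map hW (F := enumP) inferInstance hδ
        ((inferInstance : Tm ZF fun v : Fin 1 → ZFSet.{0} => zprod (v 0) (v 0)).mem W hW ![δ]
          (by simp [hδ])) (Sz.refl hW hδ) hall
    exfalso
    push Not at hall
    obtain ⟨q, hq, hmiss⟩ := hall
    have hstep : ∀ ξ ∈ δ, enumP (zprod δ δ) ξ ∈ zprod δ δ \ img (enumP (zprod δ δ)) ξ ∧
        maxP (enumP (zprod δ δ) ξ) ⊆ maxP q := by
      intro ξ hξ
      have hq' : q ∈ zprod δ δ \ img (enumP (zprod δ δ)) ξ := by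
        rw [ZFSet.mem_sdiff, mem_img]
        refine ⟨hq, fun ⟨η, hη, e⟩ => hmiss η (ho.mem_trans hη hξ) e⟩
      have := leastP_spec (s := zprod δ δ \ img (enumP (zprod δ δ)) ξ) (fun q hq => by
        obtain ⟨a, ha, b, hb, rfl⟩ := mem_zprod.1 (ZFSet.mem_sdiff.1 hq).1
        exact ⟨a, b, ho.mem ha, ho.mem hb, rfl⟩) ⟨q, hq'⟩
      rw [← enumP_eq] at this
      exact ⟨this.1, this.2 q hq'⟩
    have hinj : ∀ ξ ∈ δ, ∀ η ∈ δ, enumP (zprod δ δ) ξ = enumP (zprod δ δ) η → ξ = η := by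
      intro ξ hξ η hη e
      rcases (ho.mem hξ).mem_trichotomous (ho.mem hη) with h | h | h
      · exact absurd (mem_img.2 ⟨ξ, h, e⟩) (ZFSet.mem_sdiff.1 (hstep η hη).1).2
      · exact h
      · exact absurd (mem_img.2 ⟨η, h, e.symm⟩) (ZFSet.mem_sdiff.1 (hstep ξ hξ).1).2
    have hm : maxP q ∈ δ := by
      obtain ⟨a, ha, b, hb, rfl⟩ := mem_zprod.1 hq
      rw [maxP, zfst_pair, zsnd_pair]
      rcases maxP_pair (ho.mem ha) (ho.mem hb) with e | e <;> rw [e] <;> assumption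
    have hmW := hW.trans _ hδ _ hm
    set m := maxP q
    have hmo := ho.mem hm
    have hν : ∀ ξ ∈ δ, enumP (zprod δ δ) ξ ∈ zprod (insert m m) (insert m m) := by
      intro ξ hξ
      obtain ⟨h1, h2⟩ := hstep ξ hξ
      obtain ⟨a, ha, b, hb, e⟩ := mem_zprod.1 (ZFSet.mem_sdiff.1 h1).1
      have key : ∀ x : ZFSet.{0}, x ∈ δ → x ⊆ m → x ∈ (insert m m : ZFSet) := fun x hx hs => by
        rw [ZFSet.mem_insert_iff]
        rcases (ho.mem hx).mem_trichotomous hmo with h | h | h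
        · exact .inr h
        · exact .inl h
        · exact absurd (hs h) (ZFSet.mem_irrefl m)
      rw [← e, maxP, zfst_pair, zsnd_pair] at h2
      rw [← e, pair_mem_zprod]
      exact ⟨key a ha fun z hz => h2 (ZFSet.mem_union.2 (.inl hz)),
        key b hb fun z hz => h2 (ZFSet.mem_union.2 (.inr hz))⟩
    rcases mem_omega_or hmo with hfin | hinf
    · have hf : (zprod (insert m m) (insert m m)).toSet.Finite := by
        have h1 : (insert m m : ZFSet.{0}).toSet.Finite :=
          ((finite_of_mem_omega hfin).insert m).subset fun z hz => ZFSet.mem_insert_iff.1 hz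
        refine (Set.Finite.image2 pair h1 h1).subset fun z hz => ?_
        obtain ⟨a, ha, b, hb, rfl⟩ := mem_zprod.1 hz
        exact ⟨a, ha, b, hb, rfl⟩
      refine infinite_of_omega_subset hω (Set.Finite.of_finite_image (f := enumP (zprod δ δ))
        (hf.subset ?_) fun ξ hξ η hη => hinj ξ hξ η hη)
      rintro _ ⟨ξ, hξ, rfl⟩
      exact hν ξ hξ
    · have h1 := ih m hm hmo hinf hmW
      have h2 := Sz.insert hW hmW hinf h1 (Sz.refl hW hmW) hmW
      have h3 : Sz W m δ := by
        refine Sz.map hW (F := fun P a => ⋃₀ ZFSet.sep (fun ξ => enumP (zprod P P) ξ = a) P)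
          inferInstance hmW hδ (Sz.prod hW hmW h1 h2 h2) fun ξ hξ => ⟨_, hν ξ hξ, ?_⟩
        have : ZFSet.sep (fun η => enumP (zprod δ δ) η = enumP (zprod δ δ) ξ) δ = {ξ} := by
          ext η
          rw [ZFSet.mem_sep, ZFSet.mem_singleton]
          exact ⟨fun h => hinj _ h.1 _ hξ h.2, by rintro rfl; exact ⟨hξ, rfl⟩⟩
        rw [this, ZFSet.sUnion_singleton]
      obtain ⟨f, hf, hs⟩ := Sz.exists_surj hW hmW hδ h3 ⟨m, hm⟩
      exact hc.2 m hm f hf hs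

/-! ### The size of a closure -/

/-- One step of the enumeration of a closure; here `e = (p, (k, (d, δ)))`, where `k` enumerates the
index set and `d` enumerates `δ × δ`. -/
def enumStep (h : ZFSet.{0} → ZFSet.{0} → ZFSet.{0}) (e s : ZFSet.{0}) : ZFSet.{0} :=
  gr (fun ξ => if zfst (app (zfst (zsnd (zsnd e))) ξ) = ∅
    then app s (zsnd (app (zfst (zsnd (zsnd e))) ξ))
    else h (zfst e) (pair
      (app (zfst (zsnd e))
        (zfst (app (zfst (zsnd (zsnd e))) (zsnd (app (zfst (zsnd (zsnd e))) ξ)))))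
      (pair
        (app s (zfst (app (zfst (zsnd (zsnd e)))
          (zsnd (app (zfst (zsnd (zsnd e))) (zsnd (app (zfst (zsnd (zsnd e))) ξ)))))))
        (app s (zsnd (app (zfst (zsnd (zsnd e)))
          (zsnd (app (zfst (zsnd (zsnd e))) (zsnd (app (zfst (zsnd (zsnd e))) ξ))))))))))
    (zsnd (zsnd (zsnd e)))

theorem Tm.enumStep {h : ZFSet.{0} → ZFSet.{0} → ZFSet.{0}}
    (hh : Tm ZF fun w : Fin 2 → ZFSet.{0} => h (w 0) (w 1)) :
    Tm ZF fun w : Fin 2 → ZFSet.{0} => enumStep h (w 0) (w 1) := by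
  have hI : ∀ {n} {a b : (Fin n → ZFSet.{0}) → ZFSet.{0}} [Tm ZF a] [Tm ZF b],
      Tm ZF fun v => h (a v) (b v) := fun {_ _ _} _ _ => hh.comp2
  unfold SRPPaper.enumStep
  infer_instance

theorem Sz.Cl {W : Set ZFSet.{0}} (hW : ZF W) {h : ZFSet.{0} → ZFSet.{0} → ZFSet.{0}}
    (hh : Tm ZF fun w : Fin 2 → ZFSet.{0} => h (w 0) (w 1)) {δ p C a : ZFSet.{0}} (hδ : δ ∈ W)
    (hω : ZFSet.omega ⊆ δ) (hp : p ∈ W) (hH : Sz W δ (zprod δ δ)) (hC : Sz W δ C)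
    (ha : Sz W δ a) : Sz W δ (Cl h p C a) := by
  have hωδ : Sz W δ (zprod ZFSet.omega δ) :=
    Sz.prod hW hδ hH ((Sz.refl hW hδ).mono hω) (Sz.refl hW hδ)
  obtain ⟨d, hd, hdδ⟩ := hH
  obtain ⟨k, hk, hC⟩ := hC
  obtain ⟨s, hs, ha⟩ := ha
  have hd' : ∀ x ∈ δ, ∀ y ∈ δ, ∃ ξ ∈ δ, app d ξ = pair x y :=
    fun x hx y hy => hdδ _ (pair_mem_zprod.2 ⟨hx, hy⟩)
  set e := pair p (pair k (pair d δ)) with he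
  have heW : e ∈ W := hW.pair_mem hp (hW.pair_mem hk (hW.pair_mem hd hδ))
  set S : ℕ → ZFSet.{0} := fun n => iterF (enumStep h) (pair e s) (natZ n) with hS
  have hS0 : S 0 = s := by rw [hS]; simp only; rw [iterF_zero, zsnd_pair]
  have hS1 : ∀ n, S (n + 1) = enumStep h e (S n) := fun n => by
    rw [hS]; simp only; rw [iterF_succ, zfst_pair]
  have h0 : ∅ ∈ δ := hω (nat_mem_omega 0)
  have h1 : natZ 1 ∈ δ := hω (nat_mem_omega 1)
  have hmono1 : ∀ n b, (∃ ξ ∈ δ, app (S n) ξ = b) → ∃ ξ ∈ δ, app (S (n + 1)) ξ = b := by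
    rintro n _ ⟨η, hη, rfl⟩
    obtain ⟨ξ, hξ, e1⟩ := hd' ∅ h0 η hη
    refine ⟨ξ, hξ, ?_⟩
    rw [hS1, enumStep, app_gr (by simpa [he] using hξ)]
    simp [he, e1]
  have hmono : ∀ {m n}, m ≤ n → ∀ {b}, (∃ ξ ∈ δ, app (S m) ξ = b) → ∃ ξ ∈ δ, app (S n) ξ = b := by
    intro m n hmn
    induction hmn with
    | refl => exact id
    | step _ ih => exact fun hb => hmono1 _ _ (ih hb)
  have hall : ∀ b ∈ SRPPaper.Cl h p C a, ∃ n, ∃ ξ ∈ δ, app (S n) ξ = b := by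
    intro b hb
    refine Cl_induction (P := fun b => ∃ n, ∃ ξ ∈ δ, app (S n) ξ = b)
      (fun b hb => ⟨0, by rw [hS0]; exact ha b hb⟩) ?_ hb
    · rintro c hc A - B - ⟨m, hm⟩ ihB
      obtain ⟨n, hn⟩ := ihB
      obtain ⟨α, hα, e1⟩ := hmono (le_max_left m n) hm
      obtain ⟨β, hβ, e2⟩ := hmono (le_max_right m n) hn
      obtain ⟨γ, hγ, e3⟩ := hC c hc
      obtain ⟨ξ₁, hξ₁, e4⟩ := hd' α hα β hβ
      obtain ⟨ξ₂, hξ₂, e5⟩ := hd' γ hγ ξ₁ hξ₁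
      obtain ⟨ξ, hξ, e6⟩ := hd' _ h1 ξ₂ hξ₂
      refine ⟨max m n + 1, ξ, hξ, ?_⟩
      rw [hS1, enumStep, app_gr (by simpa [he] using hξ)]
      simp [he, e1, e2, e3, e4, e5, e6, natZ_succ_ne]
  have hI : ∀ {n} {a b : (Fin n → ZFSet.{0}) → ZFSet.{0}} [Tm ZF a] [Tm ZF b],
      Tm ZF fun v => iterF (enumStep h) (a v) (b v) :=
    fun {_ _ _} _ _ => (Tm.iterF (Tm.enumStep hh)).comp2
  refine Sz.map hW (F := fun q x => app (iterF (enumStep h) q (zfst x)) (zsnd x)) inferInstance hδ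
    (hW.pair_mem heW hs) hωδ fun b hb => ?_
  obtain ⟨n, ξ, hξ, rfl⟩ := hall b hb
  exact ⟨pair (natZ n) ξ, pair_mem_zprod.2 ⟨nat_mem_omega n, hξ⟩, by simp [hS]⟩

/-! ### Enumerating the stages of the constructible hierarchy -/

/-- An operation generating the constructible sets from the ordinals. -/
def genL (_ e : ZFSet.{0}) : ZFSet.{0} :=
  if zfst e = natZ 0 then zsnd e
  else if zfst e = natZ 1 then Lstage (zfst (zsnd e))
  else if zfst e = natZ 2 then hD (zfst (zsnd e)) (zsnd (zsnd e))
  else ZFSet.sep (fun z => pair z (zsnd (zfst (zsnd e))) ∈ zfst (zfst (zsnd e))) (zsnd (zsnd e))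

theorem Tm.genL : Tm ZF fun w : Fin 2 → ZFSet.{0} => genL (w 0) (w 1) := by
  have hI : ∀ {n} {a b : (Fin n → ZFSet.{0}) → ZFSet.{0}} [Tm ZF a] [Tm ZF b],
      Tm ZF fun v => SRPPaper.hD (a v) (b v) := fun {_ _ _} _ _ => Tm.hD.comp2
  unfold SRPPaper.genL
  infer_instance

theorem Lstage_subset_Cl {κ : ZFSet.{0}} (ho : κ.IsOrdinal) (hω : ZFSet.omega ⊆ κ) :
    Lstage κ ⊆ Cl genL ∅ κ κ := by
  have hn : ∀ n, natZ n ∈ κ := fun n => hω (nat_mem_omega n)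
  set R := Cl genL ∅ κ κ
  have hκR : ∀ {x}, x ∈ κ → x ∈ R := fun hx => subset_Cl hx
  have hpair : ∀ {x y}, x ∈ R → y ∈ R → pair x y ∈ R := fun {x y} hx hy => by
    have := Cl_step (h := genL) (hn 0) hx hy
    simpa [genL] using this
  have hL : ∀ {β}, β ∈ κ → Lstage β ∈ R := fun {β} hβ => by
    have := Cl_step (h := genL) (hn 1) (hκR hβ) (hκR hβ)
    simpa [genL, natZ_injective.eq_iff] using this
  have hhD : ∀ {x y}, x ∈ R → y ∈ R → hD x y ∈ R := fun {x y} hx hy => by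
    have := Cl_step (h := genL) (hn 2) hx hy
    simpa [genL, natZ_injective.eq_iff] using this
  have hsep : ∀ {A t x}, A ∈ R → t ∈ R → x ∈ R → ZFSet.sep (fun z => pair z t ∈ A) x ∈ R :=
    fun {A t x} hA ht hx => by
      have := Cl_step (h := genL) (hn 3) (hpair hA ht) hx
      simpa [genL, natZ_injective.eq_iff] using this
  suffices H : ∀ β ∈ κ, DefSetA ∅ (Lstage β) ⊆ R by
    intro x hx
    obtain ⟨β, hβ, hx⟩ := mem_Lstage.1 hx
    exact H β hβ hx
  intro β
  induction β using ZFSet.inductionOn with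
  | _ β ih =>
  intro hβ x hx
  have hsub : ∀ {y}, y ∈ Lstage β → y ∈ R := fun hy => by
    obtain ⟨γ, hγ, hy⟩ := mem_Lstage.1 hy
    exact ih γ hγ (ho.mem_trans hγ hβ) hy
  have hTup : ∀ {t}, t ∈ Tup (Lstage β) → t ∈ R := fun ht => by
    obtain ⟨n, v, hv, rfl⟩ := mem_Tup.1 ht
    clear ht
    induction n with
    | zero => exact hκR (hn 0)
    | succ n ih => exact hpair (hsub (hv 0)) (ih (Fin.tail v) fun i => hv i.succ)
  have hDD : ∀ {A}, A ∈ DD (Lstage β) → A ∈ R := fun hA => by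
    refine Cl_induction (P := fun A => A ∈ R) ?_ ?_ hA
    · intro A hA
      rw [ZFSet.mem_singleton.1 hA]
      have := hκR (hn 1)
      rwa [show natZ 1 = {∅} by ext z; simp [natZ]] at this
    · intro c hc A _ B _ hA hB
      exact hhD (hL hβ) (hpair (hκR (hω hc)) (hpair hA hB))
  rw [DefSetA_eq, ZFSet.mem_sUnion] at hx
  obtain ⟨_, hy, hx⟩ := hx
  obtain ⟨A, hA, rfl⟩ := mem_img.1 hy
  obtain ⟨t, ht, rfl⟩ := mem_img.1 hx
  exact hsep (hDD hA) (hTup ht) (hL hβ)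

theorem Sz.Lstage {W : Set ZFSet.{0}} (hW : ZF W) {κ : ZFSet.{0}} (ho : κ.IsOrdinal)
    (hω : ZFSet.omega ⊆ κ) (hκ : κ ∈ W) : Sz W κ (Lstage κ) :=
  (Sz.Cl hW Tm.genL hκ hω hW.empty (hessenberg hW ho hω hκ) (Sz.refl hW hκ)
    (Sz.refl hW hκ)).mono (Lstage_subset_Cl ho hω)

/-! ### Skolem hulls of small size -/

/-- Pairing, and the Skolem functions given by an enumeration; here `p` consists of the enumeration
and its domain. -/
def skolem (p q : ZFSet.{0}) : ZFSet.{0} :=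
  if zfst q = ∅ then zsnd q
  else app (zfst p) (minO (ZFSet.sep
    (fun ξ => pair (app (zfst p) ξ) (zfst (zsnd q)) ∈ zfst q) (zsnd p)))

theorem Tm.skolem : Tm ZF fun w : Fin 2 → ZFSet.{0} => skolem (w 0) (w 1) := by
  unfold SRPPaper.skolem
  infer_instance

theorem exists_hull {W : Set ZFSet.{0}} (hW : ZF W) {κ δ f : ZFSet.{0}} (ho : κ.IsOrdinal)
    (hωκ : ZFSet.omega ⊆ κ) (hκ : κ ∈ W) (hδ : δ.IsOrdinal) (hω : ZFSet.omega ⊆ δ) (hδκ : δ ∈ κ)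
    (hf : f ∈ Lstage κ) :
    ∃ Z ∈ W, ElemSub Z (Lstage κ).toSet ∧ δ ⊆ Z ∧ f ∈ Z ∧ Sz W δ Z := by
  obtain ⟨e, he, heK⟩ := Sz.Lstage hW ho hωκ hκ
  have hK : Lstage κ ∈ W := (inferInstance : Tm ZF fun v : Fin 1 → ZFSet.{0} => Lstage (v 0)).mem
    W hW ![κ] (by simp [hκ])
  have hδW := hW.trans _ hκ _ hδκ
  have hH := hessenberg hW hδ hω hδW
  set C := insert ∅ (DD (Lstage κ)) with hC
  set a := insert f δ with ha
  set p := pair e κ with hp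
  have hpW : p ∈ W := hW.pair_mem he hκ
  have hDD : Sz W δ (DD (Lstage κ)) :=
    Sz.Cl hW Tm.hD hδW hω hK hH ((Sz.refl hW hδW).mono hω) <| (Sz.refl hW hδW).mono fun x hx => by
      rw [ZFSet.mem_singleton.1 hx, show ({∅} : ZFSet.{0}) = natZ 1 by ext z; simp [natZ]]
      exact hω (nat_mem_omega 1)
  have hfW := hW.trans _ hK _ hf
  have hS : Sz W δ (Cl skolem p C a) := Sz.Cl hW Tm.skolem hδW hω hpW hH
    (Sz.insert hW hδW hω hH hDD hW.empty) (Sz.insert hW hδW hω hH (Sz.refl hW hδW) hfW)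
  have hI : ∀ {n} {a b c : (Fin n → ZFSet.{0}) → ZFSet.{0}} [Tm ZF a] [Tm ZF b] [Tm ZF c],
      Tm ZF fun v => Cl skolem (a v) (b v) (c v) := fun {_ _ _ _} _ _ _ => (Tm.Cl Tm.skolem).comp3
  have h0 : ∅ ∈ Cl skolem p C a :=
    subset_Cl (ZFSet.mem_insert_iff.2 (.inr (hω (nat_mem_omega 0))))
  have hpair : ∀ {x y}, x ∈ Cl skolem p C a → y ∈ Cl skolem p C a → pair x y ∈ Cl skolem p C a :=
    fun {x y} hx hy => by
      have := Cl_step (h := skolem) (p := p) (C := C) (c := ∅) (by simp [hC]) hx hy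
      simpa [skolem] using this
  have htup : ∀ {n} (v : Fin n → ZFSet.{0}), (∀ i, v i ∈ Cl skolem p C a) →
      tup v ∈ Cl skolem p C a := by
    intro n v hv
    induction n with
    | zero => exact h0
    | succ n ih => exact hpair (hv 0) (ih (Fin.tail v) fun i => hv i.succ)
  have hδK : δ ⊆ Lstage κ := fun x hx => mem_Lstage_of_mem ho (ho.mem_trans hx hδκ)
  refine ⟨ZFSet.sep (fun x => x ∈ Lstage κ) (Cl skolem p C a), ?_, ?_, fun x hx => ?_, ?_,
    hS.mono fun x hx => (ZFSet.mem_sep.1 hx).1⟩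
  · refine (inferInstance : Tm ZF fun v : Fin 5 → ZFSet.{0} => ZFSet.sep (fun x => x ∈ v 4)
      (Cl skolem (v 0) (insert ∅ (DD (v 1))) (insert (v 2) (v 3)))).mem W hW
      ![p, Lstage κ, f, δ, Lstage κ] ?_
    simp [Fin.forall_fin_succ, hpW, hK, hfW, hδW]
  · refine elemSub_of_exists (fun x hx => (ZFSet.mem_sep.1 hx).2) fun {n} φ v hv hex => ?_
    obtain ⟨z, hz, hφ⟩ := hex
    have hv' : ∀ i, v i ∈ Lstage κ := fun i => (ZFSet.mem_sep.1 (hv i)).2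
    set A := relS (Lstage κ) (Sat (Lstage κ).toSet φ) with hA
    have hmem : ∀ y, pair y (tup v) ∈ A ↔ y ∈ Lstage κ ∧ Sat (Lstage κ).toSet φ (Fin.cons y v) :=
      fun y => by rw [hA, pair_mem_relS, tup_mem_relS hv']
    have hzA := (hmem z).2 ⟨hz, hφ⟩
    have hA0 : A ≠ ∅ := fun h => ZFSet.notMem_empty _ (h ▸ hzA)
    have hst := Cl_step (h := skolem) (p := p) (C := C) (c := A)
      (ZFSet.mem_insert_iff.2 (.inr (relS_sat_mem_DD φ))) (htup v fun i => (ZFSet.mem_sep.1 (hv i)).1) h0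
    obtain ⟨ξ, hξ, rfl⟩ := heK z hz
    have hmin := (minO_spec (X := ZFSet.sep (fun ξ => pair (app e ξ) (tup v) ∈ A) κ)
      (fun y hy => ho.mem (ZFSet.mem_sep.1 hy).1) ⟨ξ, ZFSet.mem_sep.2 ⟨hξ, hzA⟩⟩).1
    simp only [skolem, zfst_pair, zsnd_pair, hA0, if_false, hp] at hst
    have := (hmem _).1 (ZFSet.mem_sep.1 hmin).2
    exact ⟨_, ZFSet.mem_sep.2 ⟨hst, this.1⟩, this.2⟩
  · exact ZFSet.mem_sep.2 ⟨subset_Cl (ZFSet.mem_insert_iff.2 (.inr hx)), hδK hx⟩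
  · exact ZFSet.mem_sep.2 ⟨subset_Cl (ZFSet.mem_insert_iff.2 (.inl rfl)), hf⟩

theorem collapse_of_subset {Z δ : ZFSet.{0}} (hδ : δ.IsTransitive) (h : δ ⊆ Z) {x : ZFSet.{0}}
    (hx : x ∈ δ) : collapse Z x = x := by
  induction x using ZFSet.inductionOn with
  | _ x ih =>
    ext y
    rw [mem_collapse]
    constructor
    · rintro ⟨z, hz, -, rfl⟩
      rwa [ih z hz (hδ x hx hz)]
    · exact fun hy => ⟨y, hy, h (hδ x hx hy), ih y hy (hδ x hx hy)⟩

/-! ### Condensation -/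

theorem Lstage_regular_eq {κ : ZFSet.{0}} (hκ : IsRegular κ) (hω : ZFSet.omega ∈ κ) :
    (Lstage κ).toSet = LW κ.toSet := by
  have hI := ordIdx_regular hκ hω
  ext x
  constructor
  · intro hx
    obtain ⟨β, hβ, hx⟩ := mem_Lstage.1 hx
    exact ⟨_, hI.succ β hβ, mem_Lstage.2 ⟨β, by simp, hx⟩⟩
  · rintro ⟨β, hβ, hx⟩
    exact Lstage_mono ((isOrd_iff.1 hκ.1.1).subset_of_mem hβ) hx

theorem Lstage_regular_zf {κ : ZFSet.{0}} (hκ : IsRegular κ) (hω : ZFSet.omega ∈ κ) :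
    ZF (Lstage κ).toSet := by
  rw [Lstage_regular_eq hκ hω]
  exact LW_zf (ordIdx_regular hκ hω)

theorem mem_LClass_of_ord {α : ZFSet.{0}} (hα : α.IsOrdinal) : α ∈ LClass :=
  ⟨insert α α, isOrd_iff.2 (ZFSet.isOrdinal_succ hα),
    mem_Lstage_of_mem (ZFSet.isOrdinal_succ hα) (by simp)⟩

/-- A constructible relation on an infinite `δ` appears before any larger cardinal of `L`. -/
theorem LCard.mem_Lstage {lam δ f : ZFSet.{0}} (hlam : LCard lam) (hδ : δ ∈ lam)
    (hω : ZFSet.omega ⊆ δ) (hf : f ∈ LClass) (hfδ : ∀ q ∈ f, ∃ a ∈ δ, ∃ b ∈ δ, pair a b = q) :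
    f ∈ Lstage lam := by
  have hlo := isOrd_iff.1 hlam.1
  have hδo := hlo.mem hδ
  obtain ⟨α, hα, hf⟩ := hf
  obtain ⟨κ, hκ, hωκ, hακ, hlκ⟩ : ∃ κ, IsRegular κ ∧ ZFSet.omega ∈ κ ∧ α ∈ κ ∧ lam ∈ κ := by
    have hα := isOrd_iff.1 hα
    have hu : (α ∪ lam).IsOrdinal := by
      rcases maxP_pair hα hlo with e | e <;> rw [e] <;> assumption
    obtain ⟨κ, hκ, hω, h⟩ := exists_regular _ hu
    have hκo := isOrd_iff.1 hκ.1.1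
    exact ⟨κ, hκ, hω,
      hα.mem_of_subset_of_mem hκo (fun z hz => ZFSet.mem_union.2 (.inl hz)) h,
      hlo.mem_of_subset_of_mem hκo (fun z hz => ZFSet.mem_union.2 (.inr hz)) h⟩
  have hκo := isOrd_iff.1 hκ.1.1
  have hK := Lstage_regular_zf hκ hωκ
  have hfK : f ∈ Lstage κ := Lstage_mono (hκo.subset_of_mem hακ) hf
  obtain ⟨Z, hZL, hZ, hδZ, hfZ, hsz⟩ := exists_hull LClass_zf hκo (hκo.subset_of_mem hωκ)
    (mem_LClass_of_ord hκo) hδo hω (hκo.mem_trans hδ hlκ) hfK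
  have hM := hZ.zf hK
  have hfix : ∀ {x}, x ∈ δ → collapse Z x = x := fun hx =>
    collapse_of_subset hδo.isTransitive hδZ hx
  have hpair : ∀ {a b}, a ∈ δ → b ∈ δ → pair a b ∈ Z ∧ collapse Z (pair a b) = pair a b := by
    intro a b ha hb
    have hv : ∀ i, (![a, b] : Fin 2 → ZFSet.{0}) i ∈ Z := by
      simp [Fin.forall_fin_succ, hδZ ha, hδZ hb]
    have hT : Tm ZF fun v : Fin 2 → ZFSet.{0} => pair (v 0) (v 1) := inferInstance
    refine ⟨hZ.term hK hT hv, (hZ.collapse_term hK hM hT hv).trans ?_⟩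
    simp [hfix ha, hfix hb]
  have hff : collapse Z f = f := by
    ext q
    rw [mem_collapse]
    constructor
    · rintro ⟨q, hq, -, rfl⟩
      obtain ⟨a, ha, b, hb, rfl⟩ := hfδ q hq
      rwa [(hpair ha hb).2]
    · intro hq
      obtain ⟨a, ha, b, hb, rfl⟩ := hfδ q hq
      exact ⟨_, hq, hpair ha hb⟩
  have hR : Df ZF fun W (v : Fin 1 → ZFSet.{0}) => ∃ β ∈ W, IsOrd β ∧ v 0 ∈ Lstage β :=
    inferInstance
  have := (hZ.transfer hK hM hK.trans hR ![f] (by simp [hfZ])).2 (by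
    have : f ∈ LW κ.toSet := ⟨α, hακ, hf⟩
    exact ⟨α, mem_Lstage_of_mem hκo hακ, hα, hf⟩)
  obtain ⟨β, hβM, hβ, hfβ⟩ := this
  have hfβ : f ∈ Lstage β := by simpa [hff] using hfβ
  have hβo := isOrd_iff.1 hβ
  refine Lstage_mono (hlo.subset_of_mem ?_) hfβ
  refine (hβo.mem_or_subset hlo).resolve_right fun hsub => ?_
  have h1 : Sz LClass δ lam :=
    Sz.map LClass_zf (F := collapse) inferInstance (mem_LClass_of_ord hδo) hZL hsz fun b hb =>
      mem_collapseSet.1 (hM.trans _ hβM _ (hsub hb))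
  obtain ⟨g, hg, hs⟩ := Sz.exists_surj LClass_zf (mem_LClass_of_ord hδo) (mem_LClass_of_ord hlo)
    h1 ⟨δ, hδ⟩
  exact hlam.2 δ hδ g hg hs

/-! ### The downward Löwenheim–Skolem theorem inside `H_κ` -/

/-- A Gödel numbering of formulas. -/
def Fml.code : ∀ {n : ℕ}, Fml n → ℕ
  | _, .mem i j => Nat.pair 0 (Nat.pair i j)
  | _, .eq i j => Nat.pair 1 (Nat.pair i j)
  | _, .inA i => Nat.pair 2 i
  | _, .inB i => Nat.pair 3 i
  | _, .not φ => Nat.pair 4 φ.code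
  | _, .and φ ψ => Nat.pair 5 (Nat.pair φ.code ψ.code)
  | _, .ex φ => Nat.pair 6 φ.code

theorem Fml.code_injective {n : ℕ} : Function.Injective (Fml.code (n := n)) := by
  intro φ ψ h
  induction φ with
  | mem i j => cases ψ <;> simp_all [Fml.code, Nat.pair_eq_pair, Fin.val_inj]
  | eq i j => cases ψ <;> simp_all [Fml.code, Nat.pair_eq_pair, Fin.val_inj]
  | inA i => cases ψ <;> simp_all [Fml.code, Nat.pair_eq_pair, Fin.val_inj]
  | inB i => cases ψ <;> simp_all [Fml.code, Nat.pair_eq_pair, Fin.val_inj]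
  | not φ ih => cases ψ with
    | not ψ =>
      simp only [Fml.code, Nat.pair_eq_pair, true_and] at h
      rw [ih h]
    | _ => simp_all [Fml.code, Nat.pair_eq_pair]
  | and φ φ' ih ih' => cases ψ with
    | and ψ ψ' =>
      simp only [Fml.code, Nat.pair_eq_pair, true_and] at h
      rw [ih h.1, ih' h.2]
    | _ => simp_all [Fml.code, Nat.pair_eq_pair]
  | ex φ ih => cases ψ with
    | ex ψ =>
      simp only [Fml.code, Nat.pair_eq_pair, true_and] at h
      rw [ih h]
    | _ => simp_all [Fml.code, Nat.pair_eq_pair]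

/-- `x` is a witness in `S` for the formula with code `k` and the parameters in the tuple `t`. -/
def Witness (S : Set ZFSet.{0}) (c t x : ZFSet.{0}) : Prop :=
  ∃ (n : ℕ) (φ : Fml (n + 1)) (v : Fin n → ZFSet.{0}),
    c = natZ (φ.code + 1) ∧ t = tup v ∧ Sat S φ (Fin.cons x v)

/-- Pairing, and a choice of witnesses in `S`. -/
def chooseW (S : Set ZFSet.{0}) (_ q : ZFSet.{0}) : ZFSet.{0} :=
  if zfst q = ∅ then zsnd q
  else if h : ∃ x ∈ S, Witness S (zfst q) (zfst (zsnd q)) x then h.choose else ∅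

theorem Cl_mem_Hset {κ : ZFSet.{0}} (hκ : IsRegular κ) (hω : ZFSet.omega ∈ κ)
    {h : ZFSet.{0} → ZFSet.{0} → ZFSet.{0}} {p C a : ZFSet.{0}} (hC : C ∈ Hset κ)
    (ha : a ∈ Hset κ) (hh : ∀ c ∈ Hset κ, ∀ A ∈ Hset κ, ∀ B ∈ Hset κ,
      h p (pair c (pair A B)) ∈ Hset κ) : Cl h p C a ∈ Hset κ := by
  have hH := Hset_zf hκ hω
  have hU : ∀ {x y}, x ∈ Hset κ → y ∈ Hset κ → x ∪ y ∈ Hset κ := fun {x y} hx hy =>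
    (inferInstance : Tm ZF fun v : Fin 2 → ZFSet.{0} => v 0 ∪ v 1).mem _ hH ![x, y]
      (by simp [Fin.forall_fin_two, hx, hy])
  have hP : ∀ {x y}, x ∈ Hset κ → y ∈ Hset κ → zprod x y ∈ Hset κ := fun {x y} hx hy =>
    (inferInstance : Tm ZF fun v : Fin 2 → ZFSet.{0} => zprod (v 0) (v 1)).mem _ hH ![x, y]
      (by simp [Fin.forall_fin_two, hx, hy])
  have hk : ∀ k, iterF (fun q A => A ∪ img (fun e => h (zfst q) e) (zprod (zsnd q) (zprod A A)))
      (pair (pair p C) a) (natZ k) ∈ Hset κ := by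
    intro k
    induction k with
    | zero => rwa [iterF_zero, zsnd_pair]
    | succ k ih =>
      rw [iterF_succ]
      refine hU ih (Hset_img hκ hω (card_lt_of_mem_Hset hκ
        (hP (by simpa using hC) (hP ih ih))) fun x hx => ?_)
      obtain ⟨c, hc, y, hy, rfl⟩ := mem_zprod.1 hx
      obtain ⟨A, hA, B, hB, rfl⟩ := mem_zprod.1 hy
      simp only [zfst_pair, zsnd_pair] at hc ⊢
      exact hh c (hH.trans _ hC _ hc) A (hH.trans _ ih _ hA) B (hH.trans _ ih _ hB)
  refine hH.sUnion _ (Hset_img hκ hω (hκ.1.card_lt hω) fun n hn => ?_)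
  obtain ⟨k, rfl⟩ := mem_omega.1 hn
  exact hk k

theorem exists_elemSub_Hset {κ a : ZFSet.{0}} (hκ : IsRegular κ) (hω : ZFSet.omega ∈ κ)
    (ha : a ∈ Hset κ) : ∃ N ∈ Hset κ, ElemSub N (Hset κ) ∧ a ⊆ N := by
  have hH := Hset_zf hκ hω
  have hωH := Hset_of_mem hκ hω hω
  have hmem : ∀ c ∈ Hset κ, ∀ A ∈ Hset κ, ∀ B ∈ Hset κ,
      chooseW (Hset κ) ∅ (pair c (pair A B)) ∈ Hset κ := by
    intro c hc A hA B hB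
    unfold chooseW
    simp only [zfst_pair, zsnd_pair]
    split_ifs with h1 h2
    exacts [hH.pair_mem hA hB, h2.choose_spec.1, hH.empty]
  set N := Cl (chooseW (Hset κ)) ∅ ZFSet.omega (insert ∅ a) with hN
  have hNH : N ∈ Hset κ := Cl_mem_Hset hκ hω hωH (hH.insert hH.empty ha) hmem
  have h0 : ∅ ∈ N := subset_Cl (by simp)
  have htup : ∀ {n} (v : Fin n → ZFSet.{0}), (∀ i, v i ∈ N) → tup v ∈ N := by
    intro n v hv
    induction n with
    | zero => exact h0
    | succ n ih =>
      have := Cl_step (h := chooseW (Hset κ)) (p := ∅) (nat_mem_omega 0) (hv 0)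
        (ih (Fin.tail v) fun i => hv i.succ)
      rw [chooseW, zfst_pair, if_pos (show natZ 0 = ∅ from rfl), zsnd_pair] at this
      exact this
  refine ⟨N, hNH, elemSub_of_exists (fun x hx => hH.trans _ hNH _ hx) fun {n} φ v hv hex => ?_,
    fun x hx => subset_Cl (by simp [hx])⟩
  obtain ⟨x, hx, hφ⟩ := hex
  have hw : ∃ x ∈ Hset κ, Witness (Hset κ) (natZ (φ.code + 1)) (tup v) x :=
    ⟨x, hx, n, φ, v, rfl, rfl, hφ⟩
  have := Cl_step (h := chooseW (Hset κ)) (p := ∅) (nat_mem_omega (φ.code + 1)) (htup v hv) h0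
  simp only [chooseW, zfst_pair, zsnd_pair, natZ_succ_ne, if_false, dif_pos hw] at this
  refine ⟨_, this, ?_⟩
  obtain ⟨m, ψ, w, e1, e2, hψ⟩ := hw.choose_spec.2
  obtain ⟨rfl, -⟩ := tup_inj e2
  obtain rfl := tup_injective e2
  obtain rfl := Fml.code_injective (Nat.succ_injective (natZ_injective e1))
  exact hψ

/-! ### Countable elementary submodels inside `H_κ` -/

instance {n : ℕ} {f g : (Fin n → ZFSet.{0}) → ZFSet.{0}} [Tm ZF f] [Tm ZF g] :
    Df ZF fun W v => Sz W (f v) (g v) := by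
  refine Df.comp2 (P := fun W x y => Sz W x y) ?_
  unfold Sz
  infer_instance

/-- `x` contains witnesses for all existential statements with parameters in `x` that hold
in `N`. -/
def ClosedIn (x N : ZFSet.{0}) : Prop :=
  ∀ A ∈ DD N, ∀ t ∈ Tup x, (∃ z ∈ N, pair z t ∈ A) → ∃ z ∈ x, pair z t ∈ A

instance {n : ℕ} {f g : (Fin n → ZFSet.{0}) → ZFSet.{0}} [Tm ZF f] [Tm ZF g] :
    Df ZF fun _ v => ClosedIn (f v) (g v) := by
  refine Df.comp2 (P := fun _ x y => ClosedIn x y) ?_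
  unfold ClosedIn
  infer_instance

theorem ClosedIn.elemSub {x N : ZFSet.{0}} (hx : x ⊆ N) (h : ClosedIn x N) :
    ElemSub x N.toSet := by
  refine elemSub_of_exists (fun z hz => hx hz) fun {n} φ v hv hex => ?_
  obtain ⟨z, hz, hφ⟩ := hex
  have hmem : ∀ y, pair y (tup v) ∈ relS N (Sat N.toSet φ) ↔
      y ∈ N ∧ Sat N.toSet φ (Fin.cons y v) :=
    fun y => by rw [pair_mem_relS, tup_mem_relS fun i => hx (hv i)]
  obtain ⟨y, hy, hA⟩ := h _ (relS_sat_mem_DD φ) (tup v) (mem_Tup.2 ⟨n, v, hv, rfl⟩)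
    ⟨z, hz, (hmem z).2 ⟨hz, hφ⟩⟩
  exact ⟨y, hy, ((hmem y).1 hA).2⟩

theorem ElemSub.trans {x N : ZFSet.{0}} {S : Set ZFSet.{0}} (h : ElemSub x N.toSet)
    (h' : ElemSub N S) : ElemSub x S :=
  ⟨fun _ hy => h'.mem (h.mem hy), fun φ v hv => (h.2 φ v hv).trans (h'.2 φ v fun i => h.mem (hv i))⟩

theorem Sz.countable {W : Set ZFSet.{0}} {x : ZFSet.{0}} (h : Sz W ZFSet.omega x) :
    x.toSet.Countable := by
  obtain ⟨g, -, hg⟩ := h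
  refine (Set.countable_range fun k => app g (natZ k)).mono fun b hb => ?_
  obtain ⟨a, ha, rfl⟩ := hg b hb
  obtain ⟨k, rfl⟩ := mem_omega.1 ha
  exact ⟨k, rfl⟩

theorem natZ_mem_of_elemSub {X : ZFSet.{0}} {S : Set ZFSet.{0}} (hS : ZF S) (hX : ElemSub X S)
    (k : ℕ) : natZ k ∈ X :=
  hX.term hS (f := fun _ : Fin 0 → ZFSet.{0} => natZ k) inferInstance (v := Fin.elim0)
    fun i => i.elim0

theorem ElemSub.infinite {X : ZFSet.{0}} {S : Set ZFSet.{0}} (hS : ZF S) (hX : ElemSub X S) :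
    X.toSet.Infinite :=
  infinite_of_omega_subset fun z hz => by
    obtain ⟨k, rfl⟩ := mem_omega.1 hz
    exact natZ_mem_of_elemSub hS hX k

theorem ElemSub.subset_of_sz {X y : ZFSet.{0}} {S : Set ZFSet.{0}} (hS : ZF S) (hX : ElemSub X S)
    (hy : y ∈ X) (h : Sz S ZFSet.omega y) : y ⊆ X := by
  have hω : ZFSet.omega ∈ X := hX.term hS (f := fun _ : Fin 0 → ZFSet.{0} => ZFSet.omega)
    inferInstance (v := Fin.elim0) fun i => i.elim0
  obtain ⟨g, hg, h⟩ := hX.exists hS (n := 2)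
    (R := fun _ w => ∀ b ∈ Fin.tail w 1, ∃ a ∈ Fin.tail w 0, app (w 0) a = b) inferInstance
    (v := ![ZFSet.omega, y]) (by simp [Fin.forall_fin_two, hω, hy]) h
  intro b hb
  obtain ⟨a, ha, rfl⟩ := h b hb
  obtain ⟨k, rfl⟩ := mem_omega.1 ha
  exact hX.term hS (f := fun v : Fin 2 → ZFSet.{0} => app (v 0) (v 1)) inferInstance
    (v := ![g, natZ k]) (by simp [Fin.forall_fin_two, hg, natZ_mem_of_elemSub hS hX k])

theorem ElemSub.tup_mem {X : ZFSet.{0}} {S : Set ZFSet.{0}} (hS : ZF S) (hX : ElemSub X S) {n : ℕ}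
    (v : Fin n → ZFSet.{0}) (hv : ∀ i, v i ∈ X) : tup v ∈ X := by
  induction n with
  | zero => exact natZ_mem_of_elemSub hS hX 0
  | succ n ih =>
    exact hX.term hS (f := fun v : Fin 2 → ZFSet.{0} => pair (v 0) (v 1)) inferInstance
      (v := ![v 0, tup (Fin.tail v)])
      (by simp [Fin.forall_fin_two, hv, ih (Fin.tail v) fun i => hv i.succ])

section Reflection

variable {κ : ZFSet.{0}} (hκ : IsRegular κ) (hω : ZFSet.omega ∈ κ)
include hκ hω

theorem mem_Hset_of_countable {x : ZFSet.{0}} (hx : ∀ z ∈ x, z ∈ Hset κ)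
    (hc : x.toSet.Countable) : x ∈ Hset κ := by
  refine Hset_of_subset hκ hω ?_ hx
  refine lt_of_le_of_lt ?_ (aleph0_le_card_omega.trans_lt (hκ.1.card_lt hω))
  have := ZFSet.cardinalMk_coe_sort (x := x)
  have h2 : Cardinal.mk x ≤ Cardinal.aleph0 := Cardinal.le_aleph0_iff_set_countable.2 hc
  rw [this] at h2
  simpa using h2

theorem sz_omega_of_countable {x : ZFSet.{0}} (hx : ∀ z ∈ x, z ∈ Hset κ)
    (hc : x.toSet.Countable) : Sz (Hset κ) ZFSet.omega x := by
  rcases x.toSet.eq_empty_or_nonempty with h0 | h0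
  · exact ⟨∅, (Hset_zf hκ hω).empty, fun b hb => absurd (show b ∈ x.toSet from hb) (by simp [h0])⟩
  obtain ⟨f, hf⟩ := hc.exists_eq_range h0
  have hfx : ∀ k, f k ∈ x := fun k => show f k ∈ x.toSet from hf ▸ ⟨k, rfl⟩
  refine ⟨gr (fun z => f (Function.invFun natZ z)) ZFSet.omega, ?_, fun b hb => ?_⟩
  · refine Hset_img hκ hω (hκ.1.card_lt hω) fun z hz => ?_
    have hH := Hset_zf hκ hω
    exact hH.pair_mem (hH.trans _ (Hset_of_mem hκ hω hω) _ hz) (hx _ (hfx _))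
  · have hb : b ∈ x.toSet := hb
    rw [hf] at hb
    obtain ⟨k, rfl⟩ := hb
    refine ⟨natZ k, nat_mem_omega k, ?_⟩
    rw [app_gr (nat_mem_omega k), Function.leftInverse_invFun natZ_injective]

theorem sz_omega_DD {N : ZFSet.{0}} (hN : N ∈ Hset κ) : Sz (Hset κ) ZFSet.omega (DD N) := by
  have hW := Hset_zf hκ hω
  have hωH := Hset_of_mem hκ hω hω
  refine Sz.Cl hW Tm.hD hωH (fun _ h => h) hN (hessenberg hW isOrdinal_omega (fun _ h => h) hωH)
    (Sz.refl hW hωH) ((Sz.refl hW hωH).mono fun x hx => ?_)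
  rw [ZFSet.mem_singleton.1 hx, show ({∅} : ZFSet.{0}) = natZ 1 by ext z; simp [natZ]]
  exact nat_mem_omega 1

theorem Hset_reflection {Q : Set ZFSet.{0} → ZFSet.{0} → Prop}
    (hQ : Df ZF fun W (w : Fin 1 → ZFSet.{0}) => Q W (w 0)) {p g : ZFSet.{0}}
    (hp : p.IsTransitive) (hpH : p ∈ Hset κ) (hgH : g ∈ Hset κ)
    (hall : ∀ X, ElemSub X (Hset κ) → CtblInf X → p ∈ X → g ∈ X → Q (Hset κ) (collapse X p))
    {X : ZFSet.{0}} (hX : ElemSub X (Hset κ)) (hXc : X.toSet.Countable) (hpX : p ∈ X) :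
    Q (Hset κ) (collapse X p) := by
  have hH := Hset_zf hκ hω
  have hQ' : ∀ {n : ℕ} {f : (Fin n → ZFSet.{0}) → ZFSet.{0}} [Tm ZF f],
      Df ZF fun W v => Q W (f v) := fun {_ _} _ => Df.comp1 hQ
  obtain ⟨N, hN, hNH, hsub⟩ := exists_elemSub_Hset hκ hω
    (a := insert p (insert g p)) (hH.insert hpH (hH.insert hgH hpH))
  obtain ⟨g', hg', hΦ⟩ := hX.exists hH (n := 1) (R := fun W w => ∃ N ∈ W,
      Fin.tail w 0 ⊆ N ∧ Fin.tail w 0 ∈ N ∧ w 0 ∈ N ∧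
      ∀ x ∈ W, x ⊆ N → Sz W ZFSet.omega x → ClosedIn x N → Fin.tail w 0 ∈ x → w 0 ∈ x →
        Q W (collapse x (Fin.tail w 0))) inferInstance (v := ![p]) (by simp [hpX])
    ⟨g, hgH, N, hN, fun x hx => hsub (by simp [show x ∈ p from hx]), hsub (by simp),
      hsub (by simp), fun x _ hxN hxω hc hpx hgx => by
        have hx := (hc.elemSub hxN).trans hNH
        exact hall x hx ⟨hxω.countable, hx.infinite hH⟩ hpx hgx⟩
  obtain ⟨N', hN', hΦ⟩ := hX.exists hH (n := 2) (R := fun W w =>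
      Fin.tail w 1 ⊆ w 0 ∧ Fin.tail w 1 ∈ w 0 ∧ Fin.tail w 0 ∈ w 0 ∧
      ∀ x ∈ W, x ⊆ w 0 → Sz W ZFSet.omega x → ClosedIn x (w 0) → Fin.tail w 1 ∈ x →
        Fin.tail w 0 ∈ x → Q W (collapse x (Fin.tail w 1))) inferInstance (v := ![g', p])
    (by simp [Fin.forall_fin_two, hpX, hg']) hΦ
  obtain ⟨hpN, hpN', hgN, hΦ⟩ : p ⊆ N' ∧ p ∈ N' ∧ g' ∈ N' ∧
      ∀ x ∈ Hset κ, x ⊆ N' → Sz (Hset κ) ZFSet.omega x → ClosedIn x N' → p ∈ x →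
        g' ∈ x → Q (Hset κ) (collapse x p) := hΦ
  have hN'H := hX.mem hN'
  have hDD : DD N' ⊆ X := hX.subset_of_sz hH
    (hX.term hH (f := fun v : Fin 1 → ZFSet.{0} => DD (v 0)) inferInstance (v := ![N'])
      (by simp [hN'])) (sz_omega_DD hκ hω hN'H)
  have hxX : X ∩ N' ⊆ X := fun z hz => (ZFSet.mem_inter.1 hz).1
  have hxN : X ∩ N' ⊆ N' := fun z hz => (ZFSet.mem_inter.1 hz).2
  have key := hΦ (X ∩ N') (Hset_subset hκ hω hN'H hxN) hxN
    (sz_omega_of_countable hκ hω (fun z hz => hX.mem (hxX hz)) (hXc.mono fun z hz => hxX hz))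
    (fun A hA t ht hex => ?_) (ZFSet.mem_inter.2 ⟨hpX, hpN'⟩) (ZFSet.mem_inter.2 ⟨hg', hgN⟩)
  · have : ∀ y, y ∈ p → collapse (X ∩ N') y = collapse X y := by
      intro y
      induction y using ZFSet.inductionOn with
      | _ y ih =>
        intro hy
        ext w
        simp only [mem_collapse]
        refine exists_congr fun z => and_congr_right fun hz => ?_
        have hzp := hp y hy hz
        rw [ih z hz hzp, ZFSet.mem_inter]
        exact and_congr_left fun _ => and_iff_left (hpN hzp)
    have e : collapse (X ∩ N') p = collapse X p := by
      ext w
      simp only [mem_collapse]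
      refine exists_congr fun z => and_congr_right fun hz => ?_
      rw [this z hz, ZFSet.mem_inter]
      exact and_congr_left fun _ => and_iff_left (hpN hz)
    rwa [e] at key
  · obtain ⟨n, v, hv, rfl⟩ := mem_Tup.1 ht
    obtain ⟨z, hz, h1, h2⟩ := hX.exists hH (n := 3)
      (R := fun _ w => w 0 ∈ Fin.tail w 0 ∧ pair (w 0) (Fin.tail w 1) ∈ Fin.tail w 2) inferInstance
      (v := ![N', tup v, A])
      (by simp [Fin.forall_fin_succ, hN', hDD hA, hX.tup_mem hH v fun i => hxX (hv i)])
      (let ⟨z, hz, h⟩ := hex; ⟨z, hH.trans _ hN'H _ hz, hz, h⟩)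
    exact ⟨z, ZFSet.mem_inter.2 ⟨hz, h1⟩, h2⟩

end Reflection

/-! ### Cardinals of `L` in collapses -/

/-- `δ` is a cardinal of `L` as computed in `W`. -/
def LCardAt (W : Set ZFSet.{0}) (δ : ZFSet.{0}) : Prop :=
  IsOrd δ ∧ ∀ α ∈ δ, ∀ f ∈ W, (∃ β ∈ W, IsOrd β ∧ f ∈ Lstage β) → ¬ IsSurjF α δ f

theorem Df.LCardAt : Df ZF fun W (w : Fin 1 → ZFSet.{0}) => LCardAt W (w 0) := by
  unfold SRPPaper.LCardAt
  infer_instance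

theorem LCard.lCardAt {δ : ZFSet.{0}} (h : LCard δ) (W : Set ZFSet.{0}) : LCardAt W δ :=
  ⟨h.1, fun α hα f _ hf => h.2 α hα f (let ⟨β, _, hβ⟩ := hf; ⟨β, hβ⟩)⟩

theorem IsSurjF.mem_pair {a b f q : ZFSet.{0}} (h : IsSurjF a b f) (hq : q ∈ f) :
    ∃ x ∈ a, ∃ y ∈ b, pair x y = q := by
  obtain ⟨x, hx, y, hy, rfl⟩ := ZFSet.mem_prod.1 (h.1.1 hq)
  exact ⟨x, hx, y, hy, rfl⟩

section Collapse

variable {κ : ZFSet.{0}} (hκ : IsRegular κ) (hω : ZFSet.omega ∈ κ)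
include hκ hω

theorem LCardAt.lCard {δ : ZFSet.{0}} (hδκ : δ ∈ κ) (hωδ : ZFSet.omega ⊆ δ)
    (h : LCardAt (Hset κ) δ) : LCard δ := by
  refine ⟨h.1, fun α hα f hf hs => ?_⟩
  have hδo := isOrd_iff.1 h.1
  have hfκ := (LCard_regular hκ).mem_Lstage hδκ hωδ hf fun q hq => by
    obtain ⟨x, hx, y, hy, e⟩ := hs.mem_pair hq
    exact ⟨x, hδo.mem_trans hx hα, y, hy, e⟩
  have : f ∈ (Lstage κ).toSet := hfκ
  rw [Lstage_regular_eq hκ hω] at this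
  obtain ⟨β, hβ, hfβ⟩ := this
  exact h.2 α hα f (Hset_trans _ (Lstage_mem_Hset hκ hω hβ) _ hfβ)
    ⟨β, Hset_of_mem hκ hω hβ, isOrd_iff.2 ((isOrd_iff.1 hκ.1.1).mem hβ), hfβ⟩ hs

variable {X : ZFSet.{0}} (hX : ElemSub X (Hset κ))
include hX

theorem omega_subset_collapse {γ : ZFSet.{0}} (hωγ : ZFSet.omega ⊆ γ) :
    ZFSet.omega ⊆ collapse X γ := by
  intro z hz
  obtain ⟨k, rfl⟩ := mem_omega.1 hz
  have hH := Hset_zf hκ hω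
  have e : collapse X (natZ k) = natZ k :=
    hX.collapse_term hH (hX.zf hH) (f := fun _ : Fin 0 → ZFSet.{0} => natZ k) inferInstance
      (v := Fin.elim0) fun i => i.elim0
  exact mem_collapse.2 ⟨natZ k, hωγ hz, natZ_mem_of_elemSub hH hX k, e⟩

theorem isOrd_collapse {γ : ZFSet.{0}} (hγ : γ ∈ X) (ho : IsOrd γ) : IsOrd (collapse X γ) := by
  have hH := Hset_zf hκ hω
  exact (hX.transfer hH (hX.zf hH) hH.trans (n := 1) (R := fun _ v => IsOrd (v 0)) inferInstance
    ![γ] (by simp [hγ])).2 ho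

theorem LCard.collapse_of_mem {γ₀ γ₁ : ZFSet.{0}} (h0 : γ₀ ∈ X) (h1 : γ₁ ∈ X) (h : γ₀ ∈ γ₁)
    (hωγ : ZFSet.omega ⊆ γ₀) (hL0 : LCard γ₀) (ho1 : IsOrd γ₁)
    (hL : LCard (collapse X γ₁)) : LCard (collapse X γ₀) := by
  have hH := Hset_zf hκ hω
  have hM := hX.zf hH
  have ho := isOrd_collapse hκ hω hX h0 hL0.1
  refine ⟨ho, fun α hα f hf hs => ?_⟩
  have hfL : f ∈ Lstage (collapse X γ₁) := hL.mem_Lstage (mem_collapse.2 ⟨γ₀, h, h0, rfl⟩)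
    (omega_subset_collapse hκ hω hX hωγ) hf fun q hq => by
      obtain ⟨x, hx, y, hy, e⟩ := hs.mem_pair hq
      exact ⟨x, (isOrd_iff.1 ho).mem_trans hx hα, y, hy, e⟩
  have hLM : Lstage (collapse X γ₁) ∈ (collapseSet X).toSet :=
    (inferInstance : Tm ZF fun v : Fin 1 → ZFSet.{0} => Lstage (v 0)).mem _ hM
      ![collapse X γ₁] fun i => by fin_cases i; exact collapse_mem h1
  obtain ⟨g, hg, rfl⟩ := mem_collapseSet.1 (hM.trans _ hLM _ hfL)
  obtain ⟨a, ha, haX, rfl⟩ := mem_collapse.1 hα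
  obtain ⟨hs', hg'⟩ := (hX.transfer hH hM hH.trans (n := 4)
    (R := fun _ v => IsSurjF (v 0) (v 1) (v 2) ∧ v 2 ∈ Lstage (v 3)) inferInstance
    ![a, γ₀, g, γ₁] (by simp [Fin.forall_fin_succ, haX, h0, hg, h1])).1 ⟨hs, hfL⟩
  exact hL0.2 a ha g ⟨γ₁, ho1, hg'⟩ hs'

theorem collapse_mem_regular (hXc : X.toSet.Countable) {γ : ZFSet.{0}} (hγ : γ ∈ X)
    (ho : IsOrd γ) : collapse X γ ∈ κ := by
  have hH := Hset_zf hκ hω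
  refine mem_of_mem_Hset hκ (isOrd_iff.1 (isOrd_collapse hκ hω hX hγ ho)) ?_
  exact (inferInstance : Tm ZF fun v : Fin 2 → ZFSet.{0} => collapse (v 0) (v 1)).mem _ hH
    ![X, γ] (by simp [Fin.forall_fin_two, hX.mem hγ,
      mem_Hset_of_countable hκ hω (fun z hz => hX.mem hz) hXc])

end Collapse

theorem omega_mem_aleph_one : ZFSet.omega ∈ Aleph 1 := by
  have h : ∃ α, (IsOrd α ∧ IsCard α ∧ ZFSet.omega ∈ α) ∧
      ∀ β ∈ α, ¬ (IsOrd β ∧ IsCard β ∧ ZFSet.omega ∈ β) := by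
    obtain ⟨κ, hκ, hω, -⟩ := exists_regular _ isOrdinal_omega
    by_contra hc
    push Not at hc
    have : ∀ α : ZFSet.{0}, ¬ (IsOrd α ∧ IsCard α ∧ ZFSet.omega ∈ α) := by
      intro α
      induction α using ZFSet.inductionOn with
      | _ α ih =>
        intro h
        obtain ⟨β, hβ, h1⟩ := hc α h
        exact ih β hβ h1
    exact this κ ⟨hκ.1.1, hκ.1, hω⟩
  change ZFSet.omega ∈ leastOrd fun κ => IsCard κ ∧ ZFSet.omega ∈ κ
  rw [leastOrd, dif_pos h]
  exact h.choose_spec.1.2.2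

/-- Proposition 2.12: the reflecting properties are downwards-closed among
`L`-cardinals `≥ ω₁`. -/
theorem statement5 (γ₀ γ₁ : ZFSet.{0}) (h1 : Aleph 1 ∈ γ₀ ∨ Aleph 1 = γ₀)
    (h2 : γ₀ ∈ γ₁) (hL0 : LCard γ₀) (hL1 : LCard γ₁) :
    (SRPL γ₁ → SRPL γ₀) ∧ (WRPL γ₁ → WRPL γ₀) := by
  have ho0 := isOrd_iff.1 hL0.1
  have ho1 := isOrd_iff.1 hL1.1
  have hω0 : ZFSet.omega ∈ γ₀ := by
    rcases h1 with h | rfl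
    · exact ho0.mem_trans omega_mem_aleph_one h
    · exact omega_mem_aleph_one
  have hωs := ho0.subset_of_mem hω0
  constructor
  · rintro ⟨κ, hκ, h1κ, hall⟩
    have hκo := isOrd_iff.1 hκ.1.1
    have h0κ := hκo.mem_trans h2 h1κ
    have hω := hκo.mem_trans hω0 h0κ
    refine ⟨κ, hκ, h0κ, fun X hX hXc hγX => ?_⟩
    refine LCardAt.lCard hκ hω (collapse_mem_regular hκ hω hX hXc.1 hγX hL0.1)
      (omega_subset_collapse hκ hω hX hωs) ?_
    exact Hset_reflection hκ hω Df.LCardAt ho0.isTransitive (Hset_of_mem hκ hω h0κ)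
      (Hset_of_mem hκ hω h1κ) (fun Y hY hYc h0Y h1Y => LCard.lCardAt
        (LCard.collapse_of_mem hκ hω hY h0Y h1Y h2 hωs hL0 hL1.1 (hall Y hY hYc h1Y)) _)
      hX hXc.1 hγX
  · rintro ⟨κ, hκ, h1κ, X, hX, hXc, h1X, hLX⟩
    have hκo := isOrd_iff.1 hκ.1.1
    have h0κ := hκo.mem_trans h2 h1κ
    have hω := hκo.mem_trans hω0 h0κ
    by_contra hW
    have hD : Df ZF fun W (w : Fin 1 → ZFSet.{0}) => ¬ LCardAt W (w 0) :=
      have := Df.LCardAt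
      inferInstance
    refine Hset_reflection hκ hω (Q := fun W x => ¬ LCardAt W x) hD ho1.isTransitive
      (Hset_of_mem hκ hω h1κ) (Hset_of_mem hκ hω h0κ) (fun Y hY hYc h1Y h0Y hc => hW ?_) hX hXc.1
      h1X (hLX.lCardAt _)
    have hLY := LCardAt.lCard hκ hω (collapse_mem_regular hκ hω hY hYc.1 h1Y hL1.1)
      (omega_subset_collapse hκ hω hY fun z hz => ho1.mem_trans (hωs hz) h2) hc
    exact ⟨κ, hκ, h0κ, Y, hY, hYc, h0Y,
      LCard.collapse_of_mem hκ hω hY h0Y h1Y h2 hωs hL0 hL1.1 hLY⟩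

end SRPPaper
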